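/- arXiv:2403.04312 — 2 statements merged into one kernel-verified Lean document; each statement's English description precedes it below -/
import Mathlib

section
/- Let d ≥ 2, let q ≡ 1 (mod d) be an odd prime power, let r be the smallest prime divisor of d, and let d_1,…,d_k be positive integers with d_1 > 1 and d_1 | d_2 | ⋯ | d_k | d. If q^r > max{(d + (k−1)r^{k−1})^2, e^{2(k−1)}}, then there exists a clique C = {v_1,…,v_k} in the generalized Paley graph GP(q^d, d) such that v_i has degree d_i over F_q for each i, and no two vertices of C are Galois conjugates with respect to the extension F_{q^d}/F_q. -/
open Polynomial


lemma kummer_deg {L Ω : Type*} [Field L] [Field Ω] [Algebra L Ω] [IsAlgClosed Ω] (e : ℕ)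
    (he : 0 < e) (ζ : L) (hζ : IsPrimitiveRoot ζ e) (a : L)
    (ha : ∀ l : ℕ, l.Prime → l ∣ e → ∀ b : L, b ^ l ≠ a) (α : Ω)
    (hα : α ^ e = algebraMap L Ω a) (R : L[X]) (hR : R.natDegree < e)
    (h0 : aeval α R = 0) : R = 0 := by
  by_contra hne
  have hintg : IsIntegral L α := by
    refine ⟨X ^ e - C a, monic_X_pow_sub_C a he.ne', ?_⟩
    simp [hα]
  set p := minpoly L α with hp
  have hpm : p.Monic := minpoly.monic hintg
  have hf : p.natDegree ≤ R.natDegree := by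
    exact natDegree_le_of_dvd (minpoly.dvd L α h0) hne
  have hf1 : 0 < p.natDegree := minpoly.natDegree_pos hintg
  set f := p.natDegree with hfdef
  have hfe : f < e := lt_of_le_of_lt hf hR
  have hα0 : α ≠ 0 := by
    rintro rfl
    rw [zero_pow he.ne'] at hα
    have ha0 : a = 0 := by
      have := hα.symm
      rwa [map_eq_zero] at this
    have he1 : e ≠ 1 := by omega
    refine ha e.minFac (Nat.minFac_prime he1) (Nat.minFac_dvd e) 0 ?_
    rw [ha0, zero_pow (Nat.minFac_prime he1).ne_zero]
  have hroots : ∀ x ∈ p.aroots Ω, ∃ η : L, x = algebraMap L Ω η * α := by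
    intro x hx
    have hx0 : aeval x p = 0 := (mem_aroots.1 hx).2
    have hdvd : p ∣ X ^ e - C a := minpoly.dvd L α (by simp [hα])
    have hxe : x ^ e = algebraMap L Ω a := by
      obtain ⟨w, hw⟩ := hdvd
      have := congrArg (aeval x) hw
      simp [hx0] at this
      exact sub_eq_zero.1 this
    have h1 : (x / α) ^ e = 1 := by
      rw [div_pow, hxe, hα, div_self]
      rw [← hα]; exact pow_ne_zero _ hα0
    have hζ' : IsPrimitiveRoot (algebraMap L Ω ζ) e :=
      hζ.map_of_injective (algebraMap L Ω).injective
    have : NeZero e := ⟨he.ne'⟩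
    obtain ⟨i, -, hi⟩ := hζ'.eq_pow_of_pow_eq_one h1
    refine ⟨ζ ^ i, ?_⟩
    rw [map_pow, hi, div_mul_cancel₀ _ hα0]
  have hprod : ∀ s : Multiset Ω, (∀ x ∈ s, ∃ η : L, x = algebraMap L Ω η * α) →
      ∃ η : L, s.prod = algebraMap L Ω η * α ^ s.card := by
    intro s
    induction s using Multiset.induction_on with
    | empty => intro _; exact ⟨1, by simp⟩
    | cons x s ih =>
      intro h
      obtain ⟨η, hη⟩ := ih (fun y hy => h y (Multiset.mem_cons_of_mem hy))
      obtain ⟨θ, hθ⟩ := h x (Multiset.mem_cons_self x s)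
      refine ⟨θ * η, ?_⟩
      rw [Multiset.prod_cons, hη, hθ, Multiset.card_cons, map_mul]; ring
  obtain ⟨η, hη⟩ := hprod _ hroots
  have hsplit : (p.map (algebraMap L Ω)).Splits := IsAlgClosed.splits _
  have hcard : (p.aroots Ω).card = f := by
    rw [aroots_def, ← hsplit.natDegree_eq_card_roots, natDegree_map]
  have hc0 : (p.map (algebraMap L Ω)).coeff 0 = (-1) ^ f * (p.aroots Ω).prod := by
    have := hsplit.coeff_zero_eq_prod_roots_of_monic (hpm.map _)
    rw [this, natDegree_map]
  rw [hη, hcard, coeff_map] at hc0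
  have hp0 : p.coeff 0 ≠ 0 := minpoly.coeff_zero_ne_zero hintg hα0
  have hη0 : η ≠ 0 := by
    rintro rfl
    simp at hc0; exact hp0 hc0
  have hαf : α ^ f = algebraMap L Ω ((-1) ^ f * p.coeff 0 / η) := by
    have h2 : algebraMap L Ω η ≠ 0 := by simpa using hη0
    rw [map_div₀, map_mul, hc0]
    rw [eq_div_iff h2]
    simp only [map_pow, map_neg, map_one]
    rw [← mul_assoc, ← mul_pow]; simp; ring
  set b0 := (-1) ^ f * p.coeff 0 / η
  have hg : ∃ b1 : L, α ^ (Nat.gcd f e) = algebraMap L Ω b1 := by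
    refine ⟨b0 ^ (Nat.gcdA f e) * a ^ (Nat.gcdB f e), ?_⟩
    rw [map_mul, map_zpow₀, map_zpow₀, ← hα, ← hαf, ← zpow_natCast α (Nat.gcd f e),
      Nat.gcd_eq_gcd_ab, zpow_add₀ hα0, zpow_mul, zpow_mul, zpow_natCast, zpow_natCast]
  obtain ⟨b1, hb1⟩ := hg
  set G := Nat.gcd f e
  have hGe : G ∣ e := Nat.gcd_dvd_right f e
  have hGf : G ≤ f := Nat.gcd_le_left e hf1
  obtain ⟨t, ht⟩ := hGe
  have ht1 : t ≠ 1 := by rintro rfl; omega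
  obtain ⟨s, hs⟩ := Nat.minFac_dvd t
  refine ha t.minFac (Nat.minFac_prime ht1) ((Nat.minFac_dvd t).trans ⟨G, by rw [ht]; ring⟩)
    (b1 ^ s) ?_
  apply (algebraMap L Ω).injective
  rw [← hα, map_pow, map_pow, ← hb1, ← pow_mul, ← pow_mul]
  congr 1
  rw [ht, mul_comm s, ← hs]


/-- if some root multiplicity of g is not divisible by l then γ/g is not an l-th power -/
lemma not_lpow {F : Type*} [Field F] (g : F[X]) (hg0 : g ≠ 0) (γ : F) (hγ : γ ≠ 0) (l : ℕ)
    (v : F) (hv : ¬ l ∣ g.rootMultiplicity v) (b : FractionRing F[X]) :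
    b ^ l ≠ algebraMap F[X] (FractionRing F[X]) (C γ) / algebraMap F[X] (FractionRing F[X]) g := by
  intro h
  obtain ⟨A, B, hB, rfl⟩ := IsFractionRing.div_surjective (A := F[X]) b
  have hB0 : B ≠ 0 := nonZeroDivisors.ne_zero hB
  have inj := IsFractionRing.injective F[X] (FractionRing F[X])
  have hB' : algebraMap F[X] (FractionRing F[X]) B ≠ 0 := by
    rwa [Ne, map_eq_zero_iff _ inj]
  have hg' : algebraMap F[X] (FractionRing F[X]) g ≠ 0 := by
    rwa [Ne, map_eq_zero_iff _ inj]
  rw [div_pow, div_eq_div_iff (pow_ne_zero _ hB') hg', ← map_pow, ← map_pow, ← map_mul,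
    ← map_mul] at h
  have h := inj h
  have hr : C γ * B ^ l ≠ 0 := mul_ne_zero (by simpa using hγ) (pow_ne_zero _ hB0)
  have hA0 : A ^ l * g ≠ 0 := by rw [h]; exact hr
  have h2 := congrArg (rootMultiplicity v) h
  have hA1 : A ^ l ≠ 0 := left_ne_zero_of_mul hA0
  rw [rootMultiplicity_mul hA0, rootMultiplicity_mul hr, rootMultiplicity_C, zero_add] at h2
  have hp : ∀ (P : F[X]), (P ^ l).rootMultiplicity v = l * P.rootMultiplicity v := by
    intro P
    classical
    rw [← count_roots, roots_pow, Multiset.count_nsmul, count_roots]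
  rw [hp, hp] at h2
  apply hv
  have := (Nat.dvd_add_right (Dvd.intro (rootMultiplicity v A) rfl)).1 (h2 ▸ Dvd.intro (rootMultiplicity v B) rfl : l ∣ l * rootMultiplicity v A + rootMultiplicity v g)
  exact this

lemma det_natDegree_le {F : Type*} [Field F] (e D : ℕ) (M : Matrix (Fin e) (Fin e) F[X])
    (h : ∀ i j, (M i j).natDegree ≤ D) : M.det.natDegree ≤ e * D := by
  rw [Matrix.det_apply]
  refine natDegree_sum_le_of_forall_le _ _ fun σ _ => ?_
  refine (natDegree_smul_le _ _).trans ?_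
  refine (natDegree_prod_le _ _).trans ?_
  refine (Finset.sum_le_sum (fun i _ => h _ _)).trans ?_
  simp

lemma nonvanish {F : Type*} [Field F] [Fintype F] (e D : ℕ) (he : 0 < e)
    (hdvd : e ∣ Fintype.card F - 1)
    (g : F[X]) (hγ : g.eval 0 ≠ 0)
    (hg : ∀ l : ℕ, l.Prime → l ∣ e → ∃ v : F, ¬ l ∣ g.rootMultiplicity v)
    (r : Fin e → F[X]) (hr : ∀ i, (r i).natDegree ≤ D) (hr0 : r ≠ 0)
    (hD : e * (D + g.natDegree) < Fintype.card F) :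
    ¬ X ^ Fintype.card F ∣ ∑ i, r i * g ^ ((Fintype.card F - 1) / e * (i : ℕ)) := by
  intro hX
  set N := Fintype.card F with hN
  set c := (N - 1) / e with hc
  have hce : c * e = N - 1 := Nat.div_mul_cancel hdvd
  have hN1 : 1 < N := Fintype.one_lt_card
  set γ := g.eval 0 with hγd
  have hg0 : g ≠ 0 := by rintro rfl; simp at hγd; exact hγ hγd
  set Y := g ^ c with hY
  have hYe : X ^ N ∣ g * Y ^ e - C γ := by
    have h1 : g * Y ^ e = g ^ N := by
      rw [hY, ← pow_mul, hce, ← pow_succ']; congr 1; omega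
    obtain ⟨p, hp⟩ := CharP.exists F
    have : Fact p.Prime := ⟨(CharP.char_is_prime F p)⟩
    obtain ⟨n, -, hn⟩ := FiniteField.card F p
    have h2 : g ^ N - C γ = (g - C γ) ^ N := by
      rw [hN, hn, sub_pow_char_pow, ← hn, ← C_pow, FiniteField.pow_card]
    rw [h1, h2]
    apply pow_dvd_pow_of_dvd
    rw [X_dvd_iff, coeff_zero_eq_eval_zero]; simp [hγd]
  have : NeZero e := ⟨he.ne'⟩
  let M : Matrix (Fin e) (Fin e) F[X] := fun j t =>
    if (j : ℕ) ≤ t then g * r (t - j) else C γ * r (t - j)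
  have hMdeg : ∀ i j, (M i j).natDegree ≤ D + g.natDegree := by
    intro i j
    dsimp only [M]
    split_ifs
    · refine natDegree_mul_le.trans ?_
      have := hr (j - i); omega
    · refine natDegree_mul_le.trans ?_
      have := hr (j - i); simp only [natDegree_C]; omega
  have key : ∀ (B : Type _) [CommRing B] (φ : F[X] →+* B) (y : B),
      φ g * y ^ e = φ (C γ) → ∀ j : Fin e, ∑ t, φ (M j t) * y ^ (t : ℕ) =
        φ g * y ^ (j : ℕ) * ∑ i, φ (r i) * y ^ (i : ℕ) := by
    intro B _ φ y hy j
    rw [Finset.mul_sum]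
    refine Fintype.sum_equiv (Equiv.subRight j) _ _ fun t => ?_
    simp only [Equiv.subRight_apply, M]
    have hjl := j.isLt
    have htl := t.isLt
    split_ifs with hle
    · have hval : ((t - j : Fin e) : ℕ) = t - j := Fin.sub_val_of_le hle
      rw [map_mul, hval]
      have : y ^ (t : ℕ) = y ^ (j : ℕ) * y ^ ((t : ℕ) - j) := by
        rw [← pow_add]; congr 1; omega
      rw [this]; ring
    · have hval : ((t - j : Fin e) : ℕ) = e + t - j := by
        rw [Fin.sub_def]
        simp only
        rw [Nat.mod_eq_of_lt (by omega)]; omega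
      rw [map_mul, hval, ← hy]
      have : y ^ (j : ℕ) * y ^ (e + (t : ℕ) - j) = y ^ e * y ^ (t : ℕ) := by
        rw [← pow_add, ← pow_add]; congr 1; omega
      linear_combination (- φ g * φ (r (t - j))) * this
  have hdet : M.det = 0 := by
    have h1 : X ^ N ∣ M.det := by
      let π := Ideal.Quotient.mk (Ideal.span {(X : F[X]) ^ N})
      have hy : π g * (π Y) ^ e = π (C γ) := by
        rw [← map_pow, ← map_mul, Ideal.Quotient.eq, Ideal.mem_span_singleton]; exact hYe
      have hR0 : ∑ i, π (r i) * (π Y) ^ (i : ℕ) = 0 := by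
        have : π (∑ i, r i * g ^ (c * (i : ℕ))) = 0 := by
          rw [Ideal.Quotient.eq_zero_iff_mem, Ideal.mem_span_singleton]; exact hX
        rw [map_sum] at this
        rw [← this]
        refine Finset.sum_congr rfl fun i _ => ?_
        simp only [hY, pow_mul, map_mul, map_pow]
      have hk := fun j => key _ π (π Y) hy j
      simp only [hR0, mul_zero] at hk
      have hmv : (π.mapMatrix M).mulVec (fun t => (π Y) ^ (t : ℕ)) = 0 := by
        ext j; simpa [Matrix.mulVec, dotProduct] using hk j
      have h3 := congrArg ((π.mapMatrix M).adjugate.mulVec) hmv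
      rw [Matrix.mulVec_mulVec, Matrix.adjugate_mul, Matrix.mulVec_zero, Matrix.smul_mulVec,
        Matrix.one_mulVec] at h3
      have h4 := congrFun h3 (0 : Fin e)
      simp at h4
      rw [← Ideal.mem_span_singleton, ← Ideal.Quotient.eq_zero_iff_mem]
      have h5 := RingHom.map_det π M
      rw [h5]; exact h4
    by_contra hne
    have := natDegree_le_of_dvd h1 hne
    rw [natDegree_X_pow] at this
    have h6 := det_natDegree_le e _ M hMdeg
    omega
  obtain ⟨w, hw0, hw⟩ := Matrix.exists_vecMul_eq_zero_iff.2 hdet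
  let L := FractionRing F[X]
  let Ω := AlgebraicClosure L
  have inj : Function.Injective (algebraMap F[X] L) := IsFractionRing.injective F[X] L
  have hg' : algebraMap F[X] L g ≠ 0 := by rwa [Ne, map_eq_zero_iff _ inj]
  let a : L := algebraMap F[X] L (C γ) / algebraMap F[X] L g
  obtain ⟨α, hα⟩ := IsAlgClosed.exists_pow_nat_eq (algebraMap L Ω a) he
  let φ : F[X] →+* Ω := (algebraMap L Ω).comp (algebraMap F[X] L)
  have hφ : φ g * α ^ e = φ (C γ) := by
    rw [hα]; simp only [φ, RingHom.comp_apply]; rw [← map_mul]; congr 1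
    exact mul_div_cancel₀ _ hg'
  have hφg : φ g ≠ 0 := by
    simp only [φ, RingHom.comp_apply]; rwa [Ne, map_eq_zero]
  have hk := fun j => key _ φ α hφ j
  have hsum : (∑ j, φ (w j) * α ^ (j : ℕ)) * (∑ i, φ (r i) * α ^ (i : ℕ)) = 0 := by
    have h1 : ∑ j, φ (w j) * (∑ t, φ (M j t) * α ^ (t : ℕ)) = 0 := by
      simp only [Finset.mul_sum]
      rw [Finset.sum_comm]
      refine Finset.sum_eq_zero fun t _ => ?_
      have := congrArg φ (congrFun hw t)
      simp only [Matrix.vecMul, dotProduct, Pi.zero_apply, map_zero, map_sum, map_mul] at this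
      simp only [← mul_assoc]
      rw [← Finset.sum_mul, this, zero_mul]
    simp only [hk] at h1
    have h2 : φ g * ((∑ j, φ (w j) * α ^ (j : ℕ)) * (∑ i, φ (r i) * α ^ (i : ℕ))) = 0 := by
      rw [← h1, Finset.sum_mul, Finset.mul_sum]
      refine Finset.sum_congr rfl fun j _ => by ring
    exact (mul_eq_zero.1 h2).resolve_left hφg
  obtain ⟨ζ0, hζ0⟩ : ∃ ζ : F, IsPrimitiveRoot ζ e := by
    classical
    obtain ⟨u, hu⟩ := IsCyclic.exists_generator (α := Fˣ)
    have hou : orderOf u = N - 1 := by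
      rw [orderOf_eq_card_of_forall_mem_zpowers hu, Nat.card_eq_fintype_card, Fintype.card_units]
    have h1 : IsPrimitiveRoot (u : F) (N - 1) := by
      rw [← hou]; exact (IsPrimitiveRoot.coe_units_iff).2 (IsPrimitiveRoot.orderOf u)
    exact ⟨_, h1.pow (by omega) hce.symm⟩
  have hζ : IsPrimitiveRoot (algebraMap F[X] L (C ζ0)) e :=
    (hζ0.map_of_injective (C_injective)).map_of_injective inj
  have hz : ∀ s : Fin e → F[X], ∑ j, φ (s j) * α ^ (j : ℕ) = 0 → s = 0 := by
    intro s hs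
    let S : L[X] := ∑ j, C (algebraMap F[X] L (s j)) * X ^ (j : ℕ)
    have hS : S = 0 := by
      refine kummer_deg e he _ hζ a ?_ α hα S ?_ ?_
      · intro l hl hle b
        obtain ⟨v, hv⟩ := hg l hl hle
        exact not_lpow g hg0 γ hγ l v hv b
      · refine lt_of_le_of_lt (natDegree_sum_le_of_forall_le (n := e - 1) _ _ fun j _ => ?_)
          (by omega)
        refine (natDegree_C_mul_X_pow_le _ _).trans (by omega)
      · simp only [S, map_sum, map_mul, map_pow, aeval_X, aeval_C]; exact hs
    ext1 j
    have := congrArg (fun P => coeff P (j : ℕ)) hS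
    simp only [S, finsetSum_coeff, coeff_C_mul_X_pow, coeff_zero] at this
    rw [Finset.sum_eq_single j] at this
    · simpa [map_eq_zero_iff _ inj] using this
    · intro b _ hb; rw [if_neg]; intro h; exact hb (Fin.ext h.symm)
    · simp
  rcases mul_eq_zero.1 hsum with h | h
  · exact hw0 (hz w h)
  · exact hr0 (hz r h)


lemma hasse_pow_dvd {F : Type*} [Field F] (g : F[X]) (n : ℕ) :
    ∀ k, g ^ (n - k) ∣ hasseDeriv k (g ^ n) := by
  induction n with
  | zero => intro k; simp
  | succ n ih =>
    intro k
    rw [pow_succ', hasseDeriv_mul]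
    refine Finset.dvd_sum fun ⟨a, b⟩ hab => ?_
    replace hab := Finset.HasAntidiagonal.mem_antidiagonal.1 hab
    simp only at hab ⊢
    rcases Nat.eq_zero_or_pos a with rfl | ha
    · simp only [hasseDeriv_zero']
      have : g ^ (n + 1 - k) ∣ g * g ^ (n - b) := by
        rw [← pow_succ']; exact pow_dvd_pow _ (by omega)
      exact this.trans (mul_dvd_mul_left _ (ih b))
    · exact Dvd.dvd.mul_left ((pow_dvd_pow _ (by omega)).trans (ih b)) _

lemma hasse_quot {F : Type*} [Field F] (g : F[X]) (hg : g ≠ 0) (r : F[X]) (n k : ℕ) (hk : k ≤ n) :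
    ∃ u, hasseDeriv k (r * g ^ n) = g ^ (n - k) * u ∧
      u.natDegree ≤ r.natDegree + k * g.natDegree := by
  have h1 : g ^ (n - k) ∣ hasseDeriv k (r * g ^ n) := by
    rw [hasseDeriv_mul]
    refine Finset.dvd_sum fun ⟨a, b⟩ hab => ?_
    replace hab := Finset.HasAntidiagonal.mem_antidiagonal.1 hab
    simp only at hab ⊢
    exact Dvd.dvd.mul_left ((pow_dvd_pow _ (by omega)).trans (hasse_pow_dvd g n b)) _
  obtain ⟨u, hu⟩ := h1
  refine ⟨u, hu, ?_⟩
  by_cases hu0 : u = 0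
  · simp [hu0]
  have h2 : (hasseDeriv k (r * g ^ n)).natDegree = (n - k) * g.natDegree + u.natDegree := by
    rw [hu, natDegree_mul (pow_ne_zero _ hg) hu0, natDegree_pow]
  have h3 := natDegree_hasseDeriv_le (r * g ^ n) k
  have h4 : (r * g ^ n).natDegree ≤ r.natDegree + n * g.natDegree := by
    refine natDegree_mul_le.trans ?_
    rw [natDegree_pow]
  obtain ⟨s, rfl⟩ := Nat.exists_eq_add_of_le hk
  have h5 : k + s - k = s := by omega
  rw [h5] at h2
  rw [add_mul] at h4
  omega

lemma dvd_of_hasse {F : Type*} [Field F] (P : F[X]) (x : F) (l : ℕ)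
    (h : ∀ k < l, (hasseDeriv k P).eval x = 0) : (X - C x) ^ l ∣ P := by
  rw [X_sub_C_pow_dvd_iff, X_pow_dvd_iff]
  intro d hd
  rw [← h d hd, ← taylor_coeff]; rfl

lemma exists_kernel {F : Type*} [Field F] {ι κ : Type*} [Fintype ι] [Fintype κ]
    (A : κ → ι → F) (h : Fintype.card κ < Fintype.card ι) :
    ∃ x : ι → F, x ≠ 0 ∧ ∀ k, ∑ i, A k i * x i = 0 := by
  have := LinearMap.ker_ne_bot_of_finrank_lt (f := Matrix.mulVecLin (Matrix.of A)) (by simpa using h)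
  obtain ⟨x, hx, hx0⟩ := (Submodule.ne_bot_iff _).1 this
  refine ⟨x, hx0, fun k => ?_⟩
  have := congrFun (LinearMap.mem_ker.1 hx) k
  simpa [Matrix.mulVec, dotProduct] using this

lemma stepanov {F : Type*} [Field F] [Fintype F] [DecidableEq F] (e D J l : ℕ) (he : 0 < e)
    (hdvd : e ∣ Fintype.card F - 1) (g : F[X]) (hγ : g.eval 0 ≠ 0)
    (hg : ∀ l : ℕ, l.Prime → l ∣ e → ∃ v : F, ¬ l ∣ g.rootMultiplicity v)
    (hD : e * (D + g.natDegree) < Fintype.card F) (hD0 : 0 < D) (hJ : 0 < J)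
    (hl : l ≤ Fintype.card F)
    (hcount : l * (D + J + l * g.natDegree) < e * J * D) (ζ : F) :
    l * (Finset.univ.filter fun x : F => g.eval x ^ ((Fintype.card F - 1) / e) = ζ).card ≤
      l * g.natDegree + D + Fintype.card F * g.natDegree + (J - 1) * Fintype.card F := by
  set N := Fintype.card F with hN
  set c := (N - 1) / e with hc
  have hce : c * e = N - 1 := Nat.div_mul_cancel hdvd
  have hN1 : 1 < N := Fintype.one_lt_card
  set M := g.natDegree with hM
  have hg0 : g ≠ 0 := by rintro rfl; simp at hγ
  have hq : ∀ (i b k : ℕ), ∃ u : F[X], k ≤ l + c * i →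
      hasseDeriv k (X ^ b * g ^ (l + c * i)) = g ^ (l + c * i - k) * u ∧
      u.natDegree ≤ b + k * M := by
    intro i b k
    by_cases hk : k ≤ l + c * i
    · obtain ⟨u, h1, h2⟩ := hasse_quot g hg0 (X ^ b) (l + c * i) k hk
      rw [natDegree_X_pow] at h2
      exact ⟨u, fun _ => ⟨h1, h2⟩⟩
    · exact ⟨0, fun h => absurd h hk⟩
  choose u hu using hq
  obtain ⟨lam, hlam0, hlam⟩ := exists_kernel
    (ι := Fin e × Fin J × Fin D) (κ := Fin l × Fin (D + J + l * M))
    (fun kt ijb => ζ ^ (ijb.1 : ℕ) *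
      ((X : F[X]) ^ (ijb.2.1 : ℕ) * u ijb.1 ijb.2.2 kt.1).coeff kt.2)
    (by simpa [mul_assoc] using hcount)
  have hid : ∀ k < l, ∑ ijb : Fin e × Fin J × Fin D, C (lam ijb * ζ ^ (ijb.1 : ℕ)) *
      ((X : F[X]) ^ (ijb.2.1 : ℕ) * u ijb.1 ijb.2.2 k) = 0 := by
    intro k hk
    ext t
    rw [finsetSum_coeff, coeff_zero]
    simp only [coeff_C_mul]
    by_cases ht : t < D + J + l * M
    · rw [← hlam (⟨k, hk⟩, ⟨t, ht⟩)]
      refine Finset.sum_congr rfl fun ijb _ => ?_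
      simp only; ring
    · refine Finset.sum_eq_zero fun ijb _ => ?_
      rw [coeff_eq_zero_of_natDegree_lt, mul_zero]
      refine lt_of_le_of_lt natDegree_mul_le ?_
      rw [natDegree_X_pow]
      have h1 := (hu ijb.1 ijb.2.2 k (by omega)).2
      have h2 := ijb.2.1.isLt
      have h3 := ijb.2.2.isLt
      have h4 : k * M ≤ l * M := Nat.mul_le_mul_right _ hk.le
      omega
  let r : Fin J → Fin e → F[X] := fun j i => ∑ b : Fin D, C (lam (i, j, b)) * X ^ (b : ℕ)
  have hrdeg : ∀ j i, (r j i).natDegree ≤ D := by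
    intro j i
    refine natDegree_sum_le_of_forall_le _ _ fun b _ => ?_
    exact (natDegree_C_mul_X_pow_le _ _).trans b.isLt.le
  let G : Fin J → F[X] := fun j => ∑ i, r j i * g ^ (c * (i : ℕ))
  let H : F[X] := ∑ j : Fin J, X ^ ((j : ℕ) * N) * G j
  have hH : H ≠ 0 := by
    intro hH0
    have hex : ∃ n : ℕ, ∃ h : n < J, r ⟨n, h⟩ ≠ 0 := by
      by_contra hcon
      push Not at hcon
      apply hlam0
      ext ⟨i, j, b⟩
      have h1 := congrFun (hcon j j.isLt) i
      have h2 := congrArg (fun P => coeff P (b : ℕ)) h1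
      simp only [r, finsetSum_coeff, coeff_C_mul_X_pow, Pi.zero_apply, coeff_zero] at h2
      rw [Finset.sum_eq_single b] at h2
      · simpa using h2
      · intro b' _ hb; rw [if_neg]; intro h; exact hb (Fin.ext h.symm)
      · simp
    classical
    obtain ⟨hj, hrj⟩ := Nat.find_spec hex
    set j0 := Nat.find hex
    have hmin : ∀ j : Fin J, (j : ℕ) < j0 → G j = 0 := by
      intro j hj'
      have := Nat.find_min hex hj'
      push Not at this
      have h1 := this j.isLt
      simp only [G]
      have h2 : r j = 0 := h1
      simp [h2]
    have hnv := nonvanish e D he hdvd g hγ hg (r ⟨j0, hj⟩) (hrdeg _) hrj hD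
    apply hnv
    change X ^ N ∣ G ⟨j0, hj⟩
    have h1 : X ^ (j0 * N) * X ^ N ∣ X ^ (j0 * N) * G ⟨j0, hj⟩ := by
      have h2 : X ^ (j0 * N) * G ⟨j0, hj⟩ = H - ∑ j ∈ Finset.univ.erase (⟨j0, hj⟩ : Fin J),
          X ^ ((j : ℕ) * N) * G j := by
        rw [eq_sub_iff_add_eq]
        exact Finset.add_sum_erase Finset.univ (fun j : Fin J => X ^ ((j : ℕ) * N) * G j)
          (Finset.mem_univ _)
      rw [h2, hH0, zero_sub, dvd_neg]
      refine Finset.dvd_sum fun j hj' => ?_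
      rcases lt_trichotomy (j : ℕ) j0 with h | h | h
      · rw [hmin j h]; simp
      · exact absurd (Fin.ext h) (Finset.ne_of_mem_erase hj')
      · refine Dvd.dvd.mul_right ?_ _
        rw [← pow_add]
        apply pow_dvd_pow
        nlinarith
    exact (mul_dvd_mul_iff_left (pow_ne_zero _ X_ne_zero)).1 h1
  let R : F[X] := g ^ l * H
  have hR : R ≠ 0 := mul_ne_zero (pow_ne_zero _ hg0) hH
  have hvan : ∀ x : F, g.eval x ^ c = ζ → (X - C x) ^ l ∣ R := by
    intro x hx
    have hXN : (X - C x) ^ l ∣ X ^ N - C x := by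
      obtain ⟨p, hp⟩ := CharP.exists F
      have : Fact p.Prime := ⟨(CharP.char_is_prime F p)⟩
      obtain ⟨n, -, hn⟩ := FiniteField.card F p
      have h2 : X ^ N - C x = (X - C x) ^ N := by
        rw [hN, hn, sub_pow_char_pow, ← hn, ← C_pow, FiniteField.pow_card]
      rw [h2]; exact pow_dvd_pow _ hl
    let R' : F[X] := ∑ ijb : Fin e × Fin J × Fin D, C (lam ijb * x ^ (ijb.2.1 : ℕ)) *
      (X ^ (ijb.2.2 : ℕ) * g ^ (l + c * (ijb.1 : ℕ)))
    have hRsum : R = ∑ ijb : Fin e × Fin J × Fin D, C (lam ijb) * X ^ ((ijb.2.1 : ℕ) * N) *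
      (X ^ (ijb.2.2 : ℕ) * g ^ (l + c * (ijb.1 : ℕ))) := by
      simp only [R, H, G, r]
      rw [Fintype.sum_prod_type, Finset.mul_sum]
      simp only [Fintype.sum_prod_type, Finset.mul_sum, Finset.sum_mul]
      rw [Finset.sum_comm]
      refine Finset.sum_congr rfl fun i _ => Finset.sum_congr rfl fun j _ =>
        Finset.sum_congr rfl fun b _ => ?_
      rw [pow_add]; ring
    have hdiff : (X - C x) ^ l ∣ R - R' := by
      rw [hRsum, ← Finset.sum_sub_distrib]
      refine Finset.dvd_sum fun ijb _ => ?_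
      rw [← sub_mul]
      refine Dvd.dvd.mul_right ?_ _
      rw [C_mul, ← mul_sub]
      refine Dvd.dvd.mul_left ?_ _
      rw [mul_comm _ N, pow_mul, C_pow]
      exact hXN.trans (sub_dvd_pow_sub_pow _ _ _)
    have hR' : (X - C x) ^ l ∣ R' := by
      apply dvd_of_hasse
      intro k hk
      simp only [R', map_sum, eval_finsetSum]
      have h1 := congrArg (eval x) (hid k hk)
      rw [eval_finsetSum, eval_zero] at h1
      have h2 : ∀ ijb : Fin e × Fin J × Fin D,
          eval x (hasseDeriv k (C (lam ijb * x ^ (ijb.2.1 : ℕ)) *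
            (X ^ (ijb.2.2 : ℕ) * g ^ (l + c * (ijb.1 : ℕ))))) =
          g.eval x ^ (l - k) * eval x (C (lam ijb * ζ ^ (ijb.1 : ℕ)) *
            ((X : F[X]) ^ (ijb.2.1 : ℕ) * u ijb.1 ijb.2.2 k)) := by
        intro ijb
        have h3 := (hu ijb.1 ijb.2.2 k (by omega)).1
        rw [← smul_eq_C_mul, map_smul, h3]
        have h4 : l + c * (ijb.1 : ℕ) - k = (l - k) + c * (ijb.1 : ℕ) := by omega
        rw [h4, pow_add, pow_mul]
        simp only [eval_smul, eval_mul, eval_pow, eval_C, eval_X, smul_eq_mul, hx]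
        ring
      rw [Finset.sum_congr rfl fun ijb _ => h2 ijb, ← Finset.mul_sum, h1, mul_zero]
    have := dvd_add hdiff hR'
    simpa using this
  set Z := Finset.univ.filter fun x : F => g.eval x ^ c = ζ with hZ
  have hprod : ∏ x ∈ Z, (X - C x) ^ l ∣ R := by
    apply Finset.prod_dvd_of_coprime
    · intro x _ y _ hxy
      exact IsCoprime.pow (isCoprime_X_sub_C_of_isUnit_sub (sub_ne_zero.2 hxy).isUnit)
    · intro x hx
      exact hvan x (Finset.mem_filter.1 hx).2
  have hdeg := natDegree_le_of_dvd hprod hR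
  rw [natDegree_prod _ _ (fun x _ => pow_ne_zero _ (X_sub_C_ne_zero x))] at hdeg
  simp only [natDegree_pow, natDegree_X_sub_C, mul_one, Finset.sum_const, smul_eq_mul] at hdeg
  rw [mul_comm] at hdeg
  refine hdeg.trans ?_
  refine natDegree_mul_le.trans ?_
  rw [natDegree_pow, ← hM]
  have hHdeg : H.natDegree ≤ D + N * M + (J - 1) * N := by
    refine natDegree_sum_le_of_forall_le _ _ fun j _ => ?_
    refine natDegree_mul_le.trans ?_
    rw [natDegree_X_pow]
    have h1 : (G j).natDegree ≤ D + N * M := by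
      refine natDegree_sum_le_of_forall_le _ _ fun i _ => ?_
      refine natDegree_mul_le.trans ?_
      rw [natDegree_pow, ← hM]
      have h2 := hrdeg j i
      have h3 : c * (i : ℕ) ≤ N := by
        have := Nat.mul_le_mul_left c i.isLt.le
        omega
      have h4 := Nat.mul_le_mul_right M h3
      omega
    have h5 : (j : ℕ) * N ≤ (J - 1) * N := Nat.mul_le_mul_right _ (by have := j.isLt; omega)
    omega
  omega


lemma stepanov_asymp (e M : ℕ) (he : 0 < e) : ∃ B s0 : ℕ, ∀ (F : Type) [Field F] [Fintype F]
    [DecidableEq F] (s : ℕ), s0 ≤ s → Fintype.card F = s ^ 2 → e ∣ Fintype.card F - 1 →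
    ∀ g : F[X], g.natDegree ≤ M → g.eval 0 ≠ 0 →
    (∀ l : ℕ, l.Prime → l ∣ e → ∃ v : F, ¬ l ∣ g.rootMultiplicity v) → ∀ ζ : F,
    e * (Finset.univ.filter fun x : F => g.eval x ^ ((Fintype.card F - 1) / e) = ζ).card ≤
      Fintype.card F + B * s := by
  set u : ℕ := 4 * e ^ 2 * (1 + e * M) + 1 with hu
  refine ⟨e * M + 2 * (e * M + u + 1), 2 * u + 4 * e * M + 4 * e + 1, ?_⟩
  intro F _ _ _ s hs hN hdvd g hgM hg0 hg ζ
  set n := (Finset.univ.filter fun x : F => g.eval x ^ ((Fintype.card F - 1) / e) = ζ).card with hn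
  have hsu : 2 * u ≤ s := by
    have : 0 ≤ 4 * e * M + 4 * e + 1 := Nat.zero_le _
    omega
  have hs1 : 1 ≤ s := by omega
  have hsM : 4 * (e * M) ≤ s := by
    have : 4 * e * M = 4 * (e * M) := by ring
    omega
  have hse : 4 * e ≤ s := by omega
  have hss : s ≤ s ^ 2 := by nlinarith
  set D := s ^ 2 / (2 * e) with hD
  have hD1 : D * (2 * e) ≤ s ^ 2 := Nat.div_mul_le_self _ _
  have hD2 : s ^ 2 < (D + 1) * (2 * e) := by
    rw [mul_comm]; exact Nat.lt_mul_div_succ _ (by positivity)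
  have hD3 : s ^ 2 ≤ 4 * e * D := by nlinarith
  have hD0 : 0 < D := by
    rcases Nat.eq_zero_or_pos D with h | h
    · rw [h] at hD3; nlinarith
    · exact h
  have hes : s ≤ e * s := Nat.le_mul_of_pos_left s he
  obtain ⟨l, hl⟩ : ∃ l, l + u = e * s := ⟨e * s - u, by omega⟩
  have hl2 : s ≤ 2 * l := by omega
  have h1 : e * (D + g.natDegree) < Fintype.card F := by
    rw [hN]
    have : e * g.natDegree ≤ e * M := Nat.mul_le_mul_left _ hgM
    nlinarith
  have h2 : l ≤ Fintype.card F := by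
    rw [hN]; nlinarith
  have hles : l ≤ e * s := by omega
  have h3 : l * (D + s + l * g.natDegree) < e * s * D := by
    have h4 : l * g.natDegree ≤ e * s * M := Nat.mul_le_mul hles hgM
    have h5 : l * (D + s + l * g.natDegree) ≤ l * D + (e * s) * (s + e * s * M) := by
      have : l * (s + l * g.natDegree) ≤ (e * s) * (s + e * s * M) :=
        Nat.mul_le_mul hles (by omega)
      nlinarith
    refine lt_of_le_of_lt h5 ?_
    have h8 : e * s * D = l * D + u * D := by rw [← hl]; ring
    rw [h8]
    have h6 : u * D > (e * s) * (s + e * s * M) := by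
      have : (4 * e ^ 2 * (1 + e * M)) * D = (e * (1 + e * M)) * (4 * e * D) := by ring
      have h7 : (e * (1 + e * M)) * s ^ 2 ≤ (e * (1 + e * M)) * (4 * e * D) :=
        Nat.mul_le_mul_left _ hD3
      rw [hu, add_mul, this]
      nlinarith
    omega
  have key := stepanov e D s l he hdvd g hg0 hg h1 hD0 hs1 h2 h3 ζ
  rw [← hn, hN] at key
  rw [hN]
  have hlpos : 0 < l := by omega
  refine Nat.le_of_mul_le_mul_left ?_ hlpos
  obtain ⟨t, hst⟩ : ∃ t, s = t + 1 := ⟨s - 1, by omega⟩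
  have k1 : l * g.natDegree ≤ l * M := Nat.mul_le_mul_left _ hgM
  have k2 : s ^ 2 * g.natDegree ≤ s ^ 2 * M := Nat.mul_le_mul_left _ hgM
  have k3 : s - 1 = t := by omega
  rw [k3] at key
  have k4 : e * (l * n) ≤ e * (l * M + D + s ^ 2 * M + t * s ^ 2) := Nat.mul_le_mul_left _ (by omega)
  have k5 : e * t * s ^ 2 ≤ (l + u) * s ^ 2 := by
    rw [hl]; exact Nat.mul_le_mul_right _ (Nat.mul_le_mul_left _ (by omega))
  have k6 : s ^ 2 ≤ 2 * l * s := by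
    rw [pow_two]; exact Nat.mul_le_mul_right _ hl2
  have k7 : (e * M + u + 1) * s ^ 2 ≤ (e * M + u + 1) * (2 * l * s) := Nat.mul_le_mul_left _ k6
  have k8 : l * (e * M) ≤ l * (e * M * s) := Nat.mul_le_mul_left _ (Nat.le_mul_of_pos_right _ hs1)
  clear_value u D n
  linarith

lemma stepanov_asymp' (e M : ℕ) (he : 0 < e) : ∃ B s0 : ℕ, ∀ (F : Type) [Field F] [Fintype F]
    [DecidableEq F] (s : ℕ), s0 ≤ s → Fintype.card F = s ^ 2 → e ∣ Fintype.card F - 1 →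
    ∀ g : F[X], g ≠ 0 → g.natDegree ≤ M →
    (∀ l : ℕ, l.Prime → l ∣ e → ∃ v : F, ¬ l ∣ g.rootMultiplicity v) → ∀ ζ : F,
    e * (Finset.univ.filter fun x : F => g.eval x ^ ((Fintype.card F - 1) / e) = ζ).card ≤
      Fintype.card F + B * s := by
  obtain ⟨B, s0, h⟩ := stepanov_asymp e M he
  refine ⟨B, s0 + M + 1, ?_⟩
  intro F _ _ _ s hs hN hdvd g hg0 hgM hg ζ
  obtain ⟨w, hw⟩ : ∃ w, g.eval w ≠ 0 := by
    by_contra hcon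
    push Not at hcon
    apply hg0
    refine eq_zero_of_natDegree_lt_card_of_eval_eq_zero g Function.injective_id (fun i => hcon i) ?_
    rw [hN]; nlinarith
  have := h F s (by omega) hN hdvd (g.comp (X + C w)) (by simpa [natDegree_comp] using hgM)
    (by simpa using hw) ?_ ζ
  · refine le_trans (le_of_eq ?_) this
    congr 1
    refine Finset.card_bij' (fun x _ => x - w) (fun x _ => x + w) ?_ ?_ ?_ ?_ <;> simp
  · intro l hl hle
    obtain ⟨v, hv⟩ := hg l hl hle
    refine ⟨v - w, ?_⟩
    rw [rootMultiplicity_eq_rootMultiplicity, comp_assoc]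
    rw [rootMultiplicity_eq_rootMultiplicity] at hv
    convert hv using 4
    simp [add_assoc]

lemma charsum_asymp (e M : ℕ) (he : 0 < e) : ∃ B s0 : ℕ, ∀ (F : Type) [Field F] [Fintype F]
    [DecidableEq F] (s : ℕ), s0 ≤ s → Fintype.card F = s ^ 2 → e ∣ Fintype.card F - 1 →
    ∀ g : F[X], g ≠ 0 → g.natDegree ≤ M →
    (∀ l : ℕ, l.Prime → l ∣ e → ∃ v : F, ¬ l ∣ g.rootMultiplicity v) → ∀ τ : F → ℂ,
    (∀ x, ‖τ x‖ ≤ 1) → τ 0 = 0 → (∑ ζ ∈ Finset.univ.filter (fun ζ : F => ζ ^ e = 1), τ ζ) = 0 →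
    ‖∑ x, τ (g.eval x ^ ((Fintype.card F - 1) / e))‖ ≤ B * s := by
  obtain ⟨B, s0, h⟩ := stepanov_asymp' e M he
  refine ⟨B + M, s0 + 1, ?_⟩
  intro F _ _ _ s hs hN hdvd g hg0 hgM hg τ hτ hτ0 hτs
  have key := h F s (by omega) hN hdvd g hg0 hgM hg
  set N := Fintype.card F with hNdef
  have hN1 : 1 < N := Fintype.one_lt_card
  set c := (N - 1) / e with hc
  have hce : c * e = N - 1 := Nat.div_mul_cancel hdvd
  have hc0 : c ≠ 0 := by rintro h0; rw [h0] at hce; omega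
  set T := Finset.univ.filter (fun ζ : F => ζ ^ e = 1) with hT
  set Z : F → Finset F := fun ζ => Finset.univ.filter fun x : F => g.eval x ^ c = ζ with hZ
  have hTe : T.card ≤ e := by
    have : T ⊆ (nthRoots e (1 : F)).toFinset := by
      intro x hx
      rw [Multiset.mem_toFinset, mem_nthRoots he]; simpa [hT] using hx
    refine (Finset.card_le_card this).trans ?_
    exact (Multiset.toFinset_card_le _).trans (card_nthRoots _ _)
  have hmem : ∀ x ∈ Finset.univ.filter (fun x : F => g.eval x ≠ 0), g.eval x ^ c ∈ T := by
    intro x hx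
    simp only [hT, Finset.mem_filter, Finset.mem_univ, true_and] at hx ⊢
    rw [← pow_mul, hce]
    exact FiniteField.pow_card_sub_one_eq_one _ hx
  have hT1 : ∀ ζ ∈ T, ζ ≠ 0 := by
    rintro ζ hζ rfl
    simp [hT, he.ne'] at hζ
  have hfil : ∀ ζ ∈ T, (Finset.univ.filter (fun x : F => g.eval x ≠ 0)).filter
      (fun x => g.eval x ^ c = ζ) = Z ζ := by
    intro ζ hζ
    ext x
    simp only [hZ, Finset.mem_filter, Finset.mem_univ, true_and]
    refine ⟨fun h => h.2, fun h => ⟨fun h0 => hT1 ζ hζ ?_, h⟩⟩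
    rw [← h, h0, zero_pow hc0]
  have hsum : ∑ x, τ (g.eval x ^ c) = ∑ ζ ∈ T, τ ζ * ((Z ζ).card : ℂ) := by
    rw [← Finset.sum_filter_of_ne (p := fun x => g.eval x ≠ 0),
      ← Finset.sum_fiberwise_of_maps_to hmem]
    · refine Finset.sum_congr rfl fun ζ hζ => ?_
      rw [hfil ζ hζ, Finset.sum_congr rfl (g := fun _ => τ ζ)]
      · rw [Finset.sum_const, nsmul_eq_mul, mul_comm]
      · intro x hx
        rw [(Finset.mem_filter.1 hx).2]
    · intro x _ hx h0
      apply hx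
      rw [h0, zero_pow hc0, hτ0]
  have hcard : N ≤ M + ∑ ζ ∈ T, (Z ζ).card := by
    have h1 : (Finset.univ.filter (fun x : F => g.eval x ≠ 0)).card = ∑ ζ ∈ T, (Z ζ).card := by
      rw [Finset.card_eq_sum_card_fiberwise hmem]
      exact Finset.sum_congr rfl fun ζ hζ => by rw [hfil ζ hζ]
    have h2 : (Finset.univ.filter (fun x : F => g.eval x = 0)).card ≤ M := by
      refine le_trans ?_ hgM
      refine le_trans ?_ (card_roots' g)
      refine le_trans ?_ (Multiset.toFinset_card_le _)
      refine Finset.card_le_card ?_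
      intro x hx
      simpa [hg0] using hx
    have h3 := Finset.card_filter_add_card_filter_not (s := (Finset.univ : Finset F))
      (fun x : F => g.eval x = 0)
    rw [Finset.card_univ] at h3
    rw [← h1]
    simp only [ne_eq]
    omega
  set b : ℝ := ((N : ℝ) + B * s) / e with hb
  have heR : (0 : ℝ) < e := by exact_mod_cast he
  have hle : ∀ ζ, ((Z ζ).card : ℝ) ≤ b := by
    intro ζ
    rw [hb, le_div_iff₀ heR, mul_comm]
    exact_mod_cast key ζ
  have hrew : ∑ ζ ∈ T, τ ζ * ((Z ζ).card : ℂ) = - ∑ ζ ∈ T, τ ζ * ((b - (Z ζ).card : ℝ) : ℂ) := by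
    have : ∑ ζ ∈ T, τ ζ * ((b - (Z ζ).card : ℝ) : ℂ) =
        (∑ ζ ∈ T, τ ζ) * b - ∑ ζ ∈ T, τ ζ * ((Z ζ).card : ℂ) := by
      rw [Finset.sum_mul, ← Finset.sum_sub_distrib]
      refine Finset.sum_congr rfl fun ζ _ => ?_
      push_cast; ring
    rw [this, hτs]; ring
  rw [hsum, hrew, norm_neg]
  calc ‖∑ ζ ∈ T, τ ζ * ((b - (Z ζ).card : ℝ) : ℂ)‖
      ≤ ∑ ζ ∈ T, (b - (Z ζ).card) := by
        refine norm_sum_le_of_le _ fun ζ _ => ?_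
        rw [norm_mul, Complex.norm_real, Real.norm_of_nonneg (sub_nonneg.2 (hle ζ))]
        exact mul_le_of_le_one_left (sub_nonneg.2 (hle ζ)) (hτ ζ)
    _ = T.card * b - ∑ ζ ∈ T, ((Z ζ).card : ℝ) := by
        rw [Finset.sum_sub_distrib, Finset.sum_const, nsmul_eq_mul]
    _ ≤ e * b - (N - M) := by
        have h1 : (N : ℝ) ≤ M + ∑ ζ ∈ T, ((Z ζ).card : ℝ) := by exact_mod_cast hcard
        have h2 : (T.card : ℝ) * b ≤ e * b :=
          mul_le_mul_of_nonneg_right (by exact_mod_cast hTe) (by positivity)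
        linarith
    _ = B * s + M := by rw [hb]; field_simp; ring
    _ ≤ ((B + M : ℕ) : ℝ) * s := by
        have : (1 : ℝ) ≤ s := by exact_mod_cast (by omega : 1 ≤ s)
        push_cast
        nlinarith [(Nat.cast_nonneg M : (0 : ℝ) ≤ M)]


open UniqueFactorizationMonoid in
open scoped Classical in
lemma natDegree_eq_sum_prime_pow {E : Type} [Field E] (h : E[X]) (hm : h.Monic) (n : ℕ)
    (hn : h.natDegree = n) (P : Finset E[X]) (hP : ∀ p ∈ P, p.Monic ∧ Irreducible p)
    (hP' : ∀ p : E[X], p.Monic → Irreducible p → p.natDegree ≤ n → p ∈ P) :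
    n = ∑ p ∈ P, ∑ j ∈ Finset.Icc 1 n, if p ^ j ∣ h then p.natDegree else 0 := by
  classical
  have h0 : h ≠ 0 := hm.ne_zero
  have key : ∀ p ∈ P, (∑ j ∈ Finset.Icc 1 n, if p ^ j ∣ h then p.natDegree else 0) =
      (normalizedFactors h).count p * p.natDegree := by
    intro p hp
    obtain ⟨hpm, hpi⟩ := hP p hp
    have hiff : ∀ j, p ^ j ∣ h ↔ j ≤ (normalizedFactors h).count p := by
      intro j
      rw [pow_dvd_iff_le_emultiplicity, emultiplicity_eq_count_normalizedFactors hpi h0,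
        hpm.normalize_eq_self, Nat.cast_le]
    have hle : (normalizedFactors h).count p ≤ n := by
      have h1 := natDegree_le_of_dvd ((hiff _).2 le_rfl) h0
      rw [natDegree_pow, hn] at h1
      have h2 : 0 < p.natDegree := hpi.natDegree_pos
      nlinarith
    rw [← Finset.sum_filter, Finset.sum_const, smul_eq_mul]
    congr 1
    have : Finset.filter (fun j => p ^ j ∣ h) (Finset.Icc 1 n) =
        Finset.Icc 1 ((normalizedFactors h).count p) := by
      ext j
      simp only [Finset.mem_filter, Finset.mem_Icc, hiff]
      omega
    rw [this]; simp
  rw [Finset.sum_congr rfl key]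
  have hsub : (normalizedFactors h).toFinset ⊆ P := by
    intro p hp
    rw [Multiset.mem_toFinset] at hp
    have hpm : p.Monic := by
      have h1 := normalize_normalized_factor p hp
      have h2 := ne_zero_of_mem_normalizedFactors hp
      rw [← h1]; exact monic_normalize h2
    refine hP' p hpm (irreducible_of_normalized_factor p hp) ?_
    rw [← hn]
    exact natDegree_le_of_dvd (dvd_of_mem_normalizedFactors hp) h0
  rw [← Finset.sum_subset hsub]
  · have h1 := Finset.sum_multiset_map_count (normalizedFactors h) (fun p : E[X] => p.natDegree)
    simp only [smul_eq_mul] at h1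
    rw [← h1, ← natDegree_multiset_prod _ (zero_notMem_normalizedFactors h), ← hn]
    have := prod_normalizedFactors h0
    exact (natDegree_eq_of_degree_eq (degree_eq_degree_of_associated this)).symm
  · intro p _ hp
    rw [Multiset.mem_toFinset] at hp
    rw [Multiset.count_eq_zero_of_notMem hp, zero_mul]

lemma finite_polys {E : Type} [Field E] [Fintype E] (n : ℕ) : {h : E[X] | h.natDegree ≤ n}.Finite := by
  have : Set.InjOn (fun h : E[X] => fun i : Fin (n + 1) => h.coeff i) {h : E[X] | h.natDegree ≤ n} := by
    intro h hh g hg hgh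
    ext i
    by_cases hi : i < n + 1
    · exact congrFun hgh ⟨i, hi⟩
    · simp only [Set.mem_ofPred_eq] at hh hg
      rw [coeff_eq_zero_of_natDegree_lt (by omega), coeff_eq_zero_of_natDegree_lt (by omega)]
  exact Set.Finite.of_finite_image (Set.toFinite _) this

/-- Monic polynomials of degree `n` over a finite field. -/
noncomputable def monicDeg (E : Type) [Field E] [Fintype E] (n : ℕ) : Finset E[X] :=
  ((finite_polys (E := E) n).subset (t := {h : E[X] | h.Monic ∧ h.natDegree = n})
    (fun _ hh => hh.2.le)).toFinset

lemma mem_monicDeg {E : Type} [Field E] [Fintype E] {n : ℕ} {h : E[X]} :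
    h ∈ monicDeg E n ↔ h.Monic ∧ h.natDegree = n := by simp [monicDeg]

/-- Monic irreducible polynomials of degree at most `n`. -/
noncomputable def irrDeg (E : Type) [Field E] [Fintype E] (n : ℕ) : Finset E[X] :=
  ((finite_polys (E := E) n).subset (t := {h : E[X] | (h.Monic ∧ Irreducible h) ∧ h.natDegree ≤ n})
    (fun _ hh => hh.2)).toFinset

lemma mem_irrDeg {E : Type} [Field E] [Fintype E] {n : ℕ} {h : E[X]} :
    h ∈ irrDeg E n ↔ (h.Monic ∧ Irreducible h) ∧ h.natDegree ≤ n := by simp [irrDeg]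

/-- Coefficients of the L-function. -/
noncomputable def Lcoeff {E : Type} [Field E] [Fintype E] (Ψ : E[X] →* ℂ) (n : ℕ) : ℂ :=
  ∑ h ∈ monicDeg E n, Ψ h

open scoped Classical in
lemma sum_dvd {E : Type} [Field E] [Fintype E] (Ψ : E[X] →* ℂ) (n : ℕ) (g : E[X])
    (hg : g.Monic) :
    (∑ h ∈ (monicDeg E n).filter (fun h => g ∣ h), Ψ h) =
      if g.natDegree ≤ n then Ψ g * Lcoeff Ψ (n - g.natDegree) else 0 := by
  split_ifs with hn
  · rw [Lcoeff, Finset.mul_sum]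
    symm
    refine Finset.sum_bij (fun h _ => g * h) ?_ ?_ ?_ ?_
    · intro h hh
      rw [mem_monicDeg] at hh
      rw [Finset.mem_filter, mem_monicDeg]
      refine ⟨⟨hg.mul hh.1, ?_⟩, dvd_mul_right _ _⟩
      rw [hg.natDegree_mul hh.1, hh.2]; omega
    · intro a _ b _ hab
      exact mul_left_cancel₀ hg.ne_zero hab
    · intro b hb
      rw [Finset.mem_filter, mem_monicDeg] at hb
      obtain ⟨⟨hb1, hb2⟩, c, rfl⟩ := hb
      have hc : c.Monic := hg.of_mul_monic_left hb1
      refine ⟨c, ?_, rfl⟩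
      rw [mem_monicDeg]
      refine ⟨hc, ?_⟩
      rw [hg.natDegree_mul hc] at hb2
      omega
    · intro a _; rw [map_mul]
  · refine Finset.sum_eq_zero fun h hh => ?_
    rw [Finset.mem_filter, mem_monicDeg] at hh
    exact absurd ((natDegree_le_of_dvd hh.2 hh.1.1.ne_zero).trans hh.1.2.le) hn

lemma newton_aux {E : Type} [Field E] [Fintype E] (Ψ : E[X] →* ℂ) (n : ℕ) :
    (n : ℂ) * Lcoeff Ψ n = ∑ k ∈ Finset.Icc 1 n, (∑ p ∈ irrDeg E n, ∑ j ∈ Finset.Icc 1 n,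
      if j * p.natDegree = k then (p.natDegree : ℂ) * Ψ p ^ j else 0) * Lcoeff Ψ (n - k) := by
  classical
  have h1 : (n : ℂ) * Lcoeff Ψ n = ∑ p ∈ irrDeg E n, ∑ j ∈ Finset.Icc 1 n,
      (p.natDegree : ℂ) * (∑ h ∈ (monicDeg E n).filter (fun h => p ^ j ∣ h), Ψ h) := by
    have : ∀ h ∈ monicDeg E n, (n : ℂ) * Ψ h = ∑ p ∈ irrDeg E n, ∑ j ∈ Finset.Icc 1 n,
        if p ^ j ∣ h then (p.natDegree : ℂ) * Ψ h else 0 := by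
      intro h hh
      rw [mem_monicDeg] at hh
      have h2 := natDegree_eq_sum_prime_pow h hh.1 n hh.2 (irrDeg E n)
        (fun p hp => (mem_irrDeg.1 hp).1) (fun p a b c => mem_irrDeg.2 ⟨⟨a, b⟩, c⟩)
      have h3 := congrArg (fun t : ℕ => (t : ℂ) * Ψ h) h2
      refine h3.trans ?_
      push_cast
      simp only [Finset.sum_mul, ite_mul, zero_mul]
    rw [Lcoeff, Finset.mul_sum, Finset.sum_congr rfl this, Finset.sum_comm]
    refine Finset.sum_congr rfl fun p _ => ?_
    rw [Finset.sum_comm]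
    refine Finset.sum_congr rfl fun j _ => ?_
    rw [← Finset.sum_filter, Finset.mul_sum]
  rw [h1]
  simp only [Finset.sum_mul]
  symm
  rw [Finset.sum_comm]
  refine Finset.sum_congr rfl fun p hp => ?_
  rw [Finset.sum_comm]
  refine Finset.sum_congr rfl fun j hj => ?_
  rw [mem_irrDeg] at hp
  rw [sum_dvd Ψ n _ (hp.1.1.pow j), natDegree_pow]
  have hpos : 0 < j * p.natDegree := Nat.mul_pos (Finset.mem_Icc.1 hj).1 hp.1.2.natDegree_pos
  simp only [ite_mul, zero_mul]
  rw [Finset.sum_ite_eq]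
  simp only [Finset.mem_Icc]
  by_cases hle : j * p.natDegree ≤ n
  · rw [if_pos hle, if_pos ⟨hpos, hle⟩, map_pow]; ring
  · rw [if_neg hle, if_neg (fun h => hle h.2), mul_zero]

lemma card_minpoly_fiber {E L : Type} [Field E] [Fintype E] [Field L] [Fintype L] [DecidableEq L]
    [DecidableEq E]
    [Algebra E L] (p : E[X]) (hm : p.Monic) (hi : Irreducible p) :
    (Finset.univ.filter fun x : L => minpoly E x = p).card =
      if p.natDegree ∣ Module.finrank E L then p.natDegree else 0 := by
  have hintg : ∀ x : L, IsIntegral E x := fun x => Algebra.IsIntegral.isIntegral x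
  split_ifs with hd
  · have : Fact (Irreducible p) := ⟨hi⟩
    have : FiniteDimensional E (AdjoinRoot p) := (AdjoinRoot.powerBasis hi.ne_zero).finite
    have hfr : Module.finrank E (AdjoinRoot p) = p.natDegree := by
      rw [(AdjoinRoot.powerBasis hi.ne_zero).finrank, AdjoinRoot.powerBasis_dim]
    have : Finite (AdjoinRoot p) := Module.finite_of_finite E
    obtain ⟨φ⟩ := FiniteField.nonempty_algHom_of_finrank_dvd (F := E) (K := AdjoinRoot p) (L := L)
      (by rwa [hfr])
    set y := φ (AdjoinRoot.root p) with hy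
    have hy0 : aeval y p = 0 := by
      rw [hy, aeval_algHom_apply, AdjoinRoot.aeval_eq, AdjoinRoot.mk_self, map_zero]
    have hmin : minpoly E y = p := (minpoly.eq_of_irreducible_of_monic hi hy0 hm).symm
    have hspl : (p.map (algebraMap E L)).Splits := by
      rw [← hmin]; exact Normal.splits inferInstance y
    have hsep : p.Separable := PerfectField.separable_of_irreducible hi
    rw [← card_rootSet_eq_natDegree hsep hspl, Fintype.card_of_finset' (Finset.univ.filter fun x : L => minpoly E x = p)]
    intro x
    rw [Finset.mem_filter, mem_rootSet]
    simp only [Finset.mem_univ, true_and]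
    exact ⟨fun h => ⟨hi.ne_zero, by rw [← h]; exact minpoly.aeval E x⟩,
      fun h => (minpoly.eq_of_irreducible_of_monic hi h.2 hm).symm⟩
  · rw [Finset.card_eq_zero, Finset.filter_eq_empty_iff]
    rintro x _ rfl
    exact hd (minpoly.degree_dvd (hintg x))

/-- The sum over the extension field. -/
noncomputable def extSum {E : Type} [Field E] (Ψ : E[X] →* ℂ) (L : Type) [Field L] [Fintype L]
    [Algebra E L] : ℂ :=
  ∑ x : L, Ψ (minpoly E x) ^ (Module.finrank E L / (minpoly E x).natDegree)

lemma extSum_eq {E L : Type} [Field E] [Fintype E] [Field L] [Fintype L] [Algebra E L]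
    (Ψ : E[X] →* ℂ) (n : ℕ) (hn : Module.finrank E L ≤ n) :
    extSum Ψ L = ∑ p ∈ irrDeg E n, ∑ j ∈ Finset.Icc 1 n,
      if j * p.natDegree = Module.finrank E L then (p.natDegree : ℂ) * Ψ p ^ j else 0 := by
  classical
  have hintg : ∀ x : L, IsIntegral E x := fun x => Algebra.IsIntegral.isIntegral x
  have hpos : 0 < Module.finrank E L := Module.finrank_pos
  have hmaps : ∀ x ∈ (Finset.univ : Finset L), minpoly E x ∈ irrDeg E n := by
    intro x _
    rw [mem_irrDeg]
    exact ⟨⟨minpoly.monic (hintg x), minpoly.irreducible (hintg x)⟩,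
      (Nat.le_of_dvd hpos (minpoly.degree_dvd (hintg x))).trans hn⟩
  rw [extSum, ← Finset.sum_fiberwise_of_maps_to hmaps]
  refine Finset.sum_congr rfl fun p hp => ?_
  rw [mem_irrDeg] at hp
  have hpp : 0 < p.natDegree := hp.1.2.natDegree_pos
  rw [Finset.sum_congr rfl (g := fun _ => Ψ p ^ (Module.finrank E L / p.natDegree))
    (fun x hx => by rw [(Finset.mem_filter.1 hx).2]), Finset.sum_const,
    card_minpoly_fiber p hp.1.1 hp.1.2, nsmul_eq_mul]
  split_ifs with hd
  · obtain ⟨t, ht⟩ := hd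
    have ht0 : 0 < t := by
      rcases Nat.eq_zero_or_pos t with h | h
      · rw [h] at ht; omega
      · exact h
    have h1 : Module.finrank E L / p.natDegree = t := by rw [ht]; exact Nat.mul_div_cancel_left _ hpp
    rw [h1, Finset.sum_eq_single t, if_pos (by rw [ht, mul_comm])]
    · intro j _ hj
      rw [if_neg]
      intro h
      rw [ht, mul_comm] at h
      exact hj (Nat.eq_of_mul_eq_mul_left hpp h)
    · intro h
      exfalso; apply h
      rw [Finset.mem_Icc]
      refine ⟨ht0, le_trans ?_ hn⟩
      rw [ht]; exact Nat.le_mul_of_pos_left _ hpp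
  · rw [Nat.cast_zero, zero_mul]
    symm
    refine Finset.sum_eq_zero fun j _ => ?_
    rw [if_neg]
    intro h
    exact hd ⟨j, by rw [← h, mul_comm]⟩


lemma geom_prod (s : Multiset ℂ) :
    (PowerSeries.X : PowerSeries ℂ) * PowerSeries.derivative ℂ
        (s.map fun α => (1 - PowerSeries.C α * PowerSeries.X : PowerSeries ℂ)).prod =
      - (s.map fun α => (1 - PowerSeries.C α * PowerSeries.X : PowerSeries ℂ)).prod *
        (s.map fun α => PowerSeries.mk fun k => if k = 0 then 0 else α ^ k).sum := by
  induction s using Multiset.induction_on with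
  | empty => simp
  | cons α s ih =>
    simp only [Multiset.map_cons, Multiset.prod_cons, Multiset.sum_cons]
    rw [Derivation.leibniz, smul_eq_mul, smul_eq_mul, mul_add, mul_left_comm, ih]
    have h1 : PowerSeries.derivative ℂ (1 - PowerSeries.C α * PowerSeries.X : PowerSeries ℂ) =
        - PowerSeries.C α := by
      ext n
      rw [PowerSeries.coeff_derivative]
      rcases n with _ | n
      · simp [PowerSeries.coeff_one]
      · simp [PowerSeries.coeff_one, PowerSeries.coeff_succ_mul_X, PowerSeries.coeff_C]
    have h2 : (1 - PowerSeries.C α * PowerSeries.X : PowerSeries ℂ) *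
        (PowerSeries.mk fun k => if k = 0 then 0 else α ^ k) = PowerSeries.C α * PowerSeries.X := by
      ext n
      rw [sub_mul, one_mul, mul_assoc, map_sub, PowerSeries.coeff_C_mul, PowerSeries.coeff_C_mul]
      rcases n with _ | n
      · simp
      · rw [PowerSeries.coeff_succ_X_mul, PowerSeries.coeff_mk, PowerSeries.coeff_mk,
          PowerSeries.coeff_X]
        rcases n with _ | n
        · simp
        · simp [pow_succ]; ring
    rw [h1]
    have h3 : ∀ a b c d : PowerSeries ℂ, a * b = PowerSeries.C α * PowerSeries.X →
        a * (-c * d) + PowerSeries.X * (c * -PowerSeries.C α) = -(a * c) * (b + d) := by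
      intro a b c d h
      linear_combination c * h
    exact h3 _ _ _ _ h2

lemma exists_roots_psum (A T : ℕ → ℂ) (m : ℕ) (hm : 1 ≤ m) (hA0 : A 0 = 1) (hA : ∀ n, m ≤ n → A n = 0)
    (hN : ∀ n : ℕ, (n : ℂ) * A n = ∑ k ∈ Finset.Icc 1 n, T k * A (n - k)) :
    ∃ s : Multiset ℂ, s.card ≤ m - 1 ∧ ∀ k, 1 ≤ k → T k = - (s.map fun α => α ^ k).sum := by
  set P : ℂ[X] := ∑ i ∈ Finset.range m, C (A i) * X ^ i with hP
  have hcoeff : ∀ n, P.coeff n = A n := by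
    intro n
    rw [hP, finsetSum_coeff]
    simp only [coeff_C_mul_X_pow]
    rw [Finset.sum_ite_eq]
    split_ifs with h
    · rfl
    · rw [Finset.mem_range, not_lt] at h; rw [hA n h]
  have hdeg : P.natDegree ≤ m - 1 := by
    rw [natDegree_le_iff_coeff_eq_zero]
    intro n hn
    rw [hcoeff, hA n (by omega)]
  have hP0 : P ≠ 0 := by
    intro h
    have := hcoeff 0
    rw [h, hA0] at this
    simp at this
  have hspl : P.Splits := IsAlgClosed.splits P
  have hprod := hspl.eq_prod_roots
  have hne : ∀ r ∈ P.roots, r ≠ 0 := by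
    rintro r hr rfl
    have := (mem_roots hP0).1 hr
    rw [IsRoot, ← coeff_zero_eq_eval_zero, hcoeff, hA0] at this
    exact one_ne_zero this
  have hfac : P = ((P.roots.map fun r => r⁻¹).map fun α => (1 - C α * X : ℂ[X])).prod := by
    have h1 : (P.roots.map fun a => X - C a).prod =
        C (P.roots.map fun a => - a).prod *
          ((P.roots.map fun r => r⁻¹).map fun α => (1 - C α * X : ℂ[X])).prod := by
      rw [Multiset.map_map]
      rw [← Multiset.prod_hom _ C, Multiset.map_map, ← Multiset.prod_map_mul]
      congr 1
      refine Multiset.map_congr rfl fun r hr => ?_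
      simp only [Function.comp]
      have h2 : (C r * C r⁻¹ : ℂ[X]) = 1 := by
        rw [← C_mul, mul_inv_cancel₀ (hne r hr), C_1]
      rw [C_neg]
      linear_combination (-X) * h2
    rw [h1, ← mul_assoc, ← C_mul] at hprod
    have h3 := congrArg (eval 0) hprod
    rw [← coeff_zero_eq_eval_zero, hcoeff, hA0, eval_mul, eval_C, eval_multiset_prod,
      Multiset.map_map, Multiset.map_map] at h3
    have h4 : (Multiset.map ((eval 0 ∘ fun α : ℂ => 1 - C α * X) ∘ fun r => r⁻¹) P.roots).prod = 1 := by
      apply Multiset.prod_eq_one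
      intro x hx
      rw [Multiset.mem_map] at hx
      obtain ⟨r, -, rfl⟩ := hx
      simp
    rw [h4, mul_one] at h3
    rw [← h3, C_1, one_mul] at hprod
    exact hprod
  refine ⟨P.roots.map fun r => r⁻¹, ?_, ?_⟩
  · rw [Multiset.card_map]; exact (card_roots' P).trans hdeg
  set s := P.roots.map fun r => r⁻¹ with hs
  set Q : PowerSeries ℂ := (s.map fun α => (1 - PowerSeries.C α * PowerSeries.X : PowerSeries ℂ)).prod with hQ
  have hPQ : (P : PowerSeries ℂ) = Q := by
    conv_lhs => rw [hfac]
    rw [← coeToPowerSeries.ringHom_apply, map_multiset_prod, Multiset.map_map, hQ]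
    congr 1
    refine Multiset.map_congr rfl fun r _ => ?_
    simp [coeToPowerSeries.ringHom_apply]
  have hQc : ∀ n, PowerSeries.coeff n Q = A n := by
    intro n; rw [← hPQ, coeff_coe, hcoeff]
  have hgeom := geom_prod s
  rw [← hQ] at hgeom
  set U : PowerSeries ℂ := (s.map fun α => PowerSeries.mk fun k => if k = 0 then 0 else α ^ k).sum with hU
  set V : PowerSeries ℂ := PowerSeries.mk fun k => if k = 0 then 0 else T k with hV
  have hVQ : PowerSeries.X * PowerSeries.derivative ℂ Q = V * Q := by
    ext n
    rw [PowerSeries.coeff_mul n V Q, Finset.Nat.sum_antidiagonal_eq_sum_range_succ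
      (fun i j => PowerSeries.coeff i V * PowerSeries.coeff j Q)]
    rw [Finset.range_eq_Ico, Finset.sum_eq_sum_Ico_succ_bot (Nat.succ_pos n)]
    have h5 : Finset.Ico (0 + 1) n.succ = Finset.Icc 1 n := by ext; simp
    rw [h5]
    have h6 : ∑ k ∈ Finset.Icc 1 n, PowerSeries.coeff k V * PowerSeries.coeff (n - k) Q =
        (n : ℂ) * A n := by
      rw [hN]
      refine Finset.sum_congr rfl fun k hk => ?_
      rw [hQc, hV, PowerSeries.coeff_mk, if_neg]
      have := (Finset.mem_Icc.1 hk).1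
      omega
    rw [h6]
    have h7 : PowerSeries.coeff 0 V = 0 := by rw [hV, PowerSeries.coeff_mk, if_pos rfl]
    rw [h7, zero_mul, zero_add]
    rcases n with _ | n
    · simp
    · rw [PowerSeries.coeff_succ_X_mul, PowerSeries.coeff_derivative, hQc]
      push_cast; ring
  have hQ0 : Q ≠ 0 := by
    intro h
    have := hQc 0
    rw [h, hA0] at this
    simp at this
  have hVU : V = - U := by
    apply mul_right_cancel₀ hQ0
    rw [← hVQ, hgeom]; ring
  intro k hk
  have h8 := congrArg (PowerSeries.coeff k) hVU
  rw [hV, PowerSeries.coeff_mk, if_neg (by omega), map_neg, hU, map_multiset_sum, Multiset.map_map] at h8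
  rw [h8]
  congr 2
  refine Multiset.map_congr rfl fun α _ => ?_
  simp [show k ≠ 0 by omega]

lemma bound_of_psum (s : Multiset ℂ) (R B : ℝ) (hR : 0 < R) (n0 : ℕ)
    (h : ∀ n, n0 ≤ n → ‖(s.map fun α => α ^ n).sum‖ ≤ B * R ^ n) : ∀ α ∈ s, ‖α‖ ≤ R := by
  classical
  intro β hβ
  by_contra hcon
  push Not at hcon
  set W : ℂ[X] := ∏ γ ∈ s.toFinset.erase β, (X - C γ) with hW
  have hWβ : W.eval β ≠ 0 := by
    rw [hW, eval_prod, Finset.prod_ne_zero_iff]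
    intro γ hγ
    simp only [eval_sub, eval_X, eval_C]
    exact sub_ne_zero.2 (Finset.ne_of_mem_erase hγ).symm
  have hWγ : ∀ γ ∈ s.toFinset, γ ≠ β → W.eval γ = 0 := by
    intro γ hγ hne
    rw [hW, eval_prod, Finset.prod_eq_zero (Finset.mem_erase.2 ⟨hne, hγ⟩)]
    simp
  have hcount : 1 ≤ s.count β := Multiset.one_le_count_iff_mem.2 hβ
  have hid : ∀ n, ∑ i ∈ Finset.range (W.natDegree + 1), W.coeff i * (s.map fun α => α ^ (n + i)).sum
      = (s.count β : ℂ) * β ^ n * W.eval β := by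
    intro n
    have h1 : ∀ i, (s.map fun α => α ^ (n + i)).sum =
        ∑ γ ∈ s.toFinset, (s.count γ : ℂ) * γ ^ (n + i) := by
      intro i
      rw [Finset.sum_multiset_map_count]
      simp
    simp only [h1, Finset.mul_sum]
    rw [Finset.sum_comm]
    rw [Finset.sum_eq_single β]
    · rw [eval_eq_sum_range, Finset.mul_sum]
      refine Finset.sum_congr rfl fun i _ => ?_
      rw [pow_add]; ring
    · intro γ hγ hne
      have h2 : ∑ i ∈ Finset.range (W.natDegree + 1), W.coeff i * ((s.count γ : ℂ) * γ ^ (n + i)) =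
          (s.count γ : ℂ) * γ ^ n * W.eval γ := by
        rw [eval_eq_sum_range, Finset.mul_sum]
        refine Finset.sum_congr rfl fun i _ => ?_
        rw [pow_add]; ring
      rw [h2, hWγ γ hγ hne, mul_zero]
    · intro h; exact absurd (Multiset.mem_toFinset.2 hβ) h
  set D : ℝ := ∑ i ∈ Finset.range (W.natDegree + 1), ‖W.coeff i‖ * (B * R ^ i) with hD
  have hbd : ∀ n, n0 ≤ n → ‖β‖ ^ n * ‖W.eval β‖ ≤ D * R ^ n := by
    intro n hn
    have h3 : ‖β‖ ^ n * ‖W.eval β‖ ≤ ‖(s.count β : ℂ) * β ^ n * W.eval β‖ := by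
      rw [norm_mul, norm_mul, norm_pow]
      apply mul_le_mul_of_nonneg_right _ (norm_nonneg _)
      apply le_mul_of_one_le_left (by positivity)
      rw [Complex.norm_natCast]; exact_mod_cast hcount
    refine h3.trans ?_
    rw [← hid, hD, Finset.sum_mul]
    refine norm_sum_le_of_le _ fun i _ => ?_
    rw [norm_mul]
    have := h (n + i) (by omega)
    calc _ ≤ ‖W.coeff i‖ * (B * R ^ (n + i)) := mul_le_mul_of_nonneg_left this (norm_nonneg _)
      _ = _ := by rw [pow_add]; ring
  have hratio : 1 < ‖β‖ / R := by rw [one_lt_div hR]; exact hcon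
  have hpos : 0 < ‖W.eval β‖ := norm_pos_iff.2 hWβ
  obtain ⟨n, hn⟩ := pow_unbounded_of_one_lt (D / ‖W.eval β‖) hratio
  have h9 : D / ‖W.eval β‖ < (‖β‖ / R) ^ (n + n0) :=
    lt_of_lt_of_le hn (pow_le_pow_right₀ hratio.le (by omega))
  rw [div_lt_iff₀ hpos, div_pow, div_mul_eq_mul_div, lt_div_iff₀ (by positivity)] at h9
  exact absurd (hbd (n + n0) (by omega)) (not_le.2 h9)


lemma exists_root_of_pow_eq_one {L : Type} [Field L] [Fintype L] (e c : ℕ)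
    (hce : c * e = Fintype.card L - 1) (w : L) (hw : w ≠ 0) (h : w ^ c = 1) :
    ∃ t : L, t ≠ 0 ∧ t ^ e = w := by
  classical
  obtain ⟨g, hg⟩ := IsCyclic.exists_generator (α := Lˣ)
  have hord : orderOf g = Fintype.card L - 1 := by
    rw [orderOf_eq_card_of_forall_mem_zpowers hg, Nat.card_eq_fintype_card, Fintype.card_units]
  obtain ⟨k, hk⟩ := (mem_powers_iff_mem_zpowers).2 (hg (Units.mk0 w hw))
  simp only at hk
  have h1 : (Units.mk0 w hw) ^ c = 1 := by ext; simpa using h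
  rw [← hk, ← pow_mul] at h1
  have h2 := orderOf_dvd_of_pow_eq_one h1
  rw [hord, ← hce, mul_comm k c] at h2
  have hc0 : 0 < c := by
    rcases Nat.eq_zero_or_pos c with h0 | h0
    · rw [h0] at hce
      have : 1 < Fintype.card L := Fintype.one_lt_card
      omega
    · exact h0
  obtain ⟨t, rfl⟩ := Nat.dvd_of_mul_dvd_mul_left hc0 h2
  refine ⟨((g ^ t : Lˣ) : L), Units.ne_zero _, ?_⟩
  have := congrArg (Units.val) hk
  rw [Units.val_mk0] at this
  rw [← this, ← Units.val_pow_eq_pow_val, ← pow_mul, mul_comm]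

lemma norm_sub_eq {E L : Type} [Field E] [Fintype E] [Field L] [Fintype L] [Algebra E L] (v : E) (x : L) :
    Algebra.norm E (algebraMap E L v - x) =
      (minpoly E x).eval v ^ (Module.finrank E L / (minpoly E x).natDegree) := by
  have hx : IsIntegral E x := Algebra.IsIntegral.isIntegral x
  set pb := IntermediateField.adjoin.powerBasis hx with hpb
  set y : IntermediateField.adjoin E {x} := algebraMap E _ v - IntermediateField.AdjoinSimple.gen E x with hy
  have h1 : algebraMap E L v - x = algebraMap (IntermediateField.adjoin E {x}) L y := by
    rw [hy, map_sub, IntermediateField.AdjoinSimple.algebraMap_gen, ← IsScalarTower.algebraMap_apply]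
  have h2 : Algebra.norm E y = (minpoly E x).eval v := by
    rw [Algebra.norm_eq_matrix_det pb.basis, hy, map_sub]
    have h3 := charpoly_leftMulMatrix pb
    have h4 : pb.gen = IntermediateField.AdjoinSimple.gen E x := IntermediateField.adjoin.powerBasis_gen hx
    rw [h4, IntermediateField.minpoly_gen] at h3
    rw [← h3, Matrix.eval_charpoly, AlgHom.commutes]
    rfl
  have h5 : Module.finrank E L / (minpoly E x).natDegree =
      Module.finrank (IntermediateField.adjoin E {x}) L := by
    rw [← IntermediateField.adjoin.finrank hx]
    rw [← Module.finrank_mul_finrank E (IntermediateField.adjoin E {x}) L]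
    exact Nat.mul_div_cancel_left _ Module.finrank_pos
  rw [h1, ← Algebra.norm_norm (R := E) (S := IntermediateField.adjoin E {x}), Algebra.norm_algebraMap,
    map_pow, h2, h5]

/-- The completely multiplicative function attached to characters and points. -/
noncomputable def psiHom {E : Type} [Field E] {m : ℕ} (χ : MulChar E ℂ) (v : Fin m → E) (a : Fin m → ℕ) :
    E[X] →* ℂ where
  toFun h := ∏ i, (χ ^ (a i)) (h.eval (v i))
  map_one' := by simp
  map_mul' f g := by simp [Finset.prod_mul_distrib]

lemma extSum_psi {E L : Type} [Field E] [Fintype E] [Field L] [Fintype L] [Algebra E L] {m : ℕ}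
    (χ : MulChar E ℂ) (v : Fin m → E) (a : Fin m → ℕ) :
    extSum (psiHom χ v a) L = ∑ x : L, ∏ i, (χ ^ (a i)) (Algebra.norm E (algebraMap E L (v i) - x)) := by
  rw [extSum]
  refine Finset.sum_congr rfl fun x _ => ?_
  change (∏ i, (χ ^ (a i)) ((minpoly E x).eval (v i))) ^ _ = _
  rw [← Finset.prod_pow]
  refine Finset.prod_congr rfl fun i _ => ?_
  rw [norm_sub_eq, map_pow]

lemma Lcoeff_zero {E : Type} [Field E] [Fintype E] (Ψ : E[X] →* ℂ) : Lcoeff Ψ 0 = 1 := by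
  have : monicDeg E 0 = {1} := by
    ext h
    rw [mem_monicDeg, Finset.mem_singleton]
    exact ⟨fun hh => hh.1.natDegree_eq_zero.1 hh.2, by rintro rfl; simp [monic_one]⟩
  rw [Lcoeff, this, Finset.sum_singleton, map_one]

lemma Lcoeff_eq_zero {E : Type} [Field E] [Fintype E] {m : ℕ} (χ : MulChar E ℂ) (v : Fin m → E)
    (hv : Function.Injective v) (a : Fin m → ℕ) (i0 : Fin m) (hi : χ ^ (a i0) ≠ 1) (n : ℕ) (hn : m ≤ n) :
    Lcoeff (psiHom χ v a) n = 0 := by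
  classical
  obtain ⟨u, hu⟩ := MulChar.ne_one_iff.1 hi
  set B : E[X] := Lagrange.basis Finset.univ v i0 with hB
  have hB1 : B.eval (v i0) = 1 :=
    Lagrange.eval_basis_self (hv.injOn) (Finset.mem_univ _)
  have hB0 : ∀ i, i ≠ i0 → B.eval (v i) = 0 := fun i hi =>
    Lagrange.eval_basis_of_ne (Ne.symm hi) (Finset.mem_univ _)
  have hBd : B.degree < n := by
    rw [hB, Lagrange.degree_basis hv.injOn (Finset.mem_univ _), Finset.card_univ, Fintype.card_fin]
    have := i0.isLt
    exact_mod_cast (by omega : m - 1 < n)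
  have hmem : ∀ (h : E[X]) (t : E), h ∈ monicDeg E n → h + C t * B ∈ monicDeg E n := by
    intro h t hh
    rw [mem_monicDeg] at hh ⊢
    have hd : (C t * B).degree < h.degree := by
      rw [← smul_eq_C_mul]
      refine lt_of_le_of_lt (degree_smul_le _ _) ?_
      rw [degree_eq_natDegree hh.1.ne_zero, hh.2]; exact hBd
    refine ⟨hh.1.add_of_left hd, ?_⟩
    rw [natDegree_add_eq_left_of_degree_lt hd, hh.2]
  set Ψ := psiHom χ v a with hΨ
  have key : Lcoeff Ψ n = (χ ^ a i0) u * Lcoeff Ψ n := by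
    rw [Lcoeff, Finset.mul_sum]
    symm
    refine Finset.sum_bij' (fun h _ => h + C (((u : E) - 1) * h.eval (v i0)) * B)
      (fun h _ => h + C (((u⁻¹ : Eˣ) - 1 : E) * h.eval (v i0)) * B)
      (fun h hh => hmem _ _ hh) (fun h hh => hmem _ _ hh) ?_ ?_ ?_
    · intro h _
      simp only [eval_add, eval_mul, eval_C, hB1]
      rw [add_assoc, ← add_mul, ← C_add]
      have : ((u : E) - 1) * eval (v i0) h + ((u⁻¹ : Eˣ) - 1 : E) * (eval (v i0) h + ((u : E) - 1) * eval (v i0) h * 1) = 0 := by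
        have h1 : ((u⁻¹ : Eˣ) : E) * u = 1 := Units.inv_mul u
        linear_combination (eval (v i0) h) * h1
      rw [this]; simp
    · intro h _
      simp only [eval_add, eval_mul, eval_C, hB1]
      rw [add_assoc, ← add_mul, ← C_add]
      have : ((u⁻¹ : Eˣ) - 1 : E) * eval (v i0) h + ((u : E) - 1) * (eval (v i0) h + ((u⁻¹ : Eˣ) - 1 : E) * eval (v i0) h * 1) = 0 := by
        have h1 : ((u⁻¹ : Eˣ) : E) * u = 1 := Units.inv_mul u
        linear_combination (eval (v i0) h) * h1
      rw [this]; simp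
    · intro h _
      change _ * ∏ i, (χ ^ (a i)) (h.eval (v i)) = ∏ i, (χ ^ (a i)) (eval (v i) (h + C (((u : E) - 1) * h.eval (v i0)) * B))
      rw [← Finset.mul_prod_erase Finset.univ _ (Finset.mem_univ i0),
        ← Finset.mul_prod_erase Finset.univ (fun i => (χ ^ (a i)) (eval (v i) (h + C (((u : E) - 1) * h.eval (v i0)) * B))) (Finset.mem_univ i0)]
      rw [← mul_assoc, ← map_mul]
      congr 1
      · congr 1
        simp only [eval_add, eval_mul, eval_C, hB1]; ring
      · refine Finset.prod_congr rfl fun i hi => ?_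
        simp only [eval_add, eval_mul, eval_C, hB0 i (Finset.ne_of_mem_erase hi)]
        simp
  by_contra hne
  apply hu
  have := mul_right_cancel₀ hne (key.symm.trans (one_mul _).symm)
  exact this

lemma mulChar_norm_le_one {E : Type} [Field E] [Fintype E] (χ : MulChar E ℂ) (x : E) : ‖χ x‖ ≤ 1 := by
  by_cases hx : x = 0
  · rw [hx, χ.map_zero]; simp
  · have h1 : χ x ^ (Fintype.card E - 1) = 1 := by
      rw [← map_pow, FiniteField.pow_card_sub_one_eq_one x hx, map_one]
    have h2 : Fintype.card E - 1 ≠ 0 := by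
      have : 1 < Fintype.card E := Fintype.one_lt_card
      omega
    exact (Complex.norm_eq_one_of_pow_eq_one h1 h2).le

lemma exists_tau {E L : Type} [Field E] [Fintype E] [Field L] [Fintype L] [DecidableEq L] [Algebra E L]
    (χ : MulChar E ℂ) (e c : ℕ) (hχe : χ ^ e = 1) (hχ : χ ≠ 1) (hce : c * e = Fintype.card L - 1) :
    ∃ τ : L → ℂ, (∀ x, ‖τ x‖ ≤ 1) ∧ τ 0 = 0 ∧
      (∑ ζ ∈ Finset.univ.filter (fun ζ : L => ζ ^ e = 1), τ ζ) = 0 ∧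
      ∀ y, τ (y ^ c) = χ (Algebra.norm E y) := by
  have hN : 0 < Fintype.card L - 1 := by
    have : 1 < Fintype.card L := Fintype.one_lt_card
    omega
  have hc0 : c ≠ 0 := by rintro rfl; omega
  have he0 : e ≠ 0 := by rintro rfl; omega
  have hfac : Function.FactorsThrough (fun y : L => χ (Algebra.norm E y)) (fun y : L => y ^ c) := by
    intro y z hyz
    simp only at hyz ⊢
    by_cases hz : z = 0
    · rw [hz, zero_pow hc0] at hyz
      rw [hz, pow_eq_zero_iff hc0 |>.1 hyz]
    · have hy : y ≠ 0 := by
        rintro rfl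
        rw [zero_pow hc0] at hyz
        exact hz (pow_eq_zero_iff hc0 |>.1 hyz.symm)
      obtain ⟨t, ht0, ht⟩ := exists_root_of_pow_eq_one e c hce (y / z) (div_ne_zero hy hz)
        (by rw [div_pow, hyz, div_self (pow_ne_zero _ hz)])
      have h1 : y = t ^ e * z := by rw [ht]; field_simp
      rw [h1, map_mul, map_mul, map_pow, map_pow, ← MulChar.pow_apply' χ he0, hχe,
        MulChar.one_apply (Algebra.norm_ne_zero_iff.2 ht0).isUnit, one_mul]
  set τ : L → ℂ := Function.extend (fun y : L => y ^ c) (fun y : L => χ (Algebra.norm E y)) 0 with hτ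
  have hτy : ∀ y, τ (y ^ c) = χ (Algebra.norm E y) := fun y => hfac.extend_apply 0 y
  refine ⟨τ, ?_, ?_, ?_, hτy⟩
  · intro x
    by_cases hx : ∃ y, y ^ c = x
    · obtain ⟨y, rfl⟩ := hx
      rw [hτy]; exact mulChar_norm_le_one _ _
    · rw [hτ, Function.extend_apply' _ _ _ hx]; simp
  · have := hτy 0
    rw [zero_pow hc0, Algebra.norm_zero, χ.map_zero] at this
    exact this
  · obtain ⟨u, hu⟩ := MulChar.ne_one_iff.1 hχ
    obtain ⟨w, hw⟩ := FiniteField.norm_surjective E L (u : E)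
    have hw0 : w ≠ 0 := by
      rintro rfl
      rw [Algebra.norm_zero] at hw
      exact u.ne_zero hw.symm
    set S := Finset.univ.filter (fun ζ : L => ζ ^ e = 1) with hS
    have hwc : (w ^ c) ^ e = 1 := by
      rw [← pow_mul, hce, FiniteField.pow_card_sub_one_eq_one w hw0]
    have key : ∑ ζ ∈ S, τ ζ = χ u * ∑ ζ ∈ S, τ ζ := by
      rw [Finset.mul_sum]
      symm
      refine Finset.sum_bij' (fun ζ _ => ζ * w ^ c) (fun ζ _ => ζ * (w ^ c)⁻¹) ?_ ?_ ?_ ?_ ?_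
      · intro ζ hζ
        simp only [hS, Finset.mem_filter, Finset.mem_univ, true_and] at hζ ⊢
        rw [mul_pow, hζ, hwc, one_mul]
      · intro ζ hζ
        simp only [hS, Finset.mem_filter, Finset.mem_univ, true_and] at hζ ⊢
        rw [mul_pow, hζ, inv_pow, hwc, inv_one, one_mul]
      · intro ζ _
        rw [mul_assoc, mul_inv_cancel₀ (pow_ne_zero _ hw0), mul_one]
      · intro ζ _
        rw [mul_assoc, inv_mul_cancel₀ (pow_ne_zero _ hw0), mul_one]
      · intro ζ hζ
        simp only [hS, Finset.mem_filter, Finset.mem_univ, true_and] at hζ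
        have hζ0 : ζ ≠ 0 := by rintro rfl; rw [zero_pow he0] at hζ; exact zero_ne_one hζ
        obtain ⟨y, -, rfl⟩ := exists_root_of_pow_eq_one c e (by rw [mul_comm, hce]) ζ hζ0 hζ
        rw [← mul_pow, hτy, hτy, map_mul, map_mul, hw, mul_comm]
    by_contra hne
    exact hu (mul_right_cancel₀ hne (key.symm.trans (one_mul _).symm))


lemma extSum_bound {E : Type} [Field E] [Fintype E] (χ : MulChar E ℂ) (e m : ℕ)
    (hχ : orderOf χ = e) (he : 2 ≤ e) (v : Fin m → E) (hv : Function.Injective v)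
    (a : Fin m → ℕ) (ha0 : ∀ i, 0 < a i) (ha : ∀ l : ℕ, l.Prime → l ∣ e → ∃ i, ¬ l ∣ a i) :
    ∃ B t0 : ℕ, ∀ t, t0 ≤ t → ∀ (L : Type) [Field L] [Fintype L] [Algebra E L],
      Module.finrank E L = 2 * t → ‖extSum (psiHom χ v a) L‖ ≤ B * (Fintype.card E : ℝ) ^ t := by
  classical
  obtain ⟨B, s0, hB⟩ := charsum_asymp e (∑ i, a i) (by omega)
  refine ⟨B, s0, ?_⟩
  intro t ht L _ _ _ hfr
  have hQ : 1 < Fintype.card E := Fintype.one_lt_card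
  have hcard : Fintype.card L = (Fintype.card E ^ t) ^ 2 := by
    rw [Module.card_eq_pow_finrank (K := E), hfr, ← pow_mul, mul_comm]
  have hs : s0 ≤ Fintype.card E ^ t := ht.trans (Nat.lt_pow_self hQ).le
  have hdvd : e ∣ Fintype.card L - 1 := by
    have h1 : e ∣ Fintype.card E - 1 := by rw [← hχ]; exact MulChar.orderOf_dvd_card_sub_one _ χ
    refine h1.trans ?_
    rw [hcard, ← pow_mul]
    simpa using Nat.sub_dvd_pow_sub_pow (Fintype.card E) 1 (t * 2)
  set φ := algebraMap E L with hφ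
  set g : L[X] := ∏ i, (C (φ (v i)) - X) ^ (a i) with hg
  have hlin : ∀ i, (C (φ (v i)) - X : L[X]) ≠ 0 := by
    intro i h
    have := X_sub_C_ne_zero (φ (v i))
    apply this
    rw [← neg_sub, h, neg_zero]
  have hg0 : g ≠ 0 := by
    rw [hg, Finset.prod_ne_zero_iff]
    intro i _
    exact pow_ne_zero _ (hlin i)
  have hgdeg : g.natDegree ≤ ∑ i, a i := by
    rw [hg]
    refine (natDegree_prod_le _ _).trans (Finset.sum_le_sum fun i _ => ?_)
    rw [natDegree_pow]
    have : (C (φ (v i)) - X : L[X]).natDegree ≤ 1 := by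
      refine (natDegree_sub_le _ _).trans ?_
      simp
    nlinarith
  have hmult : ∀ i, g.rootMultiplicity (φ (v i)) = a i := by
    intro i
    have h1 : g = (X - C (φ (v i))) ^ (a i) * ((-1) ^ (a i) *
        ∏ j ∈ Finset.univ.erase i, (C (φ (v j)) - X) ^ (a j)) := by
      rw [hg, ← Finset.mul_prod_erase Finset.univ _ (Finset.mem_univ i), ← mul_assoc, ← mul_pow]
      congr 2
      ring
    rw [h1] at hg0
    rw [h1, rootMultiplicity_mul hg0, rootMultiplicity_X_sub_C_pow, rootMultiplicity_eq_zero, add_zero]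
    rw [IsRoot, eval_mul, eval_prod, mul_eq_zero, not_or]
    constructor
    · rw [eval_pow]
      apply pow_ne_zero
      simp
    · refine Finset.prod_ne_zero_iff.2 ?_
      intro j hj
      rw [eval_pow]
      apply pow_ne_zero
      simp only [eval_sub, eval_C, eval_X]
      rw [sub_ne_zero]
      intro h
      exact Finset.ne_of_mem_erase hj (hv (φ.injective h))
  have hχe : χ ^ e = 1 := by rw [← hχ]; exact pow_orderOf_eq_one χ
  have hχ1 : χ ≠ 1 := by
    rintro rfl
    rw [orderOf_one] at hχ; omega
  obtain ⟨τ, h1, h2, h3, h4⟩ := exists_tau (L := L) χ e ((Fintype.card L - 1) / e) hχe hχ1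
    (Nat.div_mul_cancel hdvd)
  have key := hB L (Fintype.card E ^ t) hs hcard hdvd g hg0 hgdeg
    (fun l hl hle => by
      obtain ⟨i, hi⟩ := ha l hl hle
      exact ⟨φ (v i), by rwa [hmult]⟩) τ h1 h2 h3
  rw [extSum_psi]
  push_cast at key
  convert key using 2
  refine Finset.sum_congr rfl fun x _ => ?_
  rw [h4, hg, eval_prod, map_prod, map_prod]
  refine Finset.prod_congr rfl fun i _ => ?_
  rw [eval_pow, eval_sub, eval_C, eval_X, map_pow, map_pow, MulChar.pow_apply' χ (ha0 i).ne']

lemma exists_ext {E : Type} [Field E] [Fintype E] (k : ℕ) (hk : 1 ≤ k) :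
    ∃ (L : Type) (_ : Field L) (_ : Fintype L) (_ : Algebra E L), Module.finrank E L = k := by
  obtain ⟨p, hp⟩ := CharP.exists E
  have : Fact p.Prime := ⟨(CharP.char_is_prime E p)⟩
  have : NeZero k := ⟨by omega⟩
  have : Finite (FiniteField.Extension E p k) := Module.finite_of_finite E
  exact ⟨FiniteField.Extension E p k, inferInstance, Fintype.ofFinite _, inferInstance,
    FiniteField.finrank_extension E p k⟩

theorem weil {E : Type} [Field E] [Fintype E] (χ : MulChar E ℂ) (e m : ℕ) (hm : 1 ≤ m)
    (hχ : orderOf χ = e) (he : 2 ≤ e) (v : Fin m → E) (hv : Function.Injective v)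
    (a : Fin m → ℕ) (ha0 : ∀ i, 0 < a i) (ha : ∀ l : ℕ, l.Prime → l ∣ e → ∃ i, ¬ l ∣ a i) :
    ‖∑ x : E, ∏ i, (χ ^ (a i)) (v i - x)‖ ≤ ((m : ℝ) - 1) * Real.sqrt (Fintype.card E) := by
  set Ψ := psiHom χ v a with hΨ
  obtain ⟨i0, hi0⟩ : ∃ i0, χ ^ (a i0) ≠ 1 := by
    obtain ⟨l, hl, hle⟩ := Nat.exists_prime_and_dvd (n := e) (by omega)
    obtain ⟨i, hi⟩ := ha l hl hle
    refine ⟨i, fun h => hi ?_⟩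
    exact hle.trans (hχ ▸ orderOf_dvd_of_pow_eq_one h)
  set T : ℕ → ℂ := fun k => ∑ p ∈ irrDeg E k, ∑ j ∈ Finset.Icc 1 k,
      if j * p.natDegree = k then (p.natDegree : ℂ) * Ψ p ^ j else 0 with hT
  have hText : ∀ (L : Type) [Field L] [Fintype L] [Algebra E L], extSum Ψ L = T (Module.finrank E L) := by
    intro L _ _ _
    exact extSum_eq Ψ _ le_rfl
  have hN : ∀ n : ℕ, (n : ℂ) * Lcoeff Ψ n = ∑ k ∈ Finset.Icc 1 n, T k * Lcoeff Ψ (n - k) := by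
    intro n
    rw [newton_aux]
    refine Finset.sum_congr rfl fun k hk => ?_
    rw [Finset.mem_Icc] at hk
    obtain ⟨L, _, _, _, hL⟩ := exists_ext (E := E) k hk.1
    congr 1
    have h1 := extSum_eq (L := L) Ψ n (by rw [hL]; exact hk.2)
    rw [hL] at h1
    rw [← h1, hText, hL]
  obtain ⟨s, hs, hsT⟩ := exists_roots_psum (Lcoeff Ψ) T m hm (Lcoeff_zero Ψ)
    (fun n hn => Lcoeff_eq_zero χ v hv a i0 hi0 n hn) hN
  obtain ⟨B, t0, hB⟩ := extSum_bound χ e m hχ he v hv a ha0 ha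
  have hQ : (0 : ℝ) < Fintype.card E := by exact_mod_cast Fintype.card_pos
  have hb := bound_of_psum (s.map fun α => α ^ 2) (Fintype.card E) B hQ (t0 + 1) (by
    intro t ht
    obtain ⟨L, _, _, _, hL⟩ := exists_ext (E := E) (2 * t) (by omega)
    have h1 := hB t (by omega) L hL
    rw [← hΨ, hText, hL, hsT _ (by omega), norm_neg] at h1
    rw [Multiset.map_map]
    simpa only [Function.comp_def, ← pow_mul] using h1)
  have hα : ∀ α ∈ s, ‖α‖ ≤ Real.sqrt (Fintype.card E) := by
    intro α hα
    have := hb (α ^ 2) (Multiset.mem_map_of_mem _ hα)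
    rw [norm_pow] at this
    exact Real.le_sqrt_of_sq_le this
  have h1 : ∑ x : E, ∏ i, (χ ^ (a i)) (v i - x) = T 1 := by
    have := hText E
    rw [Module.finrank_self, extSum_psi] at this
    rw [← this]
    simp [Algebra.norm_self]
  rw [h1, hsT 1 le_rfl, norm_neg]
  simp only [pow_one, Multiset.map_id']
  have h2 : ∀ s : Multiset ℂ, (∀ α ∈ s, ‖α‖ ≤ Real.sqrt (Fintype.card E)) →
      ‖s.sum‖ ≤ s.card * Real.sqrt (Fintype.card E) := by
    intro s
    induction s using Multiset.induction_on with
    | empty => simp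
    | cons α s ih =>
      intro h
      rw [Multiset.sum_cons, Multiset.card_cons]
      refine (norm_add_le _ _).trans ?_
      have h3 := h α (Multiset.mem_cons_self _ _)
      have h4 := ih (fun β hβ => h β (Multiset.mem_cons_of_mem hβ))
      push_cast
      linarith
  refine (h2 s hα).trans ?_
  apply mul_le_mul_of_nonneg_right _ (Real.sqrt_nonneg _)
  have : ((s.card : ℕ) : ℝ) ≤ ((m - 1 : ℕ) : ℝ) := by exact_mod_cast hs
  rw [Nat.cast_sub hm] at this
  simpa using this


lemma weil_gen {E : Type} [Field E] [Fintype E] (χ : MulChar E ℂ) (e m : ℕ) (hm : 1 ≤ m)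
    (hχ : orderOf χ = e) (he : 2 ≤ e) (v : Fin m → E) (hv : Function.Injective v)
    (a : Fin m → ℕ) (ha0 : ∀ i, 0 < a i) (ha : ∃ i, ¬ e ∣ a i) :
    ‖∑ x : E, ∏ i, (χ ^ (a i)) (v i - x)‖ ≤ ((m : ℝ) - 1) * Real.sqrt (Fintype.card E) := by
  classical
  set g := Nat.gcd e (Finset.univ.gcd a) with hg
  have hge : g ∣ e := Nat.gcd_dvd_left _ _
  have hga : ∀ i, g ∣ a i := fun i => (Nat.gcd_dvd_right _ _).trans (Finset.gcd_dvd (Finset.mem_univ i))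
  have hg0 : 0 < g := Nat.gcd_pos_of_pos_left _ (by omega)
  have hord : orderOf (χ ^ g) = e / g := by
    rw [orderOf_pow_of_dvd hg0.ne' (hχ ▸ hge), hχ]
  have he0 : 0 < e / g := Nat.div_pos (Nat.le_of_dvd (by omega) hge) hg0
  have he2 : 2 ≤ e / g := by
    by_contra h
    have h1 : e / g = 1 := by omega
    obtain ⟨i, hi⟩ := ha
    apply hi
    have : e = g := by
      have := Nat.div_mul_cancel hge
      rw [h1] at this; omega
    rw [this]; exact hga i
  have key := weil (χ ^ g) (e / g) m hm hord he2 v hv (fun i => a i / g)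
    (fun i => Nat.div_pos (Nat.le_of_dvd (ha0 i) (hga i)) hg0) (by
      intro l hl hle
      by_contra h
      push Not at h
      have h1 : l * g ∣ e := by
        have := Nat.mul_dvd_mul_right hle g
        rwa [Nat.div_mul_cancel hge] at this
      have h2 : ∀ i, l * g ∣ a i := by
        intro i
        have := Nat.mul_dvd_mul_right (h i) g
        rwa [Nat.div_mul_cancel (hga i)] at this
      have h3 : l * g ∣ g := Nat.dvd_gcd h1 (Finset.dvd_gcd fun i _ => h2 i)
      have := Nat.le_of_dvd hg0 h3
      have := hl.two_le
      nlinarith)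
  have h5 : ∀ i, (χ ^ g) ^ (a i / g) = χ ^ (a i) := by
    intro i
    rw [← pow_mul, Nat.mul_div_cancel' (hga i)]
  simpa only [h5] using key

lemma sum_char_pow {E : Type} [Field E] [Fintype E] (χ : MulChar E ℂ) (e : ℕ)
    (hχ : χ ^ e = 1) (he : 1 ≤ e) (y : E) :
    ∑ a ∈ Finset.Icc 1 e, (χ ^ a) y = if χ y = 1 then (e : ℂ) else 0 := by
  have h1 : ∀ a ∈ Finset.Icc 1 e, (χ ^ a) y = (χ y) ^ a := by
    intro a ha
    rw [Finset.mem_Icc] at ha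
    exact MulChar.pow_apply' χ (by omega) y
  rw [Finset.sum_congr rfl h1]
  split_ifs with h
  · simp [h]
  · have h2 : (∑ a ∈ Finset.Icc 1 e, (χ y) ^ a) = χ y * ∑ a ∈ Finset.range e, (χ y) ^ a := by
      rw [Finset.mul_sum, Finset.range_eq_Ico, ← Finset.Ico_add_one_right_eq_Icc,
        Finset.sum_Ico_eq_sum_range, Finset.sum_Ico_eq_sum_range]
      refine Finset.sum_congr (by simp) fun i _ => ?_
      rw [zero_add, pow_add, pow_one]
    rw [h2]
    by_cases hy : y = 0
    · subst hy
      rw [MulChar.map_nonunit χ not_isUnit_zero, zero_mul]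
    · have h3 : (χ y) ^ e = 1 := by
        rw [← MulChar.pow_apply' χ (by omega) y, hχ, MulChar.one_apply (IsUnit.mk0 y hy)]
      have h4 := geom_sum_mul (χ y) e
      rw [h3, sub_self] at h4
      rcases mul_eq_zero.1 h4 with h5 | h5
      · rw [h5, mul_zero]
      · exact absurd (sub_eq_zero.1 h5) h

lemma char_one_root {E : Type} [Field E] [Fintype E] (χ : MulChar E ℂ) (e : ℕ)
    (hχ : orderOf χ = e) (y : E) (hy : χ y = 1) : ∃ t : E, t ≠ 0 ∧ t ^ e = y := by
  have hy0 : y ≠ 0 := by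
    rintro rfl
    rw [MulChar.map_nonunit χ not_isUnit_zero] at hy
    exact zero_ne_one hy
  obtain ⟨g, hg⟩ := IsCyclic.exists_monoid_generator (α := Eˣ)
  obtain ⟨n, hn⟩ := (hg (Units.mk0 y hy0))
  simp only at hn
  have hgy : (g : E) ^ n = y := by
    have := congrArg Units.val hn
    simpa using this
  have h1 : χ ^ n = 1 := by
    ext u
    obtain ⟨k, rfl⟩ := hg u
    simp only [Units.val_pow_eq_pow_val]
    rw [map_pow, map_pow]
    congr 1
    rw [MulChar.pow_apply_coe, MulChar.one_apply_coe, ← map_pow, hgy, hy]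
  obtain ⟨k, hk⟩ := hχ ▸ orderOf_dvd_of_pow_eq_one h1
  refine ⟨(g : E) ^ k, pow_ne_zero _ g.ne_zero, ?_⟩
  rw [← pow_mul, mul_comm, ← hk, hgy]

lemma count {E : Type} [Field E] [Fintype E] (e m : ℕ) (hm : 1 ≤ m) (he : 2 ≤ e)
    (hdvd : e ∣ Fintype.card E - 1) (v : Fin m → E) (hv : Function.Injective v)
    (S : Finset E) (hS : ∀ x, (∀ l, ∃ t : E, t ≠ 0 ∧ t ^ e = v l - x) → x ∈ S) :
    (Fintype.card E : ℝ) - m - ((e : ℝ) ^ m - 1) * (((m : ℝ) - 1) * Real.sqrt (Fintype.card E))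
      ≤ (e : ℝ) ^ m * S.card := by
  classical
  obtain ⟨χ, hχ⟩ := MulChar.exists_mulChar_orderOf E hdvd
    (Complex.isPrimitiveRoot_exp e (by omega))
  have hχe : χ ^ e = 1 := by rw [← hχ]; exact pow_orderOf_eq_one χ
  set P := Fintype.piFinset (fun _ : Fin m => Finset.Icc 1 e) with hP
  set T : (Fin m → ℕ) → ℂ := fun a => ∑ x : E, ∏ i, (χ ^ (a i)) (v i - x) with hT
  set G := Finset.univ.filter (fun x : E => ∀ i, χ (v i - x) = 1) with hG
  have hGS : G ⊆ S := by
    intro x hx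
    rw [hG, Finset.mem_filter] at hx
    exact hS x fun l => char_one_root χ e hχ _ (hx.2 l)
  have hsum : ∑ a ∈ P, T a = (e : ℂ) ^ m * G.card := by
    rw [hT, Finset.sum_comm]
    have : ∀ x : E, ∑ a ∈ P, ∏ i, (χ ^ (a i)) (v i - x) = if x ∈ G then (e : ℂ) ^ m else 0 := by
      intro x
      rw [hP, ← Finset.prod_univ_sum (fun _ : Fin m => Finset.Icc 1 e) (fun i j => (χ ^ j) (v i - x))]
      simp_rw [sum_char_pow χ e hχe (by omega)]
      split_ifs with h
      · rw [hG, Finset.mem_filter] at h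
        simp [h.2]
      · rw [hG, Finset.mem_filter] at h
        have : ∃ i, ¬ χ (v i - x) = 1 := by
          by_contra h'
          push Not at h'
          exact h ⟨Finset.mem_univ _, h'⟩
        obtain ⟨i, hi⟩ := this
        exact Finset.prod_eq_zero (Finset.mem_univ i) (by simp [hi])
    simp_rw [this]
    rw [Finset.sum_ite_mem, Finset.univ_inter, Finset.sum_const, nsmul_eq_mul, mul_comm]
  have hc : (fun _ : Fin m => e) ∈ P := by
    rw [hP, Fintype.mem_piFinset]; intro i; rw [Finset.mem_Icc]; omega
  have hTc : T (fun _ => e) = (Fintype.card E : ℂ) - m := by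
    have h1 : ∀ x : E, ∏ i, (χ ^ e) (v i - x) = 1 - if x ∈ Finset.univ.image v then (1 : ℂ) else 0 := by
      intro x
      rw [hχe]
      split_ifs with h
      · rw [Finset.mem_image] at h
        obtain ⟨i, _, rfl⟩ := h
        rw [sub_self]
        refine Finset.prod_eq_zero (Finset.mem_univ i) ?_
        rw [sub_self]
        exact MulChar.map_nonunit _ not_isUnit_zero
      · rw [sub_zero]
        refine Finset.prod_eq_one fun i _ => ?_
        apply MulChar.one_apply
        rw [isUnit_iff_ne_zero, sub_ne_zero]
        rintro rfl
        exact h (Finset.mem_image_of_mem _ (Finset.mem_univ i))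
    rw [hT]
    simp only
    rw [Finset.sum_congr rfl fun x _ => h1 x, Finset.sum_sub_distrib, Finset.sum_ite_mem,
      Finset.univ_inter, Finset.sum_const, Finset.sum_const, Finset.card_image_of_injective _ hv]
    simp
  have hcardP : P.card = e ^ m := by
    rw [hP, Fintype.card_piFinset]; simp
  have hrest : ‖∑ a ∈ P.erase (fun _ => e), T a‖ ≤
      ((e : ℝ) ^ m - 1) * (((m : ℝ) - 1) * Real.sqrt (Fintype.card E)) := by
    refine (norm_sum_le_of_le _ (f := T) (n := fun _ => ((m : ℝ) - 1) * Real.sqrt (Fintype.card E)) ?_).trans ?_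
    · intro a ha
      rw [Finset.mem_erase, hP, Fintype.mem_piFinset] at ha
      obtain ⟨h1, h2⟩ := ha
      refine weil_gen χ e m hm hχ he v hv a (fun i => ?_) ?_
      · have := h2 i; rw [Finset.mem_Icc] at this; omega
      · by_contra h
        push Not at h
        apply h1
        funext i
        have h3 := h2 i
        rw [Finset.mem_Icc] at h3
        have := Nat.le_of_dvd (by omega) (h i)
        omega
    · rw [Finset.sum_const, Finset.card_erase_of_mem hc, hcardP, nsmul_eq_mul,
        Nat.cast_sub (Nat.one_le_pow _ _ (by omega))]
      push_cast
      exact le_rfl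
  rw [← Finset.add_sum_erase P T hc, hTc] at hsum
  have hval : ∑ a ∈ P.erase (fun _ => e), T a =
      (((e : ℝ) ^ m * G.card - ((Fintype.card E : ℝ) - m) : ℝ) : ℂ) := by
    push_cast
    rw [← hsum]; ring
  rw [hval, Complex.norm_real, Real.norm_eq_abs] at hrest
  have h1 := (abs_le.1 hrest).1
  have h2 : (G.card : ℝ) ≤ S.card := by exact_mod_cast Finset.card_le_card hGS
  have h3 : (e : ℝ) ^ m * G.card ≤ (e : ℝ) ^ m * S.card := by gcongr
  linarith


lemma dth_power {K : Type} [Field K] [Fintype K] (q d e : ℕ) (hd : 2 ≤ d) (hq1 : q % d = 1)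
    (hK : Fintype.card K = q ^ d) (hed : e ∣ d) (t : K) (ht : t ≠ 0) (hte : t ^ q ^ e = t) :
    ∃ y : K, y ≠ 0 ∧ y ^ d = t ^ e := by
  have hq0 : 0 < q := Nat.pos_of_ne_zero (by rintro rfl; simp at hq1)
  have hqd : q ≡ 1 [MOD d] := by
    rw [Nat.ModEq, hq1, Nat.mod_eq_of_lt (by omega)]
  obtain ⟨f, rfl⟩ := hed
  set Q := q ^ e with hQ
  have hQ1 : 1 ≤ Q := Nat.one_le_pow _ _ hq0
  have hQd : Q ≡ 1 [MOD (e * f)] := by simpa using hqd.pow e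
  have hdvd : e * f ∣ q ^ (e * f) - 1 := by
    have h : q ^ (e * f) ≡ 1 [MOD (e * f)] := by simpa using hqd.pow (e * f)
    exact (Nat.modEq_iff_dvd' (Nat.one_le_pow _ _ hq0)).1 h.symm
  obtain ⟨N, hN⟩ := hdvd
  have hgeo : (Q - 1) * ∑ j ∈ Finset.range f, Q ^ j = q ^ (e * f) - 1 := by
    rw [pow_mul, ← hQ, mul_comm]
    have h := geom_sum_mul_add (Q - 1) f
    rw [Nat.sub_add_cancel hQ1] at h
    omega
  have hS : e * f ∣ e * ∑ j ∈ Finset.range f, Q ^ j := by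
    have h1 : ∑ j ∈ Finset.range f, Q ^ j ≡ f [MOD f] := by
      have : ∀ j ∈ Finset.range f, Q ^ j ≡ 1 [MOD f] := by
        intro j _
        simpa using (hQd.of_dvd (Dvd.intro_left _ rfl)).pow j
      have := Nat.ModEq.sum this
      simpa using this
    exact Nat.mul_dvd_mul_left e ((Nat.modEq_zero_iff_dvd).1 (h1.trans (by simp [Nat.ModEq])))
  obtain ⟨c, hc⟩ := hS
  have hNe : e * N = (Q - 1) * c := by
    apply Nat.eq_of_mul_eq_mul_left (show 0 < e * f by omega)
    calc e * f * (e * N) = e * (e * f * N) := by ring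
      _ = (Q - 1) * (e * ∑ j ∈ Finset.range f, Q ^ j) := by rw [← hN, ← hgeo]; ring
      _ = e * f * ((Q - 1) * c) := by rw [hc]; ring
  have ht1 : t ^ (Q - 1) = 1 := by
    have : t ^ (Q - 1) * t = 1 * t := by
      rw [← pow_succ, Nat.sub_add_cancel hQ1, hte, one_mul]
    exact mul_right_cancel₀ ht this
  refine exists_root_of_pow_eq_one (e * f) N ?_ _ (pow_ne_zero _ ht) ?_
  · rw [hK, hN]; ring
  · rw [← pow_mul, hNe, pow_mul, ht1, one_pow]

lemma pow_iter {K : Type} [Field K] (q e : ℕ) (x : K) (h : x ^ q ^ e = x) (n : ℕ) :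
    x ^ q ^ (e * n) = x := by
  induction n with
  | zero => simp
  | succ n ih => rw [mul_add, mul_one, pow_add, pow_mul, ih, h]

lemma pow_modd {K : Type} [Field K] (q e : ℕ) (x : K) (h : x ^ q ^ e = x) (s : ℕ) :
    x ^ q ^ s = x ^ q ^ (s % e) := by
  conv_lhs => rw [← Nat.div_add_mod s e, pow_add, pow_mul, pow_iter q e x h]

lemma pow_of_deg {F K : Type} [Field F] [Field K] [Fintype F] [Fintype K] [Algebra F K]
    (e : ℕ) (x : K) (h : (minpoly F x).natDegree ∣ e) : x ^ (Fintype.card F) ^ e = x := by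
  classical
  obtain ⟨n, rfl⟩ := h
  apply pow_iter
  have hintg : IsIntegral F x := Algebra.IsIntegral.isIntegral x
  have h1 := IntermediateField.adjoin.finrank hintg
  have : Fintype (IntermediateField.adjoin F {x}) := Fintype.ofFinite _
  have h2 := FiniteField.pow_card (IntermediateField.AdjoinSimple.gen F x)
  rw [Module.card_eq_pow_finrank (K := F), h1] at h2
  have := congrArg (algebraMap (IntermediateField.adjoin F {x}) K) h2
  simpa using this

lemma card_fixed {K : Type} [Field K] [Fintype K] [DecidableEq K] (Q : ℕ) (hQ : 1 < Q) :
    (Finset.univ.filter (fun x : K => x ^ Q = x)).card ≤ Q := by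
  have hne : (X ^ Q - X : K[X]) ≠ 0 := FiniteField.X_pow_card_sub_X_ne_zero K hQ
  have hdeg := FiniteField.X_pow_card_sub_X_natDegree_eq K hQ
  calc _ ≤ (X ^ Q - X : K[X]).roots.toFinset.card := by
        apply Finset.card_le_card
        intro x hx
        rw [Finset.mem_filter] at hx
        rw [Multiset.mem_toFinset, mem_roots hne]
        simp [hx.2]
    _ ≤ Multiset.card (X ^ Q - X : K[X]).roots := Multiset.toFinset_card_le _
    _ ≤ Q := (card_roots' _).trans hdeg.le

lemma exists_deg {F K : Type} [Field F] [Field K] [Fintype F] [Fintype K] [Algebra F K]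
    (e : ℕ) (he : 1 ≤ e) (hed : e ∣ Module.finrank F K) :
    ∃ x : K, (minpoly F x).natDegree = e := by
  obtain ⟨L, _, _, _, hL⟩ := exists_ext (E := F) e he
  obtain ⟨α, hα⟩ := Field.exists_primitive_element F L
  obtain ⟨ι⟩ := FiniteField.nonempty_algHom_of_finrank_dvd (F := F) (K := L) (L := K) (hL ▸ hed)
  refine ⟨ι α, ?_⟩
  rw [minpoly.algHom_eq ι ι.injective]
  have h1 := IntermediateField.adjoin.finrank (Algebra.IsIntegral.isIntegral (R := F) α)
  rw [← h1, hα, IntermediateField.finrank_top', hL]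


lemma sum_pow_le (q n : ℕ) (hq : 2 ≤ q) : ∑ f ∈ Finset.Icc 1 n, q ^ f ≤ 2 * q ^ n := by
  induction n with
  | zero => simp
  | succ n ih =>
    rw [Finset.sum_Icc_succ_top (by omega), pow_succ]
    nlinarith [Nat.one_le_pow n q (by omega)]

lemma final_ineq (m e : ℕ) (hm : 1 ≤ m) (he : 2 ≤ e) (s : ℝ) (hs : ((m : ℝ) + 2) * (e : ℝ) ^ m ≤ s) :
    (e : ℝ) ^ m * (2 * s + m * e) <
      s ^ 2 - m - ((e : ℝ) ^ m - 1) * (((m : ℝ) - 1) * s) := by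
  have hA : (e : ℝ) ≤ (e : ℝ) ^ m := by
    have : e ^ 1 ≤ e ^ m := Nat.pow_le_pow_right (by omega) hm
    rw [pow_one] at this
    exact_mod_cast this
  have hAm : (m : ℝ) ≤ (e : ℝ) ^ m := by
    exact_mod_cast (Nat.lt_pow_self (show 1 < e by omega)).le
  have hm' : (1 : ℝ) ≤ m := by exact_mod_cast hm
  have he' : (2 : ℝ) ≤ e := by exact_mod_cast he
  set A := (e : ℝ) ^ m
  set E := (e : ℝ)
  set M := (m : ℝ)
  have hs0 : 0 ≤ s := by nlinarith
  have h1 : (M + 2) * A * s ≤ s ^ 2 := by nlinarith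
  have h2 : A * ((M + 2) * A) ≤ A * s := by gcongr
  have h3 : A * ((M + 2) * E) ≤ A * ((M + 2) * A) := by gcongr
  have h4 : M < A * (2 * E) := by nlinarith
  have h5 : 0 ≤ (M - 1) * s := mul_nonneg (by linarith) hs0
  nlinarith

lemma extend {F K : Type} [Field F] [Field K] [Fintype F] [Fintype K] [Algebra F K]
    (q d e m : ℕ) (hd : 2 ≤ d) (hq1 : q % d = 1) (hq2 : 2 ≤ q)
    (hF : Fintype.card F = q) (hK : Fintype.card K = q ^ d) (hfr : Module.finrank F K = d)
    (hed : e ∣ d) (he : 2 ≤ e) (hm : 1 ≤ m)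
    (hineq : ((m : ℝ) + 2) * (e : ℝ) ^ m ≤ Real.sqrt ((q : ℝ) ^ e))
    (w : Fin m → K) (hw : Function.Injective w) (hwd : ∀ l, (minpoly F (w l)).natDegree ∣ e) :
    ∃ x : K, (minpoly F x).natDegree = e ∧ (∀ l, ∀ s : ℕ, x ≠ w l ^ q ^ s) ∧
      (∀ l, ∀ s : ℕ, w l ≠ x ^ q ^ s) ∧ ∀ l, ∃ y : K, y ≠ 0 ∧ y ^ d = w l - x := by
  classical
  obtain ⟨L, _, _, _, hL⟩ := exists_ext (E := F) e (by omega)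
  have hcL : Fintype.card L = q ^ e := by
    rw [Module.card_eq_pow_finrank (K := F), hL, hF]
  have hQ : 1 < q ^ e := Nat.one_lt_pow (by omega) (by omega)
  obtain ⟨ι⟩ := FiniteField.nonempty_algHom_of_finrank_dvd (F := F) (K := L) (L := K) (by rw [hL, hfr]; exact hed)
  have hLpow : ∀ y : L, y ^ q ^ e = y := by
    intro y; rw [← hcL]; exact FiniteField.pow_card y
  have hrange : Finset.univ.image ι = Finset.univ.filter (fun x : K => x ^ q ^ e = x) := by
    apply Finset.eq_of_subset_of_card_le
    · intro x hx
      rw [Finset.mem_image] at hx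
      obtain ⟨y, _, rfl⟩ := hx
      rw [Finset.mem_filter]
      refine ⟨Finset.mem_univ _, ?_⟩
      rw [← map_pow, hLpow]
    · rw [Finset.card_image_of_injective _ (show Function.Injective ι from ι.injective), Finset.card_univ, hcL]
      exact card_fixed _ hQ
  have hex : ∀ l, ∃ y : L, ι y = w l := by
    intro l
    have : w l ∈ Finset.univ.image ι := by
      rw [hrange, Finset.mem_filter]
      refine ⟨Finset.mem_univ _, ?_⟩
      rw [← hF]
      exact pow_of_deg e (w l) (hwd l)
    rw [Finset.mem_image] at this
    obtain ⟨y, _, hy⟩ := this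
    exact ⟨y, hy⟩
  choose v hv using hex
  have hvinj : Function.Injective v := by
    intro a b hab
    apply hw
    rw [← hv, ← hv, hab]
  set S := Finset.univ.filter (fun x : L => ∀ l, ∃ t : L, t ≠ 0 ∧ t ^ e = v l - x) with hS
  have hedQ : e ∣ Fintype.card L - 1 := by
    have hqe : q ≡ 1 [MOD e] := by
      have : q ≡ 1 [MOD d] := by rw [Nat.ModEq, hq1, Nat.mod_eq_of_lt (by omega)]
      exact this.of_dvd hed
    rw [hcL]
    have h : q ^ e ≡ 1 [MOD e] := by simpa using hqe.pow e
    exact (Nat.modEq_iff_dvd' hQ.le).1 h.symm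
  have hcount := count e m hm he hedQ v hvinj S (by
    intro x hx
    rw [hS, Finset.mem_filter]
    exact ⟨Finset.mem_univ _, hx⟩)
  set B1 := (Finset.Icc 1 (e / 2)).biUnion
    (fun f => Finset.univ.filter (fun x : L => x ^ q ^ f = x)) with hB1
  set B2 := (Finset.univ ×ˢ Finset.range e).image (fun p : Fin m × ℕ => v p.1 ^ q ^ p.2) with hB2
  have hB1c : B1.card ≤ 2 * q ^ (e / 2) := by
    refine (Finset.card_biUnion_le).trans (le_trans (Finset.sum_le_sum fun f hf => ?_) (sum_pow_le q (e / 2) hq2))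
    rw [Finset.mem_Icc] at hf
    exact card_fixed _ (Nat.one_lt_pow (by omega) (by omega))
  have hB2c : B2.card ≤ m * e := by
    refine Finset.card_image_le.trans ?_
    rw [Finset.card_product]; simp
  have hsq : (Real.sqrt ((q : ℝ) ^ e)) ^ 2 = (q : ℝ) ^ e := Real.sq_sqrt (by positivity)
  have hhalf : ((q ^ (e / 2) : ℕ) : ℝ) ≤ Real.sqrt ((q : ℝ) ^ e) := by
    apply Real.le_sqrt_of_sq_le
    push_cast
    rw [← pow_mul]
    apply pow_le_pow_right₀ (by exact_mod_cast (by omega : 1 ≤ q))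
    omega
  have hlt : (B1 ∪ B2).card < S.card := by
    have h1 : ((B1 ∪ B2).card : ℝ) ≤ 2 * Real.sqrt ((q : ℝ) ^ e) + m * e := by
      have : (B1 ∪ B2).card ≤ 2 * q ^ (e / 2) + m * e :=
        (Finset.card_union_le _ _).trans (add_le_add hB1c hB2c)
      have h' : ((B1 ∪ B2).card : ℝ) ≤ 2 * ((q ^ (e / 2) : ℕ) : ℝ) + m * e := by exact_mod_cast this
      linarith
    have h2 := final_ineq m e hm he _ hineq
    rw [hcL] at hcount
    push_cast at hcount
    rw [hsq] at h2
    have h3 := h2.trans_le hcount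
    have h4 : (2 * Real.sqrt ((q : ℝ) ^ e) + m * e) < S.card :=
      lt_of_mul_lt_mul_left h3 (by positivity)
    exact_mod_cast h1.trans_lt h4
  obtain ⟨x, hxS, hxB⟩ := Finset.exists_mem_notMem_of_card_lt_card hlt
  rw [Finset.mem_union, not_or] at hxB
  rw [hS, Finset.mem_filter] at hxS
  have hdeg : (minpoly F x).natDegree = e := by
    have hintg : IsIntegral F x := Algebra.IsIntegral.isIntegral x
    have hdv : (minpoly F x).natDegree ∣ e := by
      rw [← hL]; exact minpoly.degree_dvd hintg
    by_contra hne
    apply hxB.1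
    rw [hB1, Finset.mem_biUnion]
    refine ⟨(minpoly F x).natDegree, ?_, ?_⟩
    · rw [Finset.mem_Icc]
      refine ⟨minpoly.natDegree_pos hintg, ?_⟩
      obtain ⟨c, hc⟩ := hdv
      rw [Nat.le_div_iff_mul_le (by norm_num)]
      have : 2 ≤ c := by
        rcases c with _ | _ | c
        · omega
        · omega
        · omega
      nlinarith
    · rw [Finset.mem_filter]
      refine ⟨Finset.mem_univ _, ?_⟩
      rw [← hF]
      exact pow_of_deg _ x dvd_rfl
  have hn1 : ∀ l, ∀ s : ℕ, x ≠ v l ^ q ^ s := by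
    intro l s h
    apply hxB.2
    rw [hB2, Finset.mem_image]
    refine ⟨(l, s % e), ?_, ?_⟩
    · simp [Nat.mod_lt _ (show e > 0 by omega)]
    · simp only
      rw [h]
      exact (pow_modd q e (v l) (hLpow _) s).symm
  refine ⟨ι x, ?_, ?_, ?_, ?_⟩
  · rw [minpoly.algHom_eq ι ι.injective, hdeg]
  · intro l s h
    rw [← hv, ← map_pow] at h
    exact hn1 l s (ι.injective h)
  · intro l s h
    rw [← hv, ← map_pow] at h
    have h' := ι.injective h
    apply hn1 l (e * s - s)
    rw [h', ← pow_mul, ← pow_add, Nat.add_sub_cancel' (Nat.le_mul_of_pos_left s (by omega)),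
      pow_iter q e x (hLpow x)]
  · intro l
    obtain ⟨t, ht0, ht⟩ := hxS.2 l
    have h1 := dth_power q d e hd hq1 hK hed (ι t) (by simpa using ht0) (by rw [← map_pow, hLpow])
    rwa [← map_pow, ht, map_sub, hv] at h1


lemma bern (r t : ℝ) (hr : 2 ≤ r) (ht : 2 ≤ t) : r * t ≤ r ^ t := by
  have h := one_add_mul_self_le_rpow_one_add (s := r - 1) (p := t - 1) (by linarith) (by linarith)
  have h1 : r ^ t = r * r ^ (t - 1) := by
    rw [← Real.rpow_one_add' (by linarith) (by linarith)]
    congr 1; ring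
  rw [h1]
  have h2 : (1 + (r - 1)) = r := by ring
  rw [h2] at h
  have : t ≤ r ^ (t - 1) := by nlinarith
  nlinarith

/-- the numerical heart of the inductive step -/
lemma num_step (q d e m k r : ℕ) (hr : 2 ≤ r) (hm : 1 ≤ m) (hmk : m ≤ k - 1) (hk : 1 ≤ k)
    (hed : e ≤ d) (her : 2 * r ≤ e)
    (hq : (q : ℝ) ^ r > ((d : ℝ) + ((k : ℝ) - 1) * (r : ℝ) ^ (k - 1)) ^ 2) :
    ((m : ℝ) + 2) * (e : ℝ) ^ m ≤ Real.sqrt ((q : ℝ) ^ e) := by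
  have hr' : (2 : ℝ) ≤ r := by exact_mod_cast hr
  have hm' : (1 : ℝ) ≤ m := by exact_mod_cast hm
  have her' : (2 : ℝ) * r ≤ e := by exact_mod_cast her
  have hed' : (e : ℝ) ≤ d := by exact_mod_cast hed
  have hmk' : (m : ℝ) ≤ (k : ℝ) - 1 := by
    have : m + 1 ≤ k := by omega
    have : (m : ℝ) + 1 ≤ k := by exact_mod_cast this
    linarith
  have hpow : (r : ℝ) ^ m ≤ (r : ℝ) ^ (k - 1) := pow_le_pow_right₀ (by linarith) hmk
  set R := (r : ℝ) with hR
  set E := (e : ℝ) with hE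
  set M := (m : ℝ) with hM
  set t : ℝ := E / R with ht
  have ht2 : 2 ≤ t := by rw [ht, le_div_iff₀ (by linarith)]; exact her'
  have hRt : R * t = E := by rw [ht]; field_simp
  set b := E + M * R ^ m with hb
  have hb1 : 1 ≤ b := by
    have : 0 ≤ M * R ^ m := by positivity
    linarith
  have hbq : b ^ 2 ≤ (q : ℝ) ^ r := by
    refine le_trans ?_ hq.le
    apply pow_le_pow_left₀ (by linarith)
    have : M * R ^ m ≤ ((k : ℝ) - 1) * R ^ (k - 1) := by
      apply mul_le_mul hmk' hpow (by positivity) (by linarith)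
    linarith
  have hbt : b ^ t ≤ Real.sqrt ((q : ℝ) ^ e) := by
    apply Real.le_sqrt_of_sq_le
    have h1 : (b ^ t) ^ 2 = (b ^ 2) ^ t := by
      rw [← Real.rpow_natCast, ← Real.rpow_mul (by linarith), mul_comm, Real.rpow_mul (by linarith), Real.rpow_natCast]
    have h2 : (q : ℝ) ^ e = ((q : ℝ) ^ r) ^ t := by
      rw [← Real.rpow_natCast, ← Real.rpow_natCast, ← Real.rpow_mul (by positivity), ← hE, ← hRt, ← hR]
    rw [h1, h2]
    exact Real.rpow_le_rpow (by positivity) hbq (by linarith)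
  refine le_trans ?_ hbt
  rcases Nat.eq_or_lt_of_le hm with h1 | h1
  · have hM1 : M = 1 := by rw [hM, ← h1]; simp
    have : b ^ (2 : ℝ) ≤ b ^ t := Real.rpow_le_rpow_of_exponent_le hb1 ht2
    refine le_trans ?_ this
    rw [Real.rpow_two, hb, hM1, ← h1]
    simp only [pow_one]
    nlinarith
  · have hM2 : (2 : ℝ) ≤ M := by rw [hM]; exact_mod_cast h1
    have h2 : (M * R ^ m) ^ t ≤ b ^ t := by
      apply Real.rpow_le_rpow (by positivity) _ (by linarith)
      rw [hb]; linarith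
    refine le_trans ?_ h2
    rw [Real.mul_rpow (by positivity) (by positivity)]
    have h3 : (R ^ m) ^ t = (R ^ t) ^ m := by
      rw [← Real.rpow_natCast, ← Real.rpow_mul (by linarith), mul_comm, Real.rpow_mul (by linarith), Real.rpow_natCast]
    rw [h3]
    have h4 : M + 2 ≤ M ^ t := by
      have : M ^ (2 : ℝ) ≤ M ^ t := Real.rpow_le_rpow_of_exponent_le hm' ht2
      rw [Real.rpow_two] at this
      nlinarith
    have h5 : E ^ m ≤ (R ^ t) ^ m := by
      apply pow_le_pow_left₀ (by linarith)
      rw [← hRt]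
      exact bern R t hr' ht2
    apply mul_le_mul h4 h5 (by positivity) (by linarith)

lemma k_le_q (q d k r : ℕ) (hr : 2 ≤ r) (hrq : r ≤ q) 
    (hq : (q : ℝ) ^ r > ((d : ℝ) + ((k : ℝ) - 1) * (r : ℝ) ^ (k - 1)) ^ 2) : k ≤ q := by
  by_contra hlt
  push Not at hlt
  have hr' : (2 : ℝ) ≤ r := by exact_mod_cast hr
  have hrq' : (r : ℝ) ≤ q := by exact_mod_cast hrq
  have hk' : (q : ℝ) + 1 ≤ k := by exact_mod_cast hlt
  have h1 : ((r : ℝ) ^ q) ^ 2 ≤ ((d : ℝ) + ((k : ℝ) - 1) * (r : ℝ) ^ (k - 1)) ^ 2 := by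
    apply pow_le_pow_left₀ (by positivity)
    have h2 : (r : ℝ) ^ q ≤ (r : ℝ) ^ (k - 1) := pow_le_pow_right₀ (by linarith) (by omega)
    have h3 : (0 : ℝ) ≤ d := by positivity
    have h4 : (0 : ℝ) ≤ (r : ℝ) ^ (k - 1) := by positivity
    nlinarith
  have h5 := bern r (2 * q / r) hr' (by rw [le_div_iff₀ (by linarith)]; linarith)
  have h6 : (r : ℝ) * (2 * q / r) = 2 * q := by field_simp
  rw [h6] at h5
  have h7 : (q : ℝ) ≤ (r : ℝ) ^ (2 * (q : ℝ) / r) := by linarith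
  have h8 := pow_le_pow_left₀ (by positivity) h7 r
  have h9 : ((r : ℝ) ^ (2 * (q : ℝ) / r)) ^ r = ((r : ℝ) ^ q) ^ 2 := by
    rw [← Real.rpow_natCast, ← Real.rpow_mul (by linarith), ← pow_mul, ← Real.rpow_natCast]
    congr 1
    push_cast
    field_simp
  rw [h9] at h8
  linarith


lemma level_one {F K : Type} [Field F] [Field K] [Fintype F] [Fintype K] [Algebra F K]
    (q d e k : ℕ) (hd : 2 ≤ d) (hq1 : q % d = 1)
    (hF : Fintype.card F = q) (hK : Fintype.card K = q ^ d) (hfr : Module.finrank F K = d)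
    (hed : e ∣ d) (he : 1 ≤ e) (hkq : k ≤ q) :
    ∃ v : Fin k → K,
      (∀ i, (minpoly F (v i)).natDegree = e) ∧
      (∀ i j, i ≠ j → ∀ m : ℕ, v j ≠ v i ^ q ^ m) ∧
      (∀ i j, i ≠ j → ∃ y : K, y ≠ 0 ∧ y ^ d = v i - v j) := by
  obtain ⟨θ, hθ⟩ := exists_deg (F := F) (K := K) e he (by rw [hfr]; exact hed)
  obtain ⟨a⟩ : Nonempty (Fin k ↪ F) := by
    apply Function.Embedding.nonempty_of_card_le
    rw [Fintype.card_fin, hF]; exact hkq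
  have hdF : (d : F) ≠ 0 := by
    intro h
    have h1 : (q : F) = 0 := by rw [← hF]; exact FiniteField.cast_card_eq_zero F
    rw [← Nat.div_add_mod q d, hq1] at h1
    push_cast at h1
    rw [h, zero_mul, zero_add] at h1
    exact one_ne_zero h1
  have hFpow : ∀ (s : ℕ) (c : F), (algebraMap F K c) ^ q ^ s = algebraMap F K c := by
    intro s c
    rw [← map_pow, ← hF, FiniteField.pow_card_pow]
  have hadd : ∀ (s : ℕ) (x y : K), (x + y) ^ q ^ s = x ^ q ^ s + y ^ q ^ s := by
    intro s x y
    rw [← hF]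
    obtain ⟨p, hp⟩ := CharP.exists F
    obtain ⟨n, hpp, hn⟩ := FiniteField.card F p
    have : Fact p.Prime := ⟨hpp⟩
    have : CharP K p := charP_of_injective_algebraMap (algebraMap F K).injective p
    rw [hn, ← pow_mul]
    exact add_pow_char_pow x y p _
  refine ⟨fun i => θ + algebraMap F K (a i), ?_, ?_, ?_⟩
  · intro i
    simp only
    rw [minpoly.add_algebraMap, natDegree_comp]
    simp [hθ]
  · intro i j hij s h
    simp only at h
    rw [hadd, hFpow] at h
    set c := a j - a i with hc
    have hstep : θ ^ q ^ s = θ + algebraMap F K c := by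
      rw [hc, map_sub]
      linear_combination -h
    have hiter : ∀ n : ℕ, θ ^ q ^ (s * n) = θ + n * algebraMap F K c := by
      intro n
      induction n with
      | zero => simp
      | succ n ih =>
        rw [mul_add, mul_one, pow_add, pow_mul, ih]
        have : (n : K) * algebraMap F K c = algebraMap F K (n * c) := by simp
        rw [this, hadd, hFpow, hstep]
        simp
        ring
    have h1 := hiter d
    have h2 : θ ^ q ^ (s * d) = θ := by
      rw [mul_comm]
      apply pow_iter
      rw [← hK]; exact FiniteField.pow_card θ
    rw [h2] at h1
    have h3 : algebraMap F K (d * c) = 0 := by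
      rw [map_mul, map_natCast]
      linear_combination -h1
    rw [map_eq_zero, mul_eq_zero] at h3
    rcases h3 with h3 | h3
    · exact hdF h3
    · exact hij (a.injective (sub_eq_zero.1 h3)).symm
  · intro i j hij
    have hne : algebraMap F K (a i - a j) ≠ 0 := by
      rw [Ne, map_eq_zero, sub_eq_zero]
      exact fun h => hij (a.injective h)
    have h1 := dth_power q d 1 hd hq1 hK (one_dvd _) _ hne (hFpow 1 _)
    rw [pow_one, map_sub] at h1
    simpa using h1

/-- Proposition 4.2: existence of a clique in GP(q^d, d) with prescribed degrees
d₁ ∣ d₂ ∣ ⋯ ∣ d_k ∣ d, no two vertices Galois conjugate. -/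
theorem stmt15 (q d k : ℕ) (hd : 2 ≤ d) (hq1 : q % d = 1) (hqodd : Odd q)
    (hk : 0 < k) (ds : Fin k → ℕ)
    (hds1 : 1 < ds ⟨0, hk⟩) (hdspos : ∀ i, 0 < ds i)
    (hchain : ∀ i j : Fin k, i ≤ j → ds i ∣ ds j) (hdsd : ∀ i, ds i ∣ d)
    (hq : (q : ℝ) ^ d.minFac >
      max (((d : ℝ) + ((k : ℝ) - 1) * (d.minFac : ℝ) ^ (k - 1)) ^ 2)
        (Real.exp (2 * ((k : ℝ) - 1))))
    (F K : Type) [Field F] [Field K] [Fintype F] [Fintype K] [Algebra F K]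
    (hF : Fintype.card F = q) (hK : Fintype.card K = q ^ d) :
    ∃ v : Fin k → K,
      (∀ i, (minpoly F (v i)).natDegree = ds i) ∧
      (∀ i j, i ≠ j → ∀ m : ℕ, v j ≠ v i ^ q ^ m) ∧
      (∀ i j, i ≠ j → ∃ y : K, y ≠ 0 ∧ y ^ d = v i - v j) := by
  classical
  have hqr := (le_max_left _ _).trans_lt hq
  have hq2 : 2 ≤ q := by rw [← hF]; exact Fintype.one_lt_card
  have hr : d.minFac.Prime := Nat.minFac_prime (by omega)
  have hdq : d ≤ q := by
    by_contra h
    rw [Nat.mod_eq_of_lt (by omega)] at hq1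
    omega
  have hrd : d.minFac ≤ d := Nat.minFac_le (by omega)
  have hkq : k ≤ q := k_le_q q d k d.minFac hr.two_le (hrd.trans hdq) hqr
  have hfr : Module.finrank F K = d := by
    have h := Module.card_eq_pow_finrank (K := F) (V := K)
    rw [hK, hF] at h
    exact (Nat.pow_right_injective hq2 h).symm
  have hneg : ∃ y : K, y ≠ 0 ∧ y ^ d = -1 := by
    have h := dth_power q d 1 hd hq1 hK (one_dvd _) (-1 : K) (by simp) (by
      rw [pow_one, hqodd.neg_one_pow])
    simpa using h
  obtain ⟨z, hz0, hz⟩ := hneg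
  set i0 : Fin k := ⟨0, hk⟩ with hi0
  have key : ∀ n : ℕ, n ≤ k → ∃ v : Fin k → K,
      (∀ i : Fin k, (i.1 < n ∨ ds i = ds i0) → (minpoly F (v i)).natDegree = ds i) ∧
      (∀ i j : Fin k, (i.1 < n ∨ ds i = ds i0) → (j.1 < n ∨ ds j = ds i0) → i ≠ j →
        ∀ m : ℕ, v j ≠ v i ^ q ^ m) ∧
      (∀ i j : Fin k, (i.1 < n ∨ ds i = ds i0) → (j.1 < n ∨ ds j = ds i0) → i ≠ j →
        ∃ y : K, y ≠ 0 ∧ y ^ d = v i - v j) := by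
    intro n
    induction n with
    | zero =>
      intro _
      obtain ⟨v, h1, h2, h3⟩ := level_one (F := F) (K := K) q d (ds i0) k hd hq1 hF hK hfr
        (hdsd i0) (hdspos i0) hkq
      refine ⟨v, ?_, fun i j _ _ => h2 i j, fun i j _ _ => h3 i j⟩
      intro i hi
      rcases hi with hi | hi
      · omega
      · rw [h1, hi]
    | succ n ih =>
      intro hn
      obtain ⟨v, h1, h2, h3⟩ := ih (by omega)
      set I : Fin k := ⟨n, by omega⟩ with hI
      by_cases hsame : ds I = ds i0
      · have hA : ∀ i : Fin k, (i.1 < n + 1 ∨ ds i = ds i0) → (i.1 < n ∨ ds i = ds i0) := by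
          intro i hi
          rcases hi with hi | hi
          · by_cases h : i.1 = n
            · right
              have : i = I := Fin.ext h
              rw [this, hsame]
            · left; omega
          · exact Or.inr hi
        exact ⟨v, fun i hi => h1 i (hA i hi), fun i j hi hj => h2 i j (hA i hi) (hA j hj),
          fun i j hi hj => h3 i j (hA i hi) (hA j hj)⟩
      · have hlt : ∀ i : Fin k, ds i = ds i0 → i.1 < n := by
          intro i hi
          by_contra h
          apply hsame
          apply Nat.dvd_antisymm
          · rw [← hi]
            exact hchain I i (by rw [Fin.le_def]; simp only [hI]; omega)
          · exact hchain i0 I (by rw [Fin.le_def]; simp [hi0])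
        have hn1 : 1 ≤ n := by
          have := hlt i0 rfl
          omega
        have hmem : ∀ i : Fin k, (i.1 < n + 1 ∨ ds i = ds i0) → i ≠ I → i.1 < n := by
          intro i hi hne
          rcases hi with hi | hi
          · have : i.1 ≠ n := fun h => hne (Fin.ext h)
            omega
          · exact hlt i hi
        have her : 2 * d.minFac ≤ ds I := by
          obtain ⟨c, hc⟩ := hchain i0 I (by rw [Fin.le_def]; simp [hi0])
          have hr0 : d.minFac ≤ ds i0 := Nat.minFac_le_of_dvd hds1 (hdsd i0)
          have hc2 : 2 ≤ c := by
            rcases c with _ | _ | c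
            · have := hdspos I; omega
            · exact absurd (by rw [hc]; ring) hsame
            · omega
          rw [hc]
          nlinarith
        have hineq := num_step q d (ds I) n k d.minFac hr.two_le hn1 (by omega) hk
          (Nat.le_of_dvd (by omega) (hdsd I)) her hqr
        have hr2 := hr.two_le
        obtain ⟨x, hx1, hx2, hx3, hx4⟩ := extend (F := F) (K := K) q d (ds I) n hd hq1 hq2 hF hK hfr
          (hdsd I) (by omega) hn1 hineq (fun l : Fin n => v ⟨l.1, by omega⟩) (by
            intro a b hab
            by_contra hne
            refine h2 ⟨a.1, by omega⟩ ⟨b.1, by omega⟩ (Or.inl a.2) (Or.inl b.2) ?_ 0 ?_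
            · intro h
              exact hne (Fin.ext (by simpa using h))
            · simpa using hab.symm) (by
            intro l
            rw [h1 _ (Or.inl l.2)]
            exact hchain _ I (by rw [Fin.le_def]; simp only [hI]; omega))
        refine ⟨Function.update v I x, ?_, ?_, ?_⟩
        · intro i hi
          by_cases h : i = I
          · subst h
            rw [Function.update_self, hx1]
          · rw [Function.update_of_ne h]
            exact h1 i (Or.inl (hmem i hi h))
        · intro i j hi hj hij s
          by_cases h : i = I
          · have hj' : j ≠ I := fun h' => hij (h.trans h'.symm)
            rw [h, Function.update_self, Function.update_of_ne hj']
            exact hx3 ⟨j.1, hmem j hj hj'⟩ s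
          · rw [Function.update_of_ne h]
            by_cases h' : j = I
            · rw [h', Function.update_self]
              exact hx2 ⟨i.1, hmem i hi h⟩ s
            · rw [Function.update_of_ne h']
              exact h2 i j (Or.inl (hmem i hi h)) (Or.inl (hmem j hj h')) hij s
        · intro i j hi hj hij
          by_cases h : i = I
          · have hj' : j ≠ I := fun h' => hij (h.trans h'.symm)
            rw [h, Function.update_self, Function.update_of_ne hj']
            obtain ⟨y, hy0, hy⟩ := hx4 ⟨j.1, hmem j hj hj'⟩
            refine ⟨z * y, mul_ne_zero hz0 hy0, ?_⟩
            rw [mul_pow, hz, hy]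
            ring
          · rw [Function.update_of_ne h]
            by_cases h' : j = I
            · rw [h', Function.update_self]
              exact hx4 ⟨i.1, hmem i hi h⟩
            · rw [Function.update_of_ne h']
              exact h3 i j (Or.inl (hmem i hi h)) (Or.inl (hmem j hj h')) hij
  obtain ⟨v, h1, h2, h3⟩ := key k le_rfl
  exact ⟨v, fun i => h1 i (Or.inl i.2), fun i j => h2 i j (Or.inl i.2) (Or.inl j.2),
    fun i j => h3 i j (Or.inl i.2) (Or.inl j.2)⟩
end

section
/- Let q ≡ 3 (mod 4) be a prime power with q ≥ 83, and let u, v ∈ F_{q^2} \ F_q be elements that are not Galois conjugates of each other. Let S = H ∪ gH, where g is a primitive root of F_{q^2} and H is the index-4 subgroup of F_{q^2}^*, and set N(w) = {x ∈ F_q : w − x ∈ S}. Then |N(u) ∩ N(v)| ≤ q/4 + ((√2 + 3)/2)·√q. -/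
namespace Peisert
open Polynomial

/-- Height of a rational function. -/
noncomputable def rht {F : Type} [Field F] (x : RatFunc F) : ℕ := max x.num.natDegree x.denom.natDegree

lemma rht_le {F : Type} [Field F] (x : RatFunc F) (A B : F[X]) (hB : B ≠ 0)
    (h : x * algebraMap F[X] (RatFunc F) B = algebraMap F[X] (RatFunc F) A) (m : ℕ)
    (hA : A.natDegree ≤ m) (hBm : B.natDegree ≤ m) : rht x ≤ m := by
  have hB' : algebraMap F[X] (RatFunc F) B ≠ 0 := RatFunc.algebraMap_ne_zero hB
  have hx : x = algebraMap F[X] (RatFunc F) A / algebraMap F[X] (RatFunc F) B := by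
    rw [eq_div_iff hB', h]
  have h1 : x.denom ∣ B := (RatFunc.denom_dvd hB).2 ⟨A, hx⟩
  refine max_le ?_ ((natDegree_le_of_dvd h1 hB).trans hBm)
  by_cases hA0 : A = 0
  · have : x = 0 := by rw [hx, hA0]; simp
    rw [this]; simp
  · exact (natDegree_le_of_dvd ((RatFunc.num_dvd hA0).2 ⟨B, hB, hx⟩) hA0).trans hA

lemma rht_pair {F : Type} [Field F] (x y : RatFunc F) (D M N : F[X]) (hD : D ≠ 0)
    (h1 : algebraMap F[X] (RatFunc F) D * (x + y) = algebraMap F[X] (RatFunc F) M)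
    (h2 : algebraMap F[X] (RatFunc F) D * (x * y) = algebraMap F[X] (RatFunc F) N) (m : ℕ)
    (hDm : D.natDegree ≤ m) (hM : M.natDegree ≤ m) (hN : N.natDegree ≤ m) :
    rht x + rht y ≤ m := by
  unfold rht
  obtain ⟨u, v, huv⟩ := x.isCoprime_num_denom
  obtain ⟨w, z, hwz⟩ := y.isCoprime_num_denom
  have hb := x.denom_ne_zero
  have hd := y.denom_ne_zero
  have hxe := x.num_div_denom
  have hye := y.num_div_denom
  have hb' : algebraMap F[X] (RatFunc F) x.denom ≠ 0 := RatFunc.algebraMap_ne_zero hb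
  have hd' : algebraMap F[X] (RatFunc F) y.denom ≠ 0 := RatFunc.algebraMap_ne_zero hd
  rw [← hxe, ← hye] at h1 h2
  generalize x.num = a at *
  generalize x.denom = b at *
  generalize y.num = c at *
  generalize y.denom = d at *
  have e1 : D * (a * d + c * b) = M * (b * d) := by
    apply RatFunc.algebraMap_injective F
    simp only [map_mul, map_add]
    rw [← h1]; field_simp
  have e2 : D * (a * c) = N * (b * d) := by
    apply RatFunc.algebraMap_injective F
    simp only [map_mul]
    rw [← h2]; field_simp
  -- Bezout for the triple
  have bez : ∃ r s t : F[X], r * (b * d) + s * (a * d + c * b) + t * (a * c) = 1 := by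
    -- 1 = (ua+vb)(wc+zd) = uw ac + uz ad + vw bc + vz bd
    have h1' : (u * a + v * b) * (w * c + z * d) = 1 := by rw [huv, hwz, one_mul]
    -- mod (bd, ad+cb, ac) : 1 = (uz - vw) ad, and (ad)^2 = ad (ad+cb) - (ac)(bd)
    set k := u * z - v * w with hk
    have h2' : 1 - k * (a * d) = u * w * (a * c) + v * w * (a * d + c * b) + v * z * (b * d) := by
      rw [← h1', hk]; ring
    refine ⟨(v * z) * (1 + k * (a * d)) - k ^ 2 * (a * c), (v * w) * (1 + k * (a * d)) + k ^ 2 * (a * d),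
      (u * w) * (1 + k * (a * d)), ?_⟩
    linear_combination (-(1 + k * (a * d))) * h2'
  obtain ⟨r, s, t, hbez⟩ := bez
  set G := r * D + s * M + t * N with hG
  have g1 : D = G * (b * d) := by
    rw [hG]; linear_combination (-D) * hbez + s * e1 + t * e2
  have hbd : b * d ≠ 0 := mul_ne_zero hb hd
  have hG0 : G ≠ 0 := by rintro h; apply hD; rw [g1, h, zero_mul]
  have g2 : M = G * (a * d + c * b) := by
    apply mul_right_cancel₀ hbd; rw [← e1]; nth_rewrite 1 [g1]; ring
  have g3 : N = G * (a * c) := by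
    apply mul_right_cancel₀ hbd; rw [← e2]; nth_rewrite 1 [g1]; ring
  have le1 : ∀ p : F[X], (G * p).natDegree ≤ m → p.natDegree ≤ m := by
    intro p hp
    by_cases h0 : p = 0
    · simp [h0]
    · rw [natDegree_mul hG0 h0] at hp; omega
  have k1 : (b * d).natDegree ≤ m := le1 _ (g1 ▸ hDm)
  have k2 : (a * d + c * b).natDegree ≤ m := le1 _ (g2 ▸ hM)
  have k3 : (a * c).natDegree ≤ m := le1 _ (g3 ▸ hN)
  rw [natDegree_mul hb hd] at k1
  by_cases ha : a = 0
  · subst ha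
    simp only [zero_mul, zero_add, natDegree_zero] at *
    by_cases hc : c = 0
    · subst hc; simp; omega
    · rw [natDegree_mul hc hb] at k2
      omega
  by_cases hc : c = 0
  · subst hc
    simp only [zero_mul, add_zero, natDegree_zero] at *
    rw [natDegree_mul ha hd] at k2
    omega
  rw [natDegree_mul ha hc] at k3
  have n1 := natDegree_mul ha hd
  have n2 := natDegree_mul hc hb
  by_cases c1 : (c * b).natDegree < (a * d).natDegree
  · rw [natDegree_add_eq_left_of_natDegree_lt c1] at k2
    omega
  by_cases c2 : (a * d).natDegree < (c * b).natDegree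
  · rw [natDegree_add_eq_right_of_natDegree_lt c2] at k2
    omega
  omega


section curve
variable {F : Type} [Field F] (a b : F)

/-- The cubic. -/
noncomputable def cub : F[X] := X ^ 3 + C a * X ^ 2 + C b * X

/-- The cubic as a rational function. -/
noncomputable def lam : RatFunc F := algebraMap F[X] (RatFunc F) (cub a b)

lemma cub_natDegree : (cub a b).natDegree = 3 := by
  unfold cub; compute_degree!

lemma cub_ne_zero : cub a b ≠ 0 := by
  intro h; have := cub_natDegree a b; rw [h] at this; simp at this

lemma lam_ne_zero : lam a b ≠ 0 := RatFunc.algebraMap_ne_zero (cub_ne_zero a b)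

/-- Twisted curve over the function field. -/
noncomputable def curve : WeierstrassCurve.Affine (RatFunc F) :=
  ⟨0, RatFunc.C a * lam a b, 0, RatFunc.C b * lam a b ^ 2, 0⟩

lemma lam_eq : lam a b = RatFunc.X ^ 3 + RatFunc.C a * RatFunc.X ^ 2 + RatFunc.C b * RatFunc.X := by
  simp [lam, cub]

lemma two_ne (h2 : (2 : F) ≠ 0) : (2 : RatFunc F) ≠ 0 := by
  have h : (RatFunc.C (2 : F)) ≠ 0 := by
    intro h; apply h2; apply RatFunc.C_injective; rw [h, map_zero]
  rwa [map_ofNat] at h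

lemma curve_nonsing (h2 : (2 : F) ≠ 0) (x y : RatFunc F) (hy : y ≠ 0)
    (h : lam a b * y ^ 2 = x ^ 3 + RatFunc.C a * x ^ 2 + RatFunc.C b * x) :
    (curve a b).Nonsingular (lam a b * x) (lam a b ^ 2 * y) := by
  rw [WeierstrassCurve.Affine.nonsingular_iff]
  constructor
  · rw [WeierstrassCurve.Affine.equation_iff]
    simp only [curve]
    linear_combination lam a b ^ 3 * h
  · right
    simp only [WeierstrassCurve.Affine.negY, curve]
    intro h'
    have h3 : 2 * (lam a b ^ 2 * y) = 0 := by linear_combination h'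
    exact mul_ne_zero (two_ne h2) (mul_ne_zero (pow_ne_zero 2 (lam_ne_zero a b)) hy) h3

lemma curve_eqn (x y : RatFunc F) (h : (curve a b).Equation x y) :
    y ^ 2 = x ^ 3 + RatFunc.C a * lam a b * x ^ 2 + RatFunc.C b * lam a b ^ 2 * x := by
  rw [WeierstrassCurve.Affine.equation_iff] at h
  simp only [curve] at h
  linear_combination h

/-- Height of a point. -/
noncomputable def pht : (curve a b).Point → ℕ
  | .zero => 0
  | .some x _ _ => rht (x / lam a b)

lemma pht_neg (P : (curve a b).Point) : pht a b (-P) = pht a b P := by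
  cases P <;> rfl

/-- The generic point. -/
noncomputable def Qpt (h2 : (2 : F) ≠ 0) : (curve a b).Point :=
  .some (lam a b * RatFunc.X) (lam a b ^ 2 * 1)
    (curve_nonsing a b h2 RatFunc.X 1 one_ne_zero (by rw [lam_eq]; ring))

lemma rht_X : rht (RatFunc.X : RatFunc F) = 1 := by simp [rht]

lemma pht_Qpt (h2 : (2 : F) ≠ 0) : pht a b (Qpt a b h2) = 1 := by
  simp [pht, Qpt, mul_div_cancel_left₀ _ (lam_ne_zero a b), rht_X]

lemma alg_identity {K : Type} [Field K] (l w z T a b : K) (hz : z - T ≠ 0)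
    (hl : l = T ^ 3 + a * T ^ 2 + b * T) (hw : l * w ^ 2 = z ^ 3 + a * z ^ 2 + b * z) :
    (z - T) ^ 2 * ((l * (w - 1) ^ 2 / (z - T) ^ 2 - a - z - T) + (l * (w - -1) ^ 2 / (z - T) ^ 2 - a - z - T))
      = 2 * ((z + T) * (z * T + b) + 2 * a * (z * T)) ∧
    (z - T) ^ 2 * ((l * (w - 1) ^ 2 / (z - T) ^ 2 - a - z - T) * (l * (w - -1) ^ 2 / (z - T) ^ 2 - a - z - T))
      = (z * T - b) ^ 2 := by
  have h1 : (z - T) ^ 2 * (l * (w - 1) ^ 2 / (z - T) ^ 2 - a - z - T) = l * (w - 1) ^ 2 - (a + z + T) * (z - T) ^ 2 := by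
    field_simp; ring
  have h2 : (z - T) ^ 2 * (l * (w - -1) ^ 2 / (z - T) ^ 2 - a - z - T) = l * (w + 1) ^ 2 - (a + z + T) * (z - T) ^ 2 := by
    field_simp; ring
  constructor
  · rw [mul_add, h1, h2]
    linear_combination 2 * hw + 2 * hl
  · apply mul_left_cancel₀ (pow_ne_zero 2 hz)
    set A := (l * (w - 1) ^ 2 / (z - T) ^ 2 - a - z - T)
    set B := (l * (w - -1) ^ 2 / (z - T) ^ 2 - a - z - T)
    have h3 : (z - T) ^ 2 * ((z - T) ^ 2 * (A * B)) = (l * (w - 1) ^ 2 - (a + z + T) * (z - T) ^ 2) * (l * (w + 1) ^ 2 - (a + z + T) * (z - T) ^ 2) := by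
      rw [← h1, ← h2]; ring
    rw [h3]
    have h4 : (l * w ^ 2 - l) = (z ^ 3 + a * z ^ 2 + b * z) - (T ^ 3 + a * T ^ 2 + b * T) := by
      rw [hw, ← hl]
    have h5 : (l * w ^ 2 + l) = (z ^ 3 + a * z ^ 2 + b * z) + (T ^ 3 + a * T ^ 2 + b * T) := by
      rw [hw, ← hl]
    have h6 : (l * (w - 1) ^ 2 - (a + z + T) * (z - T) ^ 2) * (l * (w + 1) ^ 2 - (a + z + T) * (z - T) ^ 2)
      = (l * w ^ 2 - l) ^ 2 - 2 * (a + z + T) * (z - T) ^ 2 * (l * w ^ 2 + l) + (a + z + T) ^ 2 * (z - T) ^ 4 := by ring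
    rw [h6, h4, h5]
    ring

lemma addX_eq (x y y' w w' z : RatFunc F) (hxz : x = lam a b * z) (hw : y = lam a b ^ 2 * w)
    (hw' : y' = lam a b ^ 2 * w') (hz : z - RatFunc.X ≠ 0) :
    (curve a b).addX x (lam a b * RatFunc.X) ((y - y') / (x - lam a b * RatFunc.X)) / lam a b
      = lam a b * (w - w') ^ 2 / (z - RatFunc.X) ^ 2 - RatFunc.C a - z - RatFunc.X := by
  have hl := lam_ne_zero a b
  have hxy : x - lam a b * RatFunc.X = lam a b * (z - RatFunc.X) := by rw [hxz]; ring
  rw [hxy, hw, hw', hxz]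
  simp only [WeierstrassCurve.Affine.addX, curve]
  field_simp
  ring

open Classical in
lemma parallelogram (h2 : (2 : F) ≠ 0) (P : (curve a b).Point) :
    pht a b (P + Qpt a b h2) + pht a b (P - Qpt a b h2) ≤ 2 * pht a b P + 2 := by
  have hl := lam_ne_zero a b
  have h2' := two_ne h2
  have hlX := lam_eq a b
  -- doubling
  have hdbl : pht a b (Qpt a b h2 + Qpt a b h2) ≤ 4 := by
    have hne : lam a b ^ 2 * 1 ≠ (curve a b).negY (lam a b * RatFunc.X) (lam a b ^ 2 * 1) := by
      simp only [WeierstrassCurve.Affine.negY, curve]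
      intro h'
      have h3 : 2 * (lam a b ^ 2) = 0 := by linear_combination h'
      exact mul_ne_zero h2' (pow_ne_zero 2 hl) h3
    unfold Qpt
    rw [WeierstrassCurve.Affine.Point.add_self_of_Y_ne hne]
    simp only [pht]
    refine rht_le _ ((X ^ 2 - C b) ^ 2) (4 * cub a b) ?_ ?_ 4 ?_ ?_
    · refine mul_ne_zero ?_ (cub_ne_zero a b)
      have : (4 : F[X]) = C (2 * 2) := by
        rw [show (2 : F) * 2 = 4 by norm_num]; exact (map_ofNat C 4).symm
      rw [this]; simpa using h2
    · rw [WeierstrassCurve.Affine.slope_of_Y_ne rfl hne]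
      simp only [WeierstrassCurve.Affine.addX, WeierstrassCurve.Affine.negY, curve, map_mul, map_sub, map_pow,
        RatFunc.algebraMap_X, RatFunc.algebraMap_C, map_ofNat]
      rw [← lam]
      have e : (lam a b ^ 2 * 1 - (-(lam a b ^ 2 * 1) - 0 * (lam a b * RatFunc.X) - 0)) = 2 * lam a b ^ 2 := by ring
      rw [e]
      field_simp
      rw [hlX]
      ring
    · compute_degree
    · have := cub_natDegree a b
      refine natDegree_mul_le.trans ?_
      rw [this]; simp
  cases P with
  | zero =>
    rw [← WeierstrassCurve.Affine.Point.zero_def, zero_add, zero_sub, pht_neg, pht_Qpt]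
    omega
  | some x y h =>
    by_cases hx : x = lam a b * RatFunc.X
    · have : WeierstrassCurve.Affine.Point.some x y h = Qpt a b h2 ∨ WeierstrassCurve.Affine.Point.some x y h = - Qpt a b h2 := by
        unfold Qpt
        exact WeierstrassCurve.Affine.Point.X_eq_iff.1 hx
      have h0 : pht a b 0 = 0 := rfl
      rcases this with h | h <;> rw [h]
      · rw [sub_self, pht_Qpt, h0]; omega
      · rw [neg_add_cancel, h0, ← neg_add', pht_neg, pht_neg, pht_Qpt]; omega
    · rw [sub_eq_add_neg]
      have hs := curve_eqn a b _ _ h.1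
      unfold Qpt
      rw [WeierstrassCurve.Affine.Point.neg_some, WeierstrassCurve.Affine.Point.add_of_X_ne hx,
        WeierstrassCurve.Affine.Point.add_of_X_ne hx]
      simp only [pht]
      set z := x / lam a b with hz
      have hxz : x = lam a b * z := by rw [hz]; field_simp
      have hzX : z - RatFunc.X ≠ 0 := by
        intro h; apply hx; rw [hxz, sub_eq_zero.1 h]
      set A := z.num with hA
      set B := z.denom with hB
      have hB0 : B ≠ 0 := z.denom_ne_zero
      have hB0' : algebraMap F[X] (RatFunc F) B ≠ 0 := RatFunc.algebraMap_ne_zero hB0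
      have hzAB : algebraMap F[X] (RatFunc F) A = z * algebraMap F[X] (RatFunc F) B :=
        (div_eq_iff hB0').1 z.num_div_denom
      have hAd : A.natDegree ≤ rht z := le_max_left _ _
      have hBd : B.natDegree ≤ rht z := le_max_right _ _
      have hxy : x - lam a b * RatFunc.X = lam a b * (z - RatFunc.X) := by rw [hxz]; ring
      obtain ⟨w, hw⟩ : ∃ w, y = lam a b ^ 2 * w := ⟨y / lam a b ^ 2, by field_simp⟩
      have hw2 : lam a b * w ^ 2 = z ^ 3 + RatFunc.C a * z ^ 2 + RatFunc.C b * z := by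
        apply mul_left_cancel₀ (pow_ne_zero 3 hl)
        rw [hxz, hw] at hs
        linear_combination hs
      obtain ⟨alg1, alg2⟩ := alg_identity (lam a b) w z RatFunc.X (RatFunc.C a) (RatFunc.C b) hzX hlX hw2
      have kp := addX_eq a b x y (lam a b ^ 2 * 1) w 1 z hxz hw rfl hzX
      have km := addX_eq a b x y ((curve a b).negY (lam a b * RatFunc.X) (lam a b ^ 2 * 1)) w (-1) z hxz hw
        (by simp [WeierstrassCurve.Affine.negY, curve]) hzX
      have hC : ∀ p : F, (C p : F[X]).natDegree ≤ 0 := fun p => by simp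
      have hXd : (X : F[X]).natDegree ≤ 1 := by simp
      have hXB : (X * B).natDegree ≤ rht z + 1 := natDegree_mul_le.trans (by omega)
      have hXA : (A * X).natDegree ≤ rht z + 1 := natDegree_mul_le.trans (by omega)
      have hbB : (C b * B).natDegree ≤ rht z + 1 := natDegree_mul_le.trans (by have := hC b; omega)
      have hAXB : (A - X * B).natDegree ≤ rht z + 1 := (natDegree_sub_le _ _).trans (max_le (by omega) hXB)
      have hAXB' : (A + X * B).natDegree ≤ rht z + 1 := (natDegree_add_le _ _).trans (max_le (by omega) hXB)
      have hAbB : (A * X - C b * B).natDegree ≤ rht z + 1 := (natDegree_sub_le _ _).trans (max_le hXA hbB)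
      have hAbB' : (A * X + C b * B).natDegree ≤ rht z + 1 := (natDegree_add_le _ _).trans (max_le hXA hbB)
      refine rht_pair _ _ ((A - X * B) ^ 2) (C 2 * ((A + X * B) * (A * X + C b * B) + C (2 * a) * ((A * X) * B)))
        ((A * X - C b * B) ^ 2) ?_ ?_ ?_ _ ?_ ?_ ?_
      · apply pow_ne_zero
        intro h0
        apply hzX
        have : algebraMap F[X] (RatFunc F) (A - X * B) = 0 := by rw [h0, map_zero]
        rw [map_sub, map_mul, hzAB, RatFunc.algebraMap_X] at this
        have h' : (z - RatFunc.X) * algebraMap F[X] (RatFunc F) B = 0 := by linear_combination this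
        exact (mul_eq_zero.1 h').resolve_right hB0'
      · rw [WeierstrassCurve.Affine.slope_of_X_ne hx, WeierstrassCurve.Affine.slope_of_X_ne hx, kp, km]
        simp only [map_add, map_mul, map_sub, map_pow,
          RatFunc.algebraMap_X, RatFunc.algebraMap_C, hzAB, map_ofNat]
        linear_combination (algebraMap F[X] (RatFunc F) B) ^ 2 * alg1
      · rw [WeierstrassCurve.Affine.slope_of_X_ne hx, WeierstrassCurve.Affine.slope_of_X_ne hx, kp, km]
        simp only [map_mul, map_sub, map_pow,
          RatFunc.algebraMap_X, RatFunc.algebraMap_C, hzAB]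
        linear_combination (algebraMap F[X] (RatFunc F) B) ^ 2 * alg2
      · refine (natDegree_pow_le).trans (by omega)
      · refine natDegree_mul_le.trans ?_
        have := hC 2
        have h1 : ((A + X * B) * (A * X + C b * B)).natDegree ≤ 2 * rht z + 2 := natDegree_mul_le.trans (by omega)
        have h3 : (C (2 * a) * ((A * X) * B)).natDegree ≤ 2 * rht z + 2 := by
          refine natDegree_mul_le.trans ?_
          have := hC (2 * a)
          have : (A * X * B).natDegree ≤ 2 * rht z + 2 := natDegree_mul_le.trans (by omega)
          omega
        have := (natDegree_add_le ((A + X * B) * (A * X + C b * B)) (C (2 * a) * ((A * X) * B))).trans (max_le h1 h3)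
        omega
      · refine (natDegree_pow_le).trans (by omega)

end curve

set_option linter.unusedSectionVars false


section hasse
variable {F : Type} [Field F] [Fintype F] [DecidableEq F]

/-- The character sum. -/
noncomputable def csum (a b : F) : ℤ := ∑ r : F, quadraticChar F (r ^ 3 + a * r ^ 2 + b * r)

lemma cub_eval (a b r : F) : (cub a b).eval r = r ^ 3 + a * r ^ 2 + b * r := by
  simp [cub]

/-- multiplicity exponents -/
noncomputable def mexp (a b : F) (ε : ℤ) (r : F) : ℕ := (1 + ε * quadraticChar F ((cub a b).eval r)).toNat

/-- common factor -/
noncomputable def gfac (a b : F) (ε : ℤ) : F[X] := ∏ r : F, (X - C r) ^ mexp a b ε r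

lemma qc_cases (x : F) : quadraticChar F x = 0 ∨ quadraticChar F x = 1 ∨ quadraticChar F x = -1 := by
  by_cases h : x = 0
  · left; simp [h]
  · right; exact quadraticChar_dichotomy h

lemma gfac_natDegree (a b : F) (ε : ℤ) (hε : ε = 1 ∨ ε = -1) :
    ((gfac a b ε).natDegree : ℤ) = Fintype.card F + ε * csum a b := by
  unfold gfac
  rw [natDegree_prod _ _ (fun r _ => pow_ne_zero _ (X_sub_C_ne_zero r))]
  simp only [natDegree_pow, natDegree_X_sub_C, mul_one]
  push_cast
  have : ∀ r : F, ((mexp a b ε r : ℕ) : ℤ) = 1 + ε * quadraticChar F (r ^ 3 + a * r ^ 2 + b * r) := by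
    intro r
    unfold mexp
    rw [cub_eval, Int.toNat_of_nonneg]
    rcases hε with h | h <;> rcases qc_cases (r ^ 3 + a * r ^ 2 + b * r) with h' | h' | h' <;> rw [h, h'] <;> norm_num
  rw [Finset.sum_congr rfl (fun r _ => this r), Finset.sum_add_distrib, ← Finset.mul_sum, csum]
  simp

lemma gfac_ne_zero (a b : F) (ε : ℤ) : gfac a b ε ≠ 0 :=
  Finset.prod_ne_zero_iff.2 fun r _ => pow_ne_zero _ (X_sub_C_ne_zero r)

lemma gfac_dvd (a b : F) (ε : ℤ) (p : F[X]) (h : ∀ r : F, (X - C r) ^ mexp a b ε r ∣ p) :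
    gfac a b ε ∣ p := by
  unfold gfac
  apply Finset.prod_dvd_of_coprime
  · intro r _ s _ hrs
    exact (isCoprime_X_sub_C_of_isUnit_sub (sub_ne_zero.2 hrs).isUnit).pow
  · intro r _; exact h r

lemma mexp_le (a b : F) (ε : ℤ) (hε : ε = 1 ∨ ε = -1) (r : F) : mexp a b ε r ≤ 2 := by
  unfold mexp
  rcases hε with h | h <;> rcases qc_cases ((cub a b).eval r) with h' | h' | h' <;> rw [h, h'] <;> norm_num

lemma lin_dvd (r : F) : (X - C r) ∣ (X ^ Fintype.card F - X : F[X]) := by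
  rw [dvd_iff_isRoot]; simp [FiniteField.pow_card]

/-- numerator of x(P₀ ± Q) -/
noncomputable def numer (a b : F) (ε : ℤ) (m : ℕ) : F[X] :=
  cub a b * (cub a b ^ m - (ε : F[X])) ^ 2 - (C a + X ^ Fintype.card F + X) * (X ^ Fintype.card F - X) ^ 2

lemma gfac_dvd_numer (hF : ringChar F ≠ 2) (a b : F) (ε : ℤ) (hε : ε = 1 ∨ ε = -1) (m : ℕ) (hm : Fintype.card F = 2 * m + 1) :
    gfac a b ε ∣ numer a b ε m := by
  have hm' : m = Fintype.card F / 2 := by omega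
  apply gfac_dvd
  intro r
  unfold numer
  apply dvd_sub
  · have hq := quadraticChar_eq_pow_of_char_ne_two' hF ((cub a b).eval r)
    rw [← hm'] at hq
    by_cases h0 : (cub a b).eval r = 0
    · have : mexp a b ε r = 1 := by simp [mexp, h0]
      rw [this, pow_one]
      exact (dvd_iff_isRoot.2 h0).mul_right _
    · by_cases h1 : quadraticChar F ((cub a b).eval r) = ε
      · refine ((pow_dvd_pow _ (mexp_le a b ε hε r)).trans ?_).mul_left _
        apply pow_dvd_pow_of_dvd
        rw [dvd_iff_isRoot]
        simp only [IsRoot.def, eval_sub, eval_pow, eval_intCast]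
        rw [← hq, h1]; simp
      · have : mexp a b ε r = 0 := by
          unfold mexp
          have h2 := quadraticChar_dichotomy h0
          rcases hε with h | h <;> rcases h2 with h' | h' <;>
            first | exact absurd (h'.trans h.symm) h1 | (rw [h, h']; norm_num)
        rw [this]; simp
  · exact (pow_dvd_pow_of_dvd (lin_dvd r) _).trans (pow_dvd_pow_of_dvd dvd_rfl _) |> fun h =>
      ((pow_dvd_pow _ (mexp_le a b ε hε r)).trans h).mul_left _

lemma gfac_dvd_den (a b : F) (ε : ℤ) (hε : ε = 1 ∨ ε = -1) :
    gfac a b ε ∣ (X ^ Fintype.card F - X) ^ 2 := by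
  apply gfac_dvd
  intro r
  exact (pow_dvd_pow _ (mexp_le a b ε hε r)).trans (pow_dvd_pow_of_dvd (lin_dvd r) _)

lemma cub_pow_card (a b : F) : cub a b ^ Fintype.card F =
    X ^ (3 * Fintype.card F) + C a * X ^ (2 * Fintype.card F) + C b * X ^ Fintype.card F := by
  rw [← FiniteField.expand_card]
  simp only [cub, map_add, map_mul, map_pow, expand_X, expand_C]
  rw [← pow_mul, ← pow_mul, mul_comm _ 3, mul_comm _ 2]

lemma numer_natDegree (a b : F) (ε : ℤ) (hε : ε = 1 ∨ ε = -1) (m : ℕ) (hm : Fintype.card F = 2 * m + 1) :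
    (numer a b ε m).natDegree ≤ 2 * Fintype.card F + 1 := by
  have h1 := cub_pow_card a b
  have hε2 : (ε : F[X]) ^ 2 = 1 := by rcases hε with h | h <;> simp [h]
  have key : numer a b ε m = (X ^ Fintype.card F + X) * (X ^ (Fintype.card F + 1) + C b) + C (2 * a) * X ^ (Fintype.card F + 1)
      - C (2 * (ε : F)) * cub a b ^ (m + 1) := by
    have h2 : cub a b * (cub a b ^ m - (ε : F[X])) ^ 2 = cub a b ^ Fintype.card F + cub a b - 2 * ε * cub a b ^ (m + 1) := by
      rw [hm]; linear_combination cub a b * hε2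
    unfold numer
    rw [h2, h1]
    have e3 : (X : F[X]) ^ (3 * Fintype.card F) = (X ^ Fintype.card F) ^ 3 := by rw [← pow_mul, mul_comm]
    have e2 : (X : F[X]) ^ (2 * Fintype.card F) = (X ^ Fintype.card F) ^ 2 := by rw [← pow_mul, mul_comm]
    rw [e3, e2, pow_succ X (Fintype.card F)]
    have : cub a b = X ^ 3 + C a * X ^ 2 + C b * X := rfl
    rw [this]
    simp only [map_mul, map_ofNat, map_intCast]
    ring
  rw [key]
  have k1 : (cub a b ^ (m + 1)).natDegree ≤ 2 * Fintype.card F + 1 := by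
    rw [natDegree_pow, cub_natDegree]; omega
  refine (natDegree_sub_le _ _).trans (max_le ?_ ?_)
  · have : 1 ≤ Fintype.card F := by omega
    compute_degree
    omega
  · exact (natDegree_C_mul_le _ _).trans k1

lemma den_ne_zero (h1 : 1 < Fintype.card F) : (X ^ Fintype.card F - X : F[X]) ≠ 0 :=
  FiniteField.X_pow_card_sub_X_ne_zero F h1

/-- Frobenius point. -/
noncomputable def Ppt (h2 : (2 : F) ≠ 0) (a b : F) (m : ℕ) (hm : Fintype.card F = 2 * m + 1) : (curve a b).Point :=
  .some (lam a b * RatFunc.X ^ Fintype.card F) (lam a b ^ 2 * lam a b ^ m)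
    (curve_nonsing a b h2 (RatFunc.X ^ Fintype.card F) (lam a b ^ m) (pow_ne_zero _ (lam_ne_zero a b)) (by
      have h := congrArg (algebraMap F[X] (RatFunc F)) (cub_pow_card a b)
      simp only [map_pow, map_add, map_mul, RatFunc.algebraMap_X, RatFunc.algebraMap_C] at h
      have h' : lam a b * (lam a b ^ m) ^ 2 = lam a b ^ Fintype.card F := by rw [hm]; ring
      rw [h']
      unfold lam
      rw [h, ← pow_mul, ← pow_mul, mul_comm _ 3, mul_comm _ 2]))

lemma pht_Ppt (h2 : (2 : F) ≠ 0) (a b : F) (m : ℕ) (hm : Fintype.card F = 2 * m + 1) :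
    pht a b (Ppt h2 a b m hm) = Fintype.card F := by
  simp only [pht, Ppt, mul_div_cancel_left₀ _ (lam_ne_zero a b)]
  have : (RatFunc.X : RatFunc F) ^ Fintype.card F = algebraMap F[X] (RatFunc F) (X ^ Fintype.card F) := by simp
  rw [this, rht, RatFunc.num_algebraMap, RatFunc.denom_algebraMap]
  simp

/-- `Q` with sign -/
noncomputable def sQ (a b : F) (h2 : (2 : F) ≠ 0) (ε : ℤ) : (curve a b).Point :=
  if ε = 1 then Qpt a b h2 else - Qpt a b h2

open Classical in
lemma add_exists {K : Type} [Field K] (W : WeierstrassCurve.Affine K) (x₁ y₁ x₂ y₂ : K)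
    (h₁ : W.Nonsingular x₁ y₁) (h₂ : W.Nonsingular x₂ y₂) (hx : x₁ ≠ x₂) :
    ∃ x y h, WeierstrassCurve.Affine.Point.some x₁ y₁ h₁ + WeierstrassCurve.Affine.Point.some x₂ y₂ h₂
      = WeierstrassCurve.Affine.Point.some (W' := W) x y h ∧ x = W.addX x₁ x₂ ((y₁ - y₂) / (x₁ - x₂)) := by
  refine ⟨_, _, W.nonsingular_add h₁ h₂ fun hxy => hx hxy.1, WeierstrassCurve.Affine.Point.add_of_X_ne hx, ?_⟩
  rw [WeierstrassCurve.Affine.slope_of_X_ne hx]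

open Classical in
lemma pht_add (hF : ringChar F ≠ 2) (h2 : (2 : F) ≠ 0) (a b : F) (ε : ℤ) (hε : ε = 1 ∨ ε = -1) (m : ℕ)
    (hm : Fintype.card F = 2 * m + 1) :
    (pht a b (Ppt h2 a b m hm + sQ a b h2 ε) : ℤ) ≤ Fintype.card F + 1 - ε * csum a b := by
  have hc1 : 1 < Fintype.card F := Fintype.one_lt_card
  have hl := lam_ne_zero a b
  have hzX : (RatFunc.X : RatFunc F) ^ Fintype.card F - RatFunc.X ≠ 0 := by
    have := RatFunc.algebraMap_ne_zero (den_ne_zero (F := F) hc1)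
    simpa using this
  have hx : lam a b * RatFunc.X ^ Fintype.card F ≠ lam a b * RatFunc.X := by
    intro h; exact hzX (sub_eq_zero.2 (mul_left_cancel₀ hl h))
  obtain ⟨A, hA⟩ := gfac_dvd_numer hF a b ε hε m hm
  obtain ⟨B, hB⟩ := gfac_dvd_den a b ε hε
  have hg := gfac_ne_zero a b ε
  have hD0 : (X ^ Fintype.card F - X : F[X]) ^ 2 ≠ 0 := pow_ne_zero 2 (den_ne_zero hc1)
  have hB0 : B ≠ 0 := by rintro rfl; apply hD0; rw [hB, mul_zero]
  have hgd := gfac_natDegree a b ε hε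
  have dB : (gfac a b ε).natDegree + B.natDegree = 2 * Fintype.card F := by
    rw [← natDegree_mul hg hB0, ← hB, natDegree_pow, FiniteField.X_pow_card_sub_X_natDegree_eq F hc1]
  have dA : A ≠ 0 → (gfac a b ε).natDegree + A.natDegree ≤ 2 * Fintype.card F + 1 := by
    intro h
    rw [← natDegree_mul hg h, ← hA]
    exact numer_natDegree a b ε hε m hm
  have hval : ∃ x y h, Ppt h2 a b m hm + sQ a b h2 ε = .some x y h ∧ x / lam a b
      = lam a b * (lam a b ^ m - (ε : RatFunc F)) ^ 2 / (RatFunc.X ^ Fintype.card F - RatFunc.X) ^ 2 - RatFunc.C a - RatFunc.X ^ Fintype.card F - RatFunc.X := by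
    unfold sQ
    split_ifs with h1
    · unfold Ppt Qpt
      obtain ⟨x, y, h, hP, hxe⟩ := add_exists (curve a b) _ _ _ _ _ _ hx
      refine ⟨x, y, h, hP, ?_⟩
      rw [hxe]
      exact addX_eq a b _ _ _ _ _ _ rfl rfl (by rw [h1]; simp) hzX
    · unfold Ppt Qpt
      rw [WeierstrassCurve.Affine.Point.neg_some]
      obtain ⟨x, y, h, hP, hxe⟩ := add_exists (curve a b) _ _ _ _ _ _ hx
      refine ⟨x, y, h, hP, ?_⟩
      rw [hxe]
      exact addX_eq a b _ _ _ _ _ _ rfl rfl (by rw [hε.resolve_left h1]; simp [WeierstrassCurve.Affine.negY, curve]) hzX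
  obtain ⟨x, y, h, hP, hxv⟩ := hval
  rw [hP]
  simp only [pht]
  have hnn : (0 : ℤ) ≤ Fintype.card F + 1 - ε * csum a b := by
    have : (0 : ℤ) ≤ B.natDegree := by positivity
    push_cast at *
    omega
  rw [← Int.le_toNat hnn]
  have hgm : algebraMap F[X] (RatFunc F) (gfac a b ε) ≠ 0 := RatFunc.algebraMap_ne_zero hg
  refine rht_le _ A B hB0 ?_ _ ?_ ?_
  · apply mul_left_cancel₀ hgm
    rw [mul_left_comm, ← map_mul, ← map_mul, ← hA, ← hB, hxv]
    simp only [numer, map_sub, map_mul, map_pow, map_add, RatFunc.algebraMap_X, RatFunc.algebraMap_C, map_intCast]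
    rw [← lam]
    field_simp
    ring
  · by_cases hA0 : A = 0
    · simp [hA0]
    · have := dA hA0
      omega
  · omega

open Classical in
lemma pht_seq (hF : ringChar F ≠ 2) (h2 : (2 : F) ≠ 0) (a b : F) (ε : ℤ) (hε : ε = 1 ∨ ε = -1) (m : ℕ)
    (hm : Fintype.card F = 2 * m + 1) (n : ℕ) :
    (pht a b (Ppt h2 a b m hm + (n + 1) • sQ a b h2 ε) : ℤ) - pht a b (Ppt h2 a b m hm + n • sQ a b h2 ε)
      ≤ 2 * n + 1 - ε * csum a b ∧
    (pht a b (Ppt h2 a b m hm + n • sQ a b h2 ε) : ℤ) ≤ n ^ 2 - n * (ε * csum a b) + Fintype.card F := by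
  induction n with
  | zero =>
    have := pht_add hF h2 a b ε hε m hm
    have h0 := pht_Ppt h2 a b m hm
    simp only [zero_add, one_nsmul, zero_nsmul, add_zero, h0]
    push_cast
    constructor <;> linarith
  | succ n ih =>
    obtain ⟨i1, i2⟩ := ih
    have hp : pht a b ((Ppt h2 a b m hm + (n + 1) • sQ a b h2 ε) + sQ a b h2 ε) +
      pht a b ((Ppt h2 a b m hm + (n + 1) • sQ a b h2 ε) - sQ a b h2 ε) ≤ 2 * pht a b (Ppt h2 a b m hm + (n + 1) • sQ a b h2 ε) + 2 := by
      have := parallelogram a b h2 (Ppt h2 a b m hm + (n + 1) • sQ a b h2 ε)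
      unfold sQ at *
      split_ifs at * with h1
      · exact this
      · rw [sub_neg_eq_add, ← sub_eq_add_neg, add_comm]; exact this
    have e1 : (Ppt h2 a b m hm + (n + 1) • sQ a b h2 ε) + sQ a b h2 ε = Ppt h2 a b m hm + (n + 1 + 1) • sQ a b h2 ε := by
      rw [succ_nsmul _ (n+1), add_assoc]
    have e2 : (Ppt h2 a b m hm + (n + 1) • sQ a b h2 ε) - sQ a b h2 ε = Ppt h2 a b m hm + n • sQ a b h2 ε := by
      rw [succ_nsmul, ← add_assoc, add_sub_cancel_right]
    rw [e1, e2] at hp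
    push_cast
    constructor
    · linarith
    · linarith

theorem csum_bound (hF : ringChar F ≠ 2) (a b : F) :
    |(csum a b : ℝ)| ≤ 2 * Real.sqrt (Fintype.card F) + 1 := by
  classical
  have h2 : (2 : F) ≠ 0 := Ring.two_ne_zero hF
  have hodd := FiniteField.odd_card_of_char_ne_two hF
  obtain ⟨m, hm⟩ : ∃ m, Fintype.card F = 2 * m + 1 := ⟨Fintype.card F / 2, by omega⟩
  have key : ∀ ε : ℤ, (ε = 1 ∨ ε = -1) → ∀ n : ℕ, (0 : ℝ) ≤ n ^ 2 - n * (ε * csum a b) + Fintype.card F := by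
    intro ε hε n
    have := (pht_seq hF h2 a b ε hε m hm n).2
    have h0 : (0 : ℤ) ≤ n ^ 2 - n * (ε * csum a b) + Fintype.card F := le_trans (by positivity) this
    exact_mod_cast h0
  set s := Real.sqrt (Fintype.card F) with hs
  have hs2 : s ^ 2 = Fintype.card F := Real.sq_sqrt (by positivity)
  have hcp : (0 : ℝ) < Fintype.card F := by exact_mod_cast Fintype.card_pos
  have hs0 : 0 < s := Real.sqrt_pos.2 hcp
  have hn1 := Nat.le_ceil s
  have hn2 := Nat.ceil_lt_add_one hs0.le
  have gen : ∀ ε : ℤ, (ε = 1 ∨ ε = -1) → (ε * csum a b : ℝ) ≤ 2 * s + 1 := by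
    intro ε hε
    have k := key ε hε ⌈s⌉₊
    set n : ℝ := (⌈s⌉₊ : ℝ)
    rw [← hs2] at k
    by_contra hcon
    push Not at hcon
    have : n * (2 * s + 1) < n * (ε * csum a b) := mul_lt_mul_of_pos_left hcon (by linarith)
    nlinarith
  rw [abs_le]
  have g1 := gen 1 (Or.inl rfl)
  have g2 := gen (-1) (Or.inr rfl)
  push_cast at g1 g2
  constructor <;> linarith

end hasse


section reduction
variable {F K : Type} [Field F] [Fintype F] [DecidableEq F] [Field K] [Fintype K] [DecidableEq K] [Algebra F K]

/-- coordinates -/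
noncomputable def ee (i : K) (z : F × F) : K := algebraMap F K z.1 + algebraMap F K z.2 * i

/-- what we need to know about the quartic character -/
structure Setup (F : Type) {K : Type} [Field F] [Fintype F] [DecidableEq F] [Field K] [Fintype K] [DecidableEq K] [Algebra F K]
    (i : K) (χ : MulChar K ℂ) : Prop where
  char2 : ringChar F ≠ 2
  hi : i * i = -1
  bij : Function.Bijective (ee (F := F) i)
  anis : ∀ x y : F, x ^ 2 + y ^ 2 = 0 → x = 0 ∧ y = 0
  triv : ∀ c : F, c ≠ 0 → χ (algebraMap F K c) = 1
  qF : ∀ x y : F, χ (ee i (x, y)) ^ 2 = ((quadraticChar F (x ^ 2 + y ^ 2) : ℤ) : ℂ)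
  qK : ∀ x : K, χ x ^ 2 = ((quadraticChar K x : ℤ) : ℂ)
  cube : ∀ x y : F, χ (ee i (x, -y)) = χ (ee i (x, y)) ^ 3
  charK : ringChar K ≠ 2
  nontriv : χ ≠ 1

lemma ee_mul (i : K) (hi : i * i = -1) (a b c d : F) :
    ee i (a, b) * ee i (c, d) = ee i (a * c - b * d, a * d + b * c) := by
  simp only [ee, map_sub, map_mul, map_add]
  linear_combination (algebraMap F K b * algebraMap F K d) * hi

lemma ee_smul (i : K) (c : F) (a b : F) : ee i (c * a, c * b) = algebraMap F K c * ee i (a, b) := by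
  simp only [ee, map_mul]; ring

variable {i : K} {χ : MulChar K ℂ}

lemma line_sum (H : Setup F i χ) (P Q : F) (hPQ : ¬ (P = 0 ∧ Q = 0)) :
    ∑ z : F × F, (if Q * z.1 = P * z.2 then χ (ee i z) else 0) = ((Fintype.card F : ℂ) - 1) * χ (ee i (P, Q)) := by
  rw [← Finset.sum_filter]
  have h1 : ∑ z : F × F with Q * z.1 = P * z.2, χ (ee i z) = ∑ c : F, χ (ee i (c * P, c * Q)) := by
    symm
    apply Finset.sum_bij (fun c _ => (c * P, c * Q))
    · intro c _; simp; ring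
    · intro c _ d _ h
      simp only [Prod.mk.injEq] at h
      by_cases hP : P = 0
      · exact mul_right_cancel₀ (fun hQ => hPQ ⟨hP, hQ⟩) h.2
      · exact mul_right_cancel₀ hP h.1
    · rintro ⟨x, y⟩ h
      simp only [Finset.mem_filter, Finset.mem_univ, true_and] at h
      by_cases hP : P = 0
      · have hQ : Q ≠ 0 := fun hQ => hPQ ⟨hP, hQ⟩
        refine ⟨y / Q, Finset.mem_univ _, ?_⟩
        rw [hP, zero_mul] at h
        have := (mul_eq_zero.1 h).resolve_left hQ
        simp [hP, this, hQ]
      · refine ⟨x / P, Finset.mem_univ _, ?_⟩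
        ext
        · simp [hP]
        · simp only; field_simp; linear_combination h
    · intro c _; rfl
  rw [h1]
  have h2 : ∀ c : F, χ (ee i (c * P, c * Q)) = (if c = 0 then 0 else 1) * χ (ee i (P, Q)) := by
    intro c
    rw [ee_smul, map_mul]
    split_ifs with h
    · rw [h, map_zero, MulChar.map_zero]
    · rw [H.triv c h]
  rw [Finset.sum_congr rfl fun c _ => h2 c, ← Finset.sum_mul]
  congr 1
  have : ∀ c : F, (if c = 0 then (0 : ℂ) else 1) = 1 - if c = 0 then 1 else 0 := by
    intro c; split_ifs <;> simp
  rw [Finset.sum_congr rfl fun c _ => this c, Finset.sum_sub_distrib]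
  simp

lemma quad_count (hF : ringChar F ≠ 2) (α β γ : F) (hα : α ≠ 0) :
    ((Finset.univ.filter fun a : F => α * a ^ 2 + β * a + γ = 0).card : ℤ) = 1 + quadraticChar F (β ^ 2 - 4 * α * γ) := by
  have h2 : (2 : F) ≠ 0 := Ring.two_ne_zero hF
  have h4 : (4 : F) ≠ 0 := by have := mul_ne_zero h2 h2; norm_num at this; exact this
  have := quadraticChar_card_sqrts hF (β ^ 2 - 4 * α * γ)
  rw [add_comm, ← this]
  congr 1
  apply Finset.card_bij (fun a _ => 2 * α * a + β)
  · intro a ha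
    simp only [Finset.mem_filter, Finset.mem_univ, true_and] at ha
    simp only [Set.mem_toFinset, Set.mem_ofPred_eq]
    linear_combination 4 * α * ha
  · intro a _ b _ h
    have : 2 * α * (a - b) = 0 := by linear_combination h
    exact sub_eq_zero.1 ((mul_eq_zero.1 this).resolve_left (mul_ne_zero h2 hα))
  · intro t ht
    simp only [Set.mem_toFinset, Set.mem_ofPred_eq] at ht
    refine ⟨(t - β) / (2 * α), ?_, by field_simp; ring⟩
    simp only [Finset.mem_filter, Finset.mem_univ, true_and]
    field_simp
    linear_combination ht

lemma sum_all (H : Setup F i χ) : ∑ z : F × F, χ (ee i z) = 0 := by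
  have h := (Equiv.ofBijective _ H.bij).sum_comp (fun x => χ x)
  simp only [Equiv.ofBijective_apply] at h
  rw [h]
  exact MulChar.sum_eq_zero_of_ne_one H.nontriv

lemma sum_axis (H : Setup F i χ) : ∑ z : F × F, (if z.2 = 0 then χ (ee i z) else 0) = (Fintype.card F : ℂ) - 1 := by
  have := line_sum H 1 0 (by simp)
  have h1 : χ (ee i ((1 : F), (0 : F))) = 1 := by simp [ee]
  rw [h1, mul_one] at this
  rw [← this]
  apply Finset.sum_congr rfl
  intro z _
  simp [eq_comm]

lemma card_sub_one_ne (H : Setup F i χ) : (Fintype.card F : ℂ) - 1 ≠ 0 := by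
  have : 1 < Fintype.card F := Fintype.one_lt_card
  rw [sub_ne_zero]
  exact_mod_cast this.ne'

lemma single_sum (H : Setup F i χ) (u1 u2 : F) (hu : u2 ≠ 0) : ∑ a : F, χ (ee i (u1 - a, u2)) = -1 := by
  apply mul_left_cancel₀ (card_sub_one_ne H)
  rw [Finset.mul_sum]
  rw [Finset.sum_congr rfl fun a _ => (line_sum H (u1 - a) u2 (by simp [hu])).symm, Finset.sum_comm]
  have : ∀ z : F × F, ∑ a : F, (if u2 * z.1 = (u1 - a) * z.2 then χ (ee i z) else 0)
      = χ (ee i z) - (if z.2 = 0 then χ (ee i z) else 0) := by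
    rintro ⟨x, y⟩
    simp only
    by_cases hy : y = 0
    · subst hy
      by_cases hx : x = 0
      · subst hx; simp [ee, MulChar.map_zero]
      · simp [hu, hx]
    · have : ∀ a : F, u2 * x = (u1 - a) * y ↔ a = u1 - u2 * x / y := by
        intro a
        constructor
        · intro h; rw [h]; field_simp; ring
        · rintro rfl; field_simp; ring
      simp only [this, Finset.sum_ite_eq', Finset.mem_univ, if_true, hy, if_false, sub_zero]
  rw [Finset.sum_congr rfl fun z _ => this z, Finset.sum_sub_distrib, sum_all H, sum_axis H]
  ring

/-- the discriminant form -/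
def disc (d1 d2 p : F) (z : F × F) : F := (z.1 * d2 - z.2 * d1) ^ 2 + p * (z.1 ^ 2 + z.2 ^ 2)

lemma double_sum_step1 (H : Setup F i χ) (u1 u2 v1 v2 : F) (hu : u2 ≠ 0) (hv : v2 ≠ 0) (hconj : ¬ (v1 = u1 ∧ v2 = - u2)) :
    ((Fintype.card F : ℂ) - 1) * (∑ a : F, χ (ee i (u1 - a, u2) * ee i (v1 - a, v2)) + 1) =
      ∑ z : F × F, χ (ee i z) * ((quadraticChar F (disc (u1 - v1) (u2 - v2) (4 * u2 * v2) z) : ℤ) : ℂ) := by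
  have hF := H.char2
  have h2 : (2 : F) ≠ 0 := Ring.two_ne_zero hF
  have hne : ∀ a : F, ¬ ((u1 - a) * (v1 - a) - u2 * v2 = 0 ∧ (u1 - a) * v2 + u2 * (v1 - a) = 0) := by
    rintro a ⟨h1, h3⟩
    -- norm of the product vanishes
    have h4 : ((u1 - a) ^ 2 + u2 ^ 2) * ((v1 - a) ^ 2 + v2 ^ 2) = 0 := by
      linear_combination ((u1 - a) * (v1 - a) - u2 * v2) * h1 + ((u1 - a) * v2 + u2 * (v1 - a)) * h3
    rcases mul_eq_zero.1 h4 with h | h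
    · exact hu (H.anis _ _ h).2
    · exact hv (H.anis _ _ h).2
  rw [mul_add, Finset.mul_sum, mul_one]
  have e1 : ∀ a : F, ((Fintype.card F : ℂ) - 1) * χ (ee i (u1 - a, u2) * ee i (v1 - a, v2)) =
      ∑ z : F × F, if ((u1 - a) * v2 + u2 * (v1 - a)) * z.1 = ((u1 - a) * (v1 - a) - u2 * v2) * z.2 then χ (ee i z) else 0 := by
    intro a
    rw [ee_mul i H.hi, line_sum H _ _ (hne a)]
  rw [Finset.sum_congr rfl fun a _ => e1 a, Finset.sum_comm]
  have key : ∀ z : F × F, ∑ a : F, (if ((u1 - a) * v2 + u2 * (v1 - a)) * z.1 = ((u1 - a) * (v1 - a) - u2 * v2) * z.2 then χ (ee i z) else 0)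
      = χ (ee i z) + χ (ee i z) * ((quadraticChar F (disc (u1 - v1) (u2 - v2) (4 * u2 * v2) z) : ℤ) : ℂ)
        - (if z.2 = 0 then χ (ee i z) else 0) := by
    rintro ⟨x, y⟩
    simp only
    rw [← Finset.sum_filter, Finset.sum_const, nsmul_eq_mul]
    by_cases hy : y = 0
    · subst hy
      by_cases hx : x = 0
      · subst hx; simp [ee, MulChar.map_zero]
      · simp only [mul_zero, mul_eq_zero, hx, or_false, if_true]
        by_cases hs : u2 + v2 = 0
        · have hd : disc (u1 - v1) (u2 - v2) (4 * u2 * v2) (x, 0) = 0 := by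
            simp only [disc]
            linear_combination (x ^ 2 * (u2 + v2)) * hs
          have hc : (Finset.univ.filter fun a : F => (u1 - a) * v2 + u2 * (v1 - a) = 0) = ∅ := by
            ext a
            simp only [Finset.mem_filter, Finset.mem_univ, true_and, Finset.notMem_empty, iff_false]
            intro h
            apply hconj
            have hv2 : v2 = - u2 := by linear_combination hs
            refine ⟨?_, hv2⟩
            rw [hv2] at h
            have : u2 * (v1 - u1) = 0 := by linear_combination h
            exact sub_eq_zero.1 ((mul_eq_zero.1 this).resolve_left hu)
          rw [hd, hc]; simp
        · have hd : disc (u1 - v1) (u2 - v2) (4 * u2 * v2) (x, 0) = (x * (u2 + v2)) ^ 2 := by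
            simp only [disc]; ring
          have hc : (Finset.univ.filter fun a : F => (u1 - a) * v2 + u2 * (v1 - a) = 0) = {(u1 * v2 + u2 * v1) / (u2 + v2)} := by
            ext a
            simp only [Finset.mem_filter, Finset.mem_univ, true_and, Finset.mem_singleton]
            rw [eq_div_iff hs]
            constructor <;> intro h <;> linear_combination -h
          rw [hd, hc, quadraticChar_sq_one' (mul_ne_zero hx hs)]
          simp
    · have hc := quad_count hF (-y) (y * (u1 + v1) - x * (u2 + v2)) (x * (u1 * v2 + u2 * v1) - y * (u1 * v1 - u2 * v2)) (neg_ne_zero.2 hy)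
      have hd : (y * (u1 + v1) - x * (u2 + v2)) ^ 2 - 4 * (-y) * (x * (u1 * v2 + u2 * v1) - y * (u1 * v1 - u2 * v2))
          = disc (u1 - v1) (u2 - v2) (4 * u2 * v2) (x, y) := by
        simp only [disc]; ring
      rw [hd] at hc
      have hf : (Finset.univ.filter fun a : F => ((u1 - a) * v2 + u2 * (v1 - a)) * x = ((u1 - a) * (v1 - a) - u2 * v2) * y)
          = (Finset.univ.filter fun a : F => -y * a ^ 2 + (y * (u1 + v1) - x * (u2 + v2)) * a + (x * (u1 * v2 + u2 * v1) - y * (u1 * v1 - u2 * v2)) = 0) := by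
        ext a
        simp only [Finset.mem_filter, Finset.mem_univ, true_and]
        constructor <;> intro h <;> linear_combination h
      rw [hf]
      have hc' := congrArg (fun n : ℤ => (n : ℂ)) hc
      push_cast at hc'
      rw [hc']
      simp only [hy, if_false]
      ring
  rw [Finset.sum_congr rfl fun z _ => key z, Finset.sum_sub_distrib, Finset.sum_add_distrib, sum_all H, sum_axis H]
  ring


lemma sum_sq {L : Type} [Field L] [Fintype L] [DecidableEq L] {R : Type} [CommRing R] (hL : ringChar L ≠ 2) (f : L → R) :
    ∑ r : L, f (r ^ 2) = ∑ t : L, (1 + ((quadraticChar L t : ℤ) : R)) * f t := by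
  rw [← Finset.sum_fiberwise Finset.univ (fun r : L => r ^ 2) (fun r => f (r ^ 2))]
  apply Finset.sum_congr rfl
  intro t _
  rw [Finset.sum_congr rfl (g := fun _ => f t) (by intro r hr; rw [(Finset.mem_filter.1 hr).2])]
  rw [Finset.sum_const, nsmul_eq_mul]
  congr 1
  have := quadraticChar_card_sqrts hL t
  have h2 : (({x : L | x ^ 2 = t}.toFinset).card : ℤ) = ((Finset.univ.filter fun r : L => r ^ 2 = t).card : ℤ) := by
    congr 2; ext; simp
  rw [h2] at this
  have h3 := congrArg (fun n : ℤ => (n : R)) this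
  push_cast at h3
  rw [h3]; ring

/-- the symmetric quadratic form after rotating -/
def psi (m p : F) (z : F × F) : F := m * (m * z.2 ^ 2 + p * (z.1 ^ 2 + z.2 ^ 2))

lemma step4 (H : Setup F i χ) (d1 d2 p : F) (hd : ¬ (d1 = 0 ∧ d2 = 0)) :
    ∑ z : F × F, χ (ee i z) * ((quadraticChar F (disc d1 d2 p z) : ℤ) : ℂ) =
      χ (ee i (d1, d2)) * ∑ z : F × F, χ (ee i z) * ((quadraticChar F (psi (d1 ^ 2 + d2 ^ 2) p z) : ℤ) : ℂ) := by
  have hm : d1 ^ 2 + d2 ^ 2 ≠ 0 := fun h => hd (H.anis _ _ h)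
  have hb : Function.Bijective (fun z : F × F => (d1 * z.1 - d2 * z.2, d1 * z.2 + d2 * z.1)) := by
    rw [← Finite.injective_iff_bijective]
    rintro ⟨a, b⟩ ⟨c, d⟩ h
    simp only [Prod.mk.injEq] at h
    obtain ⟨h1, h2⟩ := h
    ext
    · apply mul_left_cancel₀ hm; linear_combination d1 * h1 + d2 * h2
    · apply mul_left_cancel₀ hm; linear_combination d1 * h2 - d2 * h1
  rw [← hb.sum_comp, Finset.mul_sum]
  apply Finset.sum_congr rfl
  rintro ⟨x, y⟩ _
  have h1 : disc d1 d2 p (d1 * x - d2 * y, d1 * y + d2 * x) = psi (d1 ^ 2 + d2 ^ 2) p (x, y) := by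
    simp only [disc, psi]; ring
  simp only [h1, ← ee_mul i H.hi, map_mul]
  ring

lemma step5 (H : Setup F i χ) (m p : F) :
    2 * ∑ z : F × F, χ (ee i z) * ((quadraticChar F (psi m p z) : ℤ) : ℂ) =
     ((∑ z : F × F, quadraticChar F ((z.1 ^ 2 + z.2 ^ 2) * psi m p (z.1 ^ 2 - z.2 ^ 2, 2 * z.1 * z.2)) : ℤ) : ℂ) := by
  set E := Equiv.ofBijective _ H.bij with hE
  have hEa : ∀ z, E z = ee i z := fun z => rfl
  set f : K → ℂ := fun x => χ x * ((quadraticChar F (psi m p (E.symm x)) : ℤ) : ℂ) with hf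
  have hs := sum_sq H.charK f
  rw [← E.sum_comp, ← E.sum_comp (fun t => (1 + ((quadraticChar K t : ℤ) : ℂ)) * f t)] at hs
  have h1 : ∑ z : F × F, f (E z ^ 2) = ((∑ z : F × F, quadraticChar F ((z.1 ^ 2 + z.2 ^ 2) * psi m p (z.1 ^ 2 - z.2 ^ 2, 2 * z.1 * z.2)) : ℤ) : ℂ) := by
    push_cast
    apply Finset.sum_congr rfl
    rintro ⟨r, s⟩ _
    have h2 : E (r, s) ^ 2 = E (r ^ 2 - s ^ 2, 2 * r * s) := by
      simp only [hEa]
      rw [sq, ee_mul i H.hi]; congr 2 <;> ring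
    simp only [hf]
    rw [map_pow, h2, Equiv.symm_apply_apply, hEa, H.qF, map_mul]
    push_cast; rfl
  rw [h1] at hs
  rw [hs, two_mul]
  simp only [add_mul, one_mul, Finset.sum_add_distrib]
  congr 1
  · apply Finset.sum_congr rfl
    intro z _
    simp only [hf, Equiv.symm_apply_apply]
    rw [hEa]
  · have hb : Function.Bijective (fun z : F × F => (z.1, -z.2)) := by
      apply Function.Involutive.bijective
      intro z; simp
    rw [← hb.sum_comp]
    apply Finset.sum_congr rfl
    rintro ⟨x, y⟩ _
    simp only [hf, Equiv.symm_apply_apply]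
    rw [hEa, H.cube, ← H.qK]
    have : psi m p (x, -y) = psi m p (x, y) := by simp [psi]
    rw [this]; ring

/-- the cubic -/
def gg (m p R : F) : F := m * (R + 1) * (4 * m * R + p * (R + 1) ^ 2)

lemma qc_mul_sq (a s : F) (hs : s ≠ 0) : quadraticChar F (s ^ 2 * a) = quadraticChar F a := by
  rw [map_mul, quadraticChar_sq_one' hs, one_mul]

lemma step6 (m p : F) :
    (∑ z : F × F, quadraticChar F ((z.1 ^ 2 + z.2 ^ 2) * psi m p (z.1 ^ 2 - z.2 ^ 2, 2 * z.1 * z.2)) : ℤ) =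
     ((Fintype.card F : ℤ) - 1) * (∑ r : F, quadraticChar F (gg m p (r ^ 2)) + quadraticChar F (m * p)) := by
  rw [Fintype.sum_prod_type_right]
  have h1 : ∀ s : F, ∑ r : F, quadraticChar F ((r ^ 2 + s ^ 2) * psi m p (r ^ 2 - s ^ 2, 2 * r * s))
     = if s = 0 then ((Fintype.card F : ℤ) - 1) * quadraticChar F (m * p) else ∑ r : F, quadraticChar F (gg m p (r ^ 2)) := by
    intro s
    split_ifs with hs
    · subst hs
      have : ∀ r : F, quadraticChar F ((r ^ 2 + 0 ^ 2) * psi m p (r ^ 2 - 0 ^ 2, 2 * r * 0))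
         = (1 - if r = 0 then 1 else 0) * quadraticChar F (m * p) := by
        intro r
        split_ifs with hr
        · subst hr; simp
        · have e : (r ^ 2 + 0 ^ 2) * psi m p (r ^ 2 - 0 ^ 2, 2 * r * 0) = (r ^ 3) ^ 2 * (m * p) := by
            simp only [psi]; ring
          rw [e, qc_mul_sq _ _ (pow_ne_zero _ hr)]; ring
      rw [Finset.sum_congr rfl fun r _ => this r, ← Finset.sum_mul, Finset.sum_sub_distrib]
      simp
    · have hb : Function.Bijective (fun r : F => r * s) := mulRight_bijective₀ s hs
      rw [← hb.sum_comp]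
      apply Finset.sum_congr rfl
      intro r _
      have e : ((r * s) ^ 2 + s ^ 2) * psi m p ((r * s) ^ 2 - s ^ 2, 2 * (r * s) * s) = (s ^ 3) ^ 2 * gg m p (r ^ 2) := by
        simp only [psi, gg]; ring
      rw [e, qc_mul_sq _ _ (pow_ne_zero _ hs)]
  have h2 : ∀ s : F, (if s = 0 then ((Fintype.card F : ℤ) - 1) * quadraticChar F (m * p) else ∑ r : F, quadraticChar F (gg m p (r ^ 2)))
     = ∑ r : F, quadraticChar F (gg m p (r ^ 2)) + if s = 0 then (((Fintype.card F : ℤ) - 1) * quadraticChar F (m * p) - ∑ r : F, quadraticChar F (gg m p (r ^ 2))) else 0 := by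
    intro s; split_ifs <;> ring
  simp only
  rw [Finset.sum_congr rfl fun s _ => (h1 s).trans (h2 s), Finset.sum_add_distrib]
  simp
  ring

lemma step7 (hF : ringChar F ≠ 2) (m p : F) :
    ∑ r : F, quadraticChar F (gg m p (r ^ 2)) + quadraticChar F (m * p) = 2 * ∑ R : F, quadraticChar F (gg m p R) := by
  have := sum_sq hF (fun R => quadraticChar F (gg m p R))
  rw [this]
  simp only [add_mul, one_mul, Finset.sum_add_distrib, Int.cast_id]
  have h1 : ∑ t : F, quadraticChar F t * quadraticChar F (gg m p t) =
      ∑ t : F, (quadraticChar F (gg m p t) - if t = 0 then quadraticChar F (m * p) else 0) := by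
    rw [← (inv_involutive (G := F)).bijective.sum_comp]
    apply Finset.sum_congr rfl
    intro t _
    split_ifs with ht
    · subst ht; simp [gg]
    · rw [← map_mul, sub_zero]
      have : gg m p t = (t ^ 2) ^ 2 * (t⁻¹ * gg m p t⁻¹) := by
        simp only [gg]; field_simp; ring
      rw [this, qc_mul_sq _ _ (pow_ne_zero _ ht)]
  rw [h1, Finset.sum_sub_distrib]
  simp
  ring

lemma step8 (m p : F) (hm : m ≠ 0) (hp : p ≠ 0) :
    ∑ R : F, quadraticChar F (gg m p R) = csum (4 * m ^ 2) (-4 * p * m ^ 3) := by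
  have hb : Function.Bijective (fun R : F => p * m * (R + 1)) :=
    (mulLeft_bijective₀ _ (mul_ne_zero hp hm)).comp (Equiv.addRight (1 : F)).bijective
  rw [csum, ← hb.sum_comp (fun r => quadraticChar F (r ^ 3 + 4 * m ^ 2 * r ^ 2 + -4 * p * m ^ 3 * r))]
  apply Finset.sum_congr rfl
  intro R _
  rw [← qc_mul_sq (gg m p R) (p * m) (mul_ne_zero hp hm)]
  congr 1
  simp only [gg]; ring

lemma norm_chi_le (H : Setup F i χ) (x : K) : ‖χ x‖ ≤ 1 := by
  have h := congrArg norm (H.qK x)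
  rw [norm_pow, Complex.norm_intCast] at h
  have h2 : |((quadraticChar K x : ℤ) : ℝ)| ≤ 1 := by
    by_cases hx : x = 0
    · subst hx; simp
    · rcases quadraticChar_dichotomy hx with h | h <;> rw [h] <;> simp
  rw [← h] at h2
  exact (sq_le_one_iff₀ (norm_nonneg _)).1 h2

lemma double_bound (H : Setup F i χ) (u1 u2 v1 v2 : F) (hu : u2 ≠ 0) (hv : v2 ≠ 0) (hne : ¬ (v1 = u1 ∧ v2 = u2))
    (hconj : ¬ (v1 = u1 ∧ v2 = - u2)) :
    ‖∑ a : F, χ (ee i (u1 - a, u2) * ee i (v1 - a, v2))‖ ≤ 2 * Real.sqrt (Fintype.card F) + 2 := by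
  have hd : ¬ (u1 - v1 = 0 ∧ u2 - v2 = 0) := fun h =>
    hne ⟨(sub_eq_zero.1 h.1).symm, (sub_eq_zero.1 h.2).symm⟩
  have h2 : (2 : F) ≠ 0 := Ring.two_ne_zero H.char2
  have h4 : (4 : F) ≠ 0 := by have := mul_ne_zero h2 h2; norm_num at this; exact this
  have hm : (u1 - v1) ^ 2 + (u2 - v2) ^ 2 ≠ 0 := fun h => hd (H.anis _ _ h)
  have hp : 4 * u2 * v2 ≠ 0 := mul_ne_zero (mul_ne_zero h4 hu) hv
  have e1 := double_sum_step1 H u1 u2 v1 v2 hu hv hconj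
  rw [step4 H _ _ _ hd] at e1
  have e2 := step5 H ((u1 - v1) ^ 2 + (u2 - v2) ^ 2) (4 * u2 * v2)
  rw [step6, step7 H.char2, step8 _ _ hm hp] at e2
  set A := ∑ a : F, χ (ee i (u1 - a, u2) * ee i (v1 - a, v2))
  set c := csum (4 * ((u1 - v1) ^ 2 + (u2 - v2) ^ 2) ^ 2) (-4 * (4 * u2 * v2) * ((u1 - v1) ^ 2 + (u2 - v2) ^ 2) ^ 3) with hc
  have hA : A = χ (ee i (u1 - v1, u2 - v2)) * (c : ℂ) - 1 := by
    have : A + 1 = χ (ee i (u1 - v1, u2 - v2)) * (c : ℂ) := by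
      apply mul_left_cancel₀ (card_sub_one_ne H)
      rw [e1]
      push_cast at e2
      linear_combination (χ (ee i (u1 - v1, u2 - v2)) / 2) * e2
    rw [← this]; ring
  have hb := csum_bound H.char2 (4 * ((u1 - v1) ^ 2 + (u2 - v2) ^ 2) ^ 2) (-4 * (4 * u2 * v2) * ((u1 - v1) ^ 2 + (u2 - v2) ^ 2) ^ 3)
  rw [← hc] at hb
  calc ‖A‖ ≤ ‖χ (ee i (u1 - v1, u2 - v2)) * (c : ℂ)‖ + ‖(1 : ℂ)‖ := by rw [hA]; exact norm_sub_le _ _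
    _ ≤ 1 * |(c : ℝ)| + 1 := by
      rw [norm_mul, norm_one, Complex.norm_intCast]
      gcongr
      exact norm_chi_le H _
    _ ≤ _ := by linarith

end reduction

section final
variable {F K : Type} [Field F] [Fintype F] [DecidableEq F] [Field K] [Fintype K] [DecidableEq K] [Algebra F K]

lemma exists_gpow (g : Kˣ) (hg : ∀ y : Kˣ, y ∈ Subgroup.zpowers g) (x : K) (hx : x ≠ 0) : ∃ k : ℕ, x = (g : K) ^ k := by
  have h := hg (Units.mk0 x hx)
  rw [← mem_powers_iff_mem_zpowers] at h
  obtain ⟨k, hk⟩ := h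
  refine ⟨k, ?_⟩
  have := congrArg (fun y : Kˣ => (y : K)) hk
  simpa using this.symm

lemma setup_exists (q : ℕ) (hq4 : q % 4 = 3) (hF : Fintype.card F = q) (hK : Fintype.card K = q ^ 2)
    (g : Kˣ) (hg : ∀ y : Kˣ, y ∈ Subgroup.zpowers g) :
    ∃ (i : K) (χ : MulChar K ℂ), Setup F i χ ∧ χ (g : K) = Complex.I ∧
      ∀ x y : F, (ee i (x, y)) ^ q = ee i (x, -y) := by
  obtain ⟨t, ht⟩ : ∃ t, q = 4 * t + 3 := ⟨q / 4, by omega⟩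
  have hcF : ringChar F ≠ 2 := by
    intro h; have := FiniteField.even_card_of_char_two h; omega
  have hq2 : q ^ 2 = 4 * (4 * t ^ 2 + 6 * t + 2) + 1 := by rw [ht]; ring
  have hcK : ringChar K ≠ 2 := by
    intro h; have := FiniteField.even_card_of_char_two h; omega
  have hsF : ¬ IsSquare (-1 : F) := by
    rw [FiniteField.isSquare_neg_one_iff]; omega
  have hsK : IsSquare (-1 : K) := by
    rw [FiniteField.isSquare_neg_one_iff]; omega
  obtain ⟨i, hi⟩ := hsK
  have hcU : Fintype.card Kˣ = 4 * (4 * t ^ 2 + 6 * t + 2) := by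
    rw [Fintype.card_units]; omega
  set ζ : ℂˣ := Units.mk0 Complex.I Complex.I_ne_zero with hζ
  have hζm : ζ ∈ rootsOfUnity (Fintype.card Kˣ) ℂ := by
    rw [mem_rootsOfUnity, hcU, pow_mul]
    have : ζ ^ 4 = 1 := by ext; simp [hζ]
    rw [this, one_pow]
  set χ : MulChar K ℂ := MulChar.ofRootOfUnity hζm hg with hχ
  have hχg : χ (g : K) = Complex.I := MulChar.ofRootOfUnity_spec hζm hg
  have hχ4 : ∀ z : K, z ≠ 0 → χ z ^ 4 = 1 := by
    intro z hz
    obtain ⟨k, rfl⟩ := exists_gpow g hg z hz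
    rw [map_pow, hχg, ← pow_mul, mul_comm, pow_mul, Complex.I_pow_four, one_pow]
  have hi4 : i ^ 4 = 1 := by
    have : i ^ 4 = (i * i) ^ 2 := by ring
    rw [this, ← hi]; ring
  have hiq : i ^ q = -i := by
    rw [ht, pow_add, pow_mul, hi4, one_pow, one_mul]
    linear_combination (-i) * hi
  have hfrob : ∀ x y : F, (ee i (x, y)) ^ q = ee i (x, -y) := by
    intro x y
    have h := congrFun (FiniteField.coe_frobeniusAlgHom F K) (ee i (x, y))
    simp only [hF] at h
    rw [← h]
    have h' := congrFun (FiniteField.coe_frobeniusAlgHom F K) i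
    simp only [hF] at h'
    simp only [ee, map_add, map_mul, AlgHom.commutes, map_neg]
    rw [h', hiq]; ring
  have hanis : ∀ x y : F, x ^ 2 + y ^ 2 = 0 → x = 0 ∧ y = 0 := by
    intro x y h
    have hy : y = 0 := by
      by_contra hy
      apply hsF
      refine ⟨x / y, ?_⟩
      field_simp
      linear_combination -h
    subst hy
    refine ⟨?_, rfl⟩
    simpa using h
  have hmulconj : ∀ x y : F, ee i (x, y) * ee i (x, -y) = algebraMap F K (x ^ 2 + y ^ 2) := by
    intro x y
    rw [ee_mul i hi.symm]
    have : x * -y + y * x = 0 := by ring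
    rw [this]
    simp only [ee, map_zero, zero_mul, add_zero]
    congr 1; ring
  have hinj : Function.Injective (ee (F := F) i) := by
    rintro ⟨a, b⟩ ⟨c, d⟩ h
    have h0 : ee i (a - c, b - d) = 0 := by
      simp only [ee, map_sub] at h ⊢
      linear_combination h
    have h1 := hmulconj (a - c) (b - d)
    rw [h0, zero_mul] at h1
    have h2 := (map_eq_zero (algebraMap F K)).1 h1.symm
    have h3 := hanis _ _ h2
    ext
    · exact sub_eq_zero.1 h3.1
    · exact sub_eq_zero.1 h3.2
  have hbij : Function.Bijective (ee (F := F) i) := by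
    rw [Fintype.bijective_iff_injective_and_card]
    refine ⟨hinj, ?_⟩
    rw [Fintype.card_prod, hF, hK]; ring
  have hord : orderOf g = Fintype.card Kˣ := orderOf_eq_card_of_forall_mem_zpowers hg |>.trans Nat.card_eq_fintype_card
  have htriv : ∀ c : F, c ≠ 0 → χ (algebraMap F K c) = 1 := by
    intro c hc
    have hc' : algebraMap F K c ≠ 0 := (_root_.map_ne_zero (algebraMap F K)).2 hc
    obtain ⟨k, hk⟩ := exists_gpow g hg _ hc'
    have h1 : (algebraMap F K c) ^ (q - 1) = 1 := by
      rw [← map_pow, ← hF, FiniteField.pow_card_sub_one_eq_one c hc, map_one]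
    rw [hk, ← pow_mul] at h1
    have h2 : g ^ (k * (q - 1)) = 1 := by
      ext; push_cast; exact h1
    have h3 := orderOf_dvd_of_pow_eq_one h2
    have h4 : 4 * (4 * t ^ 2 + 6 * t + 2) = (4 * t + 4) * (4 * t + 2) := by ring
    have h5 : q - 1 = 4 * t + 2 := by omega
    rw [hord, hcU, h4, h5] at h3
    have h6 := Nat.dvd_of_mul_dvd_mul_right (by omega) h3
    have h7 : 4 ∣ k := dvd_trans ⟨t + 1, by ring⟩ h6
    obtain ⟨n, hn⟩ := h7
    rw [hk, map_pow, hχg, hn, pow_mul, Complex.I_pow_four, one_pow]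
  have hqKg : quadraticChar K (g : K) = -1 := by
    rcases quadraticChar_dichotomy g.ne_zero with h | h
    · exfalso
      apply quadraticChar_ne_one hcK
      rw [MulChar.eq_iff hg, h]; simp
    · exact h
  have hqK : ∀ x : K, χ x ^ 2 = ((quadraticChar K x : ℤ) : ℂ) := by
    intro x
    by_cases hx : x = 0
    · subst hx; simp [MulChar.map_zero]
    obtain ⟨k, rfl⟩ := exists_gpow g hg _ hx
    rw [map_pow, map_pow, hχg, hqKg, ← pow_mul, mul_comm, pow_mul, Complex.I_sq]
    push_cast; rfl
  have hqF : ∀ x y : F, quadraticChar K (ee i (x, y)) = quadraticChar F (x ^ 2 + y ^ 2) := by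
    intro x y
    have memK : quadraticChar K (ee i (x, y)) ∈ ({0, 1, -1} : Set ℤ) := by
      rcases quadraticChar_isQuadratic K (ee i (x, y)) with h | h | h <;> simp [h]
    have memF : quadraticChar F (x ^ 2 + y ^ 2) ∈ ({0, 1, -1} : Set ℤ) := by
      rcases quadraticChar_isQuadratic F (x ^ 2 + y ^ 2) with h | h | h <;> simp [h]
    apply Int.cast_injOn_of_ringChar_ne_two hcK memK memF
    rw [quadraticChar_eq_pow_of_char_ne_two' hcK]
    have e1 : Fintype.card K / 2 = (q + 1) * (q / 2) := by
      have : q / 2 = 2 * t + 1 := by omega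
      rw [hK, hq2, this, ht]
      have : (4 * t + 3 + 1) * (2 * t + 1) = 2 * (4 * t ^ 2 + 6 * t + 2) := by ring
      omega
    rw [e1, pow_mul, pow_succ', hfrob, hmulconj, ← map_pow, ← hF, ← quadraticChar_eq_pow_of_char_ne_two' hcF]
    simp
  refine ⟨i, χ, ⟨hcF, hi.symm, hbij, hanis, htriv, ?_, hqK, ?_, hcK, ?_⟩, hχg, hfrob⟩
  · intro x y; rw [hqK, hqF]
  · intro x y
    rw [← hfrob, map_pow]
    by_cases hz : ee i (x, y) = 0
    · rw [hz, MulChar.map_zero, zero_pow (by omega), zero_pow (by omega)]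
    · rw [ht, pow_add, pow_mul, hχ4 _ hz, one_pow, one_mul]
  · intro h
    rw [h, MulChar.one_apply_coe] at hχg
    have := congrArg Complex.im hχg
    simp at this

lemma ind_S (g : Kˣ) (hg : ∀ y : Kˣ, y ∈ Subgroup.zpowers g) (χ : MulChar K ℂ) (hχg : χ (g : K) = Complex.I)
    (S : Set K) (hS : S = {x : K | ∃ j : ℕ, x = (g : K) ^ (4 * j) ∨ x = (g : K) ^ (4 * j + 1)}) (x : K) (hx : x ≠ 0) :
    (x ∈ S ∧ (χ x).re + (χ x).im = 1) ∨ (x ∉ S ∧ (χ x).re + (χ x).im = -1) := by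
  have h4 : ∀ j, χ ((g : K) ^ (4 * j)) = 1 := by
    intro j; rw [map_pow, hχg, pow_mul, Complex.I_pow_four, one_pow]
  have hmem : x ∈ S → (χ x).re + (χ x).im = 1 := by
    rw [hS]
    rintro ⟨j, rfl | rfl⟩
    · rw [h4]; simp
    · rw [pow_succ, map_mul, h4, hχg]; simp
  obtain ⟨k, hk⟩ := exists_gpow g hg x hx
  have hk4 : k = 4 * (k / 4) + k % 4 := by omega
  have hlt : k % 4 < 4 := Nat.mod_lt _ (by norm_num)
  generalize k / 4 = j at hk4
  generalize k % 4 = r at hk4 hlt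
  subst hk4
  have hv : χ x = Complex.I ^ r := by
    rw [hk, pow_add, map_mul, h4, map_pow, hχg, one_mul]
  have hin : r = 0 ∨ r = 1 → x ∈ S := by
    rw [hS]
    rintro (rfl | rfl)
    · exact ⟨j, Or.inl hk⟩
    · exact ⟨j, Or.inr hk⟩
  by_cases hr : r = 0 ∨ r = 1
  · exact Or.inl ⟨hin hr, hmem (hin hr)⟩
  · have : (χ x).re + (χ x).im = -1 := by
      have : r = 2 ∨ r = 3 := by omega
      rcases this with rfl | rfl
      · rw [hv, Complex.I_sq]; simp
      · rw [hv, pow_succ, Complex.I_sq]; simp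
    refine Or.inr ⟨fun h => ?_, this⟩
    have := hmem h
    linarith

end final

section count
variable {F K : Type} [Field F] [Fintype F] [DecidableEq F] [Field K] [Fintype K] [DecidableEq K] [Algebra F K]

lemma conj_chi {i : K} {χ : MulChar K ℂ} (H : Setup F i χ) (g : Kˣ) (hg : ∀ y : Kˣ, y ∈ Subgroup.zpowers g)
    (hχg : χ (g : K) = Complex.I) (x y : F) :
    (starRingEnd ℂ) (χ (ee i (x, y))) = χ (ee i (x, -y)) := by
  rw [H.cube]
  by_cases hz : ee i (x, y) = 0
  · rw [hz, MulChar.map_zero]; simp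
  obtain ⟨k, hk⟩ := exists_gpow g hg _ hz
  rw [hk, map_pow, hχg, map_pow, Complex.conj_I, ← pow_mul, mul_comm, pow_mul]
  congr 1
  rw [pow_succ, Complex.I_sq]; ring

lemma count_bound {i : K} {χ : MulChar K ℂ} (H : Setup F i χ) (g : Kˣ) (hg : ∀ y : Kˣ, y ∈ Subgroup.zpowers g)
    (hχg : χ (g : K) = Complex.I)
    (S : Set K) (hS : S = {x : K | ∃ j : ℕ, x = (g : K) ^ (4 * j) ∨ x = (g : K) ^ (4 * j + 1)})
    (u1 u2 v1 v2 : F) (hu : u2 ≠ 0) (hv : v2 ≠ 0) (hne : ¬ (v1 = u1 ∧ v2 = u2))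
    (hconj : ¬ (v1 = u1 ∧ v2 = - u2)) :
    4 * (Set.ncard {x : F | ee i (u1 - x, u2) ∈ S ∧ ee i (v1 - x, v2) ∈ S} : ℝ) ≤
      (Fintype.card F : ℝ) + 4 * Real.sqrt (Fintype.card F) + 2 := by
  classical
  have hnz : ∀ x y : F, y ≠ 0 → ee i (x, y) ≠ 0 := by
    intro x y hy h
    have h0 : ee i ((0 : F), (0 : F)) = 0 := by simp [ee]
    have := H.bij.1 (h.trans h0.symm)
    simp only [Prod.mk.injEq] at this
    exact hy this.2
  set s : K → ℝ := fun z => (χ z).re + (χ z).im with hs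
  have hcard : (4 : ℝ) * (Set.ncard {x : F | ee i (u1 - x, u2) ∈ S ∧ ee i (v1 - x, v2) ∈ S} : ℝ) =
      ∑ a : F, (1 + s (ee i (u1 - a, u2))) * (1 + s (ee i (v1 - a, v2))) := by
    have e : {x : F | ee i (u1 - x, u2) ∈ S ∧ ee i (v1 - x, v2) ∈ S} =
        ((Finset.univ.filter fun x : F => ee i (u1 - x, u2) ∈ S ∧ ee i (v1 - x, v2) ∈ S : Finset F) : Set F) := by
      ext; simp
    rw [e, Set.ncard_coe_finset, Finset.card_filter]
    push_cast
    rw [Finset.mul_sum]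
    apply Finset.sum_congr rfl
    intro a _
    rcases ind_S g hg χ hχg S hS _ (hnz (u1 - a) u2 hu) with ⟨h1, h2⟩ | ⟨h1, h2⟩ <;>
    rcases ind_S g hg χ hχg S hS _ (hnz (v1 - a) v2 hv) with ⟨h3, h4⟩ | ⟨h3, h4⟩ <;>
    · simp only [h1, h3, hs, h2, h4]; norm_num
  have hsing : ∀ w1 w2 : F, w2 ≠ 0 → ∑ a : F, s (ee i (w1 - a, w2)) = -1 := by
    intro w1 w2 hw
    have h := single_sum H w1 w2 hw
    have hr := congrArg Complex.re h
    have him := congrArg Complex.im h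
    rw [Complex.re_sum] at hr
    rw [Complex.im_sum] at him
    simp only [hs, Finset.sum_add_distrib]
    rw [hr, him]; simp
  have hprod : ∑ a : F, s (ee i (u1 - a, u2)) * s (ee i (v1 - a, v2)) =
      (∑ a : F, χ (ee i (u1 - a, u2) * ee i (v1 - a, -v2))).re + (∑ a : F, χ (ee i (u1 - a, u2) * ee i (v1 - a, v2))).im := by
    rw [Complex.re_sum, Complex.im_sum, ← Finset.sum_add_distrib]
    apply Finset.sum_congr rfl
    intro a _
    rw [map_mul, map_mul, ← conj_chi H g hg hχg]
    simp only [hs, Complex.mul_re, Complex.mul_im, Complex.conj_re, Complex.conj_im]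
    ring
  have b1 := double_bound H u1 u2 v1 v2 hu hv hne hconj
  have b2 := double_bound H u1 u2 v1 (-v2) hu (neg_ne_zero.2 hv)
    (fun h => hconj ⟨h.1, by rw [← h.2, neg_neg]⟩) (fun h => hne ⟨h.1, neg_inj.1 h.2⟩)
  have c1 := (Complex.abs_im_le_norm _).trans b1
  have c2 := (Complex.abs_re_le_norm _).trans b2
  have d1 := (le_abs_self _).trans c1
  have d2 := (le_abs_self _).trans c2
  rw [hcard]
  have : ∀ a : F, (1 + s (ee i (u1 - a, u2))) * (1 + s (ee i (v1 - a, v2))) =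
     1 + s (ee i (u1 - a, u2)) + s (ee i (v1 - a, v2)) + s (ee i (u1 - a, u2)) * s (ee i (v1 - a, v2)) := by
    intro a; ring
  rw [Finset.sum_congr rfl fun a _ => this a, Finset.sum_add_distrib, Finset.sum_add_distrib, Finset.sum_add_distrib,
    hsing u1 u2 hu, hsing v1 v2 hv, hprod]
  simp only [Finset.sum_const, Finset.card_univ, nsmul_eq_mul, mul_one]
  linarith

end count
end Peisert

/-- Bound on the common F_q-neighborhood of two non-conjugate elements of F_{q^2} \ F_q in
the Peisert graph: |N(u) ∩ N(v)| ≤ q/4 + ((√2 + 3)/2)√q. -/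
theorem stmt19 (q : ℕ) (hq4 : q % 4 = 3) (hq83 : 83 ≤ q)
    (F K : Type) [Field F] [Field K] [Fintype F] [Fintype K] [Algebra F K]
    (hF : Fintype.card F = q) (hK : Fintype.card K = q ^ 2)
    (g : Kˣ) (hg : ∀ y : Kˣ, y ∈ Subgroup.zpowers g)
    (S : Set K)
    (hS : S = {x : K | ∃ j : ℕ, x = (g : K) ^ (4 * j) ∨ x = (g : K) ^ (4 * j + 1)})
    (u v : K) (hu : u ∉ Set.range (algebraMap F K)) (hv : v ∉ Set.range (algebraMap F K))
    (huv : v ≠ u ∧ v ≠ u ^ q) :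
    (Set.ncard {x : F | u - algebraMap F K x ∈ S ∧ v - algebraMap F K x ∈ S} : ℝ)
      ≤ (q : ℝ) / 4 + ((Real.sqrt 2 + 3) / 2) * Real.sqrt q := by
  classical
  obtain ⟨i, χ, H, hχg, hfrob⟩ := Peisert.setup_exists q hq4 hF hK g hg
  obtain ⟨⟨u1, u2⟩, rfl⟩ := H.bij.2 u
  obtain ⟨⟨v1, v2⟩, rfl⟩ := H.bij.2 v
  have h1 : u2 ≠ 0 := by
    rintro rfl; exact hu ⟨u1, by simp [Peisert.ee]⟩
  have h2 : v2 ≠ 0 := by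
    rintro rfl; exact hv ⟨v1, by simp [Peisert.ee]⟩
  have h3 : ¬ (v1 = u1 ∧ v2 = u2) := by
    rintro ⟨rfl, rfl⟩; exact huv.1 rfl
  have h4 : ¬ (v1 = u1 ∧ v2 = - u2) := by
    rintro ⟨rfl, rfl⟩; exact huv.2 (hfrob _ _).symm
  have hb := Peisert.count_bound H g hg hχg S hS u1 u2 v1 v2 h1 h2 h3 h4
  have e : ∀ a b x : F, Peisert.ee i (a, b) - algebraMap F K x = Peisert.ee i (a - x, b) := by
    intro a b x; simp only [Peisert.ee, map_sub]; ring
  simp only [e]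
  rw [hF] at hb
  have hs2 : 1 ≤ Real.sqrt 2 := Real.one_le_sqrt.2 (by norm_num)
  have hsq : 1 ≤ Real.sqrt q := Real.one_le_sqrt.2 (by exact_mod_cast (by omega : 1 ≤ q))
  nlinarith
end
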